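/- arXiv:1804.10674 — 9 statements merged into one kernel-verified Lean document; each statement's English description precedes it below -/
import Mathlib

section
/- Let X be a real Banach space such that the closed convex hull of the set of extreme points of the closed unit ball B_X has non-empty interior in X. Then every convex body K ⊂ X has the strong Mankiewicz property: every surjective isometry T from K onto an arbitrary convex subset L of any real normed space Y is affine. -/
/-- A convex subset `K` of a real normed space `X` has the *strong Mankiewicz property* if
every surjective isometry `T` from `K` onto an arbitrary convex subset `L` of an arbitrary
real normed space `Y` is affine. -/
def StrongMankiewiczProp {X : Type*} [NormedAddCommGroup X] [NormedSpace ℝ X]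
    (K : Set X) : Prop :=
  ∀ (Y : Type*) [NormedAddCommGroup Y] [NormedSpace ℝ Y] (L : Set Y), Convex ℝ L →
    ∀ T : X → Y, (∀ x ∈ K, ∀ y ∈ K, dist (T x) (T y) = dist x y) → T '' K = L →
      ∀ x ∈ K, ∀ y ∈ K, ∀ α ∈ Set.Icc (0 : ℝ) 1,
        T (α • x + (1 - α) • y) = α • T x + (1 - α) • T y

open Set Filter Topology

/-- `E` is the only metric midpoint of `0` and `2 • E`. -/
def UniqueMidpoint {X : Type*} [NormedAddCommGroup X] (E : X) : Prop :=
  ∀ z : X, ‖z‖ ≤ ‖E‖ → ‖E + E - z‖ ≤ ‖E‖ → z = E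

/-- `T` preserves the distances between points of `K`. -/
def IsometricOn {X Y : Type*} [NormedAddCommGroup X] [NormedAddCommGroup Y]
    (T : X → Y) (K : Set X) : Prop :=
  ∀ x ∈ K, ∀ y ∈ K, dist (T x) (T y) = dist x y

theorem IsometricOn.continuousOn {X Y : Type*} [NormedAddCommGroup X] [NormedAddCommGroup Y]
    {T : X → Y} {K : Set X} (hT : IsometricOn T K) :
    ContinuousOn T K :=
  (LipschitzOnWith.of_dist_le_mul (K := 1) fun x hx y hy => by
    simp [hT x hx y hy]).continuousOn

/-- A point of the image at distance at most `‖E‖` from the images of `z` and `z + 2 • E` is the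
image of `z + E`. -/
theorem IsometricOn.eq_map_add {X Y : Type*} [NormedAddCommGroup X] [NormedAddCommGroup Y]
    {T : X → Y} {K : Set X} (hT : IsometricOn T K) {z E : X}
    (hE : UniqueMidpoint E) (hz : z ∈ K) (hz' : z + E + E ∈ K) {q : Y} (hq : q ∈ T '' K)
    (h₁ : ‖q - T z‖ ≤ ‖E‖) (h₂ : ‖T (z + E + E) - q‖ ≤ ‖E‖) : q = T (z + E) := by
  obtain ⟨k, hk, rfl⟩ := hq
  rw [← dist_eq_norm, hT _ hk _ hz, dist_eq_norm] at h₁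
  rw [← dist_eq_norm, hT _ hz' _ hk, dist_eq_norm] at h₂
  have := hE (k - z) h₁ (by rwa [show E + E - (k - z) = z + E + E - k by abel])
  rw [← this, add_sub_cancel]

section

variable {X Y : Type*} [NormedAddCommGroup X] [NormedSpace ℝ X]
  [NormedAddCommGroup Y] [NormedSpace ℝ Y]

theorem UniqueMidpoint.smul {E : X} (hE : UniqueMidpoint E) (c : ℝ) :
    UniqueMidpoint (c • E) := by
  intro z h₁ h₂
  rcases eq_or_ne c 0 with rfl | hc
  · simpa using h₁
  have hc' : 0 < ‖c‖ := norm_pos_iff.mpr hc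
  have key : c⁻¹ • z = E := by
    apply hE
    · rw [norm_smul, norm_inv, inv_mul_le_iff₀ hc', ← norm_smul]
      exact h₁
    · have : E + E - c⁻¹ • z = c⁻¹ • (c • E + c • E - z) := by
        rw [smul_sub, smul_add, inv_smul_smul₀ hc]
      rw [this, norm_smul, norm_inv, inv_mul_le_iff₀ hc', ← norm_smul]
      exact h₂
  rw [← key, smul_inv_smul₀ hc]

theorem uniqueMidpoint_of_mem_extremePoints {e : X}
    (he : e ∈ extremePoints ℝ (Metric.closedBall (0 : X) 1)) : UniqueMidpoint e := by
  intro z h₁ h₂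
  have h1 : ‖e‖ ≤ 1 := by simpa using he.1
  refine he.2 (x₁ := z) (x₂ := e + e - z) ?_ ?_ ⟨1 / 2, 1 / 2, by norm_num, by norm_num,
    by norm_num, by module⟩
  · simpa using h₁.trans h1
  · simpa using h₂.trans h1

theorem IsometricOn.map_add_half {T : X → Y} {K : Set X} (hT : IsometricOn T K)
    (hL : Convex ℝ (T '' K)) {z E : X} (hE : UniqueMidpoint E) (hz : z ∈ K) (hz' : z + E ∈ K) :
    T (z + (1 / 2 : ℝ) • E) = (1 / 2 : ℝ) • T z + (1 / 2 : ℝ) • T (z + E) := by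
  have e : z + (1 / 2 : ℝ) • E + (1 / 2 : ℝ) • E = z + E := by module
  have hd : ‖T (z + E) - T z‖ = ‖E‖ := by
    rw [← dist_eq_norm, hT _ hz' _ hz, dist_eq_norm, add_sub_cancel_left]
  have hh : ‖(1 / 2 : ℝ) • (T (z + E) - T z)‖ ≤ ‖(1 / 2 : ℝ) • E‖ := by
    rw [norm_smul, norm_smul, hd]
  symm
  refine hT.eq_map_add (hE.smul _) hz (e ▸ hz') (hL (mem_image_of_mem T hz)
    (mem_image_of_mem T hz') (by norm_num) (by norm_num) (by norm_num)) ?_ ?_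
  · convert hh using 2; module
  · rw [e]; convert hh using 2; module

/-- A surjective isometry between convex sets maps parallelograms whose sides have unique
midpoints to parallelograms. -/
theorem IsometricOn.map_parallelogram {T : X → Y} {K : Set X} (hT : IsometricOn T K)
    (hK : Convex ℝ K) (hL : Convex ℝ (T '' K)) {x E G : X} (hE : UniqueMidpoint E)
    (hG : UniqueMidpoint G) (hx : x ∈ K) (hxE : x + E ∈ K) (hxG : x + G ∈ K)
    (hxEG : x + E + G ∈ K) :
    T (x + E + G) - T (x + E) = T (x + G) - T x := by
  have half_mem : ∀ {u v : X}, u ∈ K → v ∈ K → (1 / 2 : ℝ) • u + (1 / 2 : ℝ) • v ∈ K :=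
    fun hu hv => hK hu hv (by norm_num) (by norm_num) (by norm_num)
  have half_mem' : ∀ {u v : Y}, u ∈ T '' K → v ∈ T '' K →
      (1 / 2 : ℝ) • u + (1 / 2 : ℝ) • v ∈ T '' K :=
    fun hu hv => hL hu hv (by norm_num) (by norm_num) (by norm_num)
  have m₀ := hT.map_add_half hL hG hx hxG
  have m₁ := hT.map_add_half hL hG hxE hxEG
  have hm₀ : x + (1 / 2 : ℝ) • G ∈ K := by
    convert half_mem hx hxG using 1; module
  have hm₁ : x + E + (1 / 2 : ℝ) • G ∈ K := by
    convert half_mem hxE hxEG using 1; module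
  have hm₁' : x + (1 / 2 : ℝ) • G + E ∈ K := by rwa [add_right_comm]
  have n := hT.map_add_half hL hE hm₀ hm₁'
  have hn : x + (1 / 2 : ℝ) • G + (1 / 2 : ℝ) • E ∈ K := by
    convert half_mem hm₀ hm₁' using 1; module
  have e : x + (1 / 2 : ℝ) • G + (1 / 2 : ℝ) • E + (1 / 2 : ℝ) • E =
      x + E + (1 / 2 : ℝ) • G := by module
  have r := hT.map_add_half hL (hE.smul (1 / 2)) hn (e ▸ hm₁)
  have e' : x + (1 / 2 : ℝ) • G + (1 / 2 : ℝ) • E + (1 / 2 : ℝ) • (1 / 2 : ℝ) • E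
      + (1 / 2 : ℝ) • (1 / 2 : ℝ) • E = x + E + (1 / 2 : ℝ) • G := by module
  rw [add_right_comm x _ E, m₀, m₁] at n
  rw [e, n, m₁] at r
  have d₀ : ‖T (x + E) - T x‖ = ‖E‖ := by
    rw [← dist_eq_norm, hT _ hxE _ hx, dist_eq_norm, add_sub_cancel_left]
  have d₁ : ‖T (x + E + G) - T (x + G)‖ = ‖E‖ := by
    rw [← dist_eq_norm, hT _ hxEG _ hxG, dist_eq_norm]
    congr 1; abel
  have q := hT.eq_map_add ((hE.smul (1 / 2)).smul (1 / 2)) hn (e' ▸ hm₁)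
    (half_mem' (mem_image_of_mem T hm₁)
      (half_mem' (mem_image_of_mem T hx) (mem_image_of_mem T hxEG)))
    (by
      have : ‖(1 / 2 : ℝ) • (1 / 2 : ℝ) • (T (x + E + G) - T (x + G))‖ ≤
          ‖(1 / 2 : ℝ) • (1 / 2 : ℝ) • E‖ := by simp only [norm_smul, d₁, le_refl]
      rw [m₁, n]; convert this using 2; module)
    (by
      have : ‖(1 / 2 : ℝ) • (1 / 2 : ℝ) • (T (x + E) - T x)‖ ≤
          ‖(1 / 2 : ℝ) • (1 / 2 : ℝ) • E‖ := by simp only [norm_smul, d₀, le_refl]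
      rw [e', m₁]; convert this using 2; module)
  rw [r, m₁] at q
  rw [← sub_eq_zero] at q ⊢
  have := congrArg (fun y => (8 : ℝ) • y) q
  simp only [smul_zero] at this
  rw [← this]
  module

/-- A continuous function on an open convex set that is invariant under translations in the
directions of a set with dense span is constant. -/
theorem eq_of_invariant_of_dense_span {S V : Set X} (hS : Dense (Submodule.span ℝ S : Set X))
    (hV : Convex ℝ V) (hVo : IsOpen V) {F : X → Y} (hF : ContinuousOn F V)
    (hinv : ∀ e ∈ S, ∀ x ∈ V, ∀ t : ℝ, x + t • e ∈ V → F (x + t • e) = F x)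
    {x y : X} (hx : x ∈ V) (hy : y ∈ V) : F y = F x := by
  have hcont : ∀ h z : X, Tendsto (fun p : X × ℝ => p.1 + p.2 • h) (𝓝 (z, 0)) (𝓝 z) := by
    intro h z
    have : Continuous (fun p : X × ℝ => p.1 + p.2 • h) := by fun_prop
    simpa using this.tendsto (z, 0)
  have hloc : ∀ h ∈ Submodule.span ℝ S, ∀ z ∈ V,
      ∀ᶠ p : X × ℝ in 𝓝 (z, 0), F (p.1 + p.2 • h) = F p.1 := by
    intro h hh
    induction hh using Submodule.span_induction with
    | mem e he =>
      intro z hz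
      filter_upwards [hcont e z (hVo.mem_nhds hz),
        continuous_fst.continuousAt (x := (z, (0 : ℝ))) (hVo.mem_nhds hz)] with p h₁ h₂
      exact hinv e he _ h₂ _ h₁
    | zero => simp
    | add h₁ h₂ _ _ ih₁ ih₂ =>
      intro z hz
      have : Tendsto (fun p : X × ℝ => (p.1 + p.2 • h₁, p.2)) (𝓝 (z, 0)) (𝓝 (z, 0)) :=
        (hcont h₁ z).prodMk_nhds (continuous_snd.tendsto (z, (0 : ℝ)))
      filter_upwards [ih₁ z hz, this.eventually (ih₂ z hz)] with p q₁ q₂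
      rw [smul_add, ← add_assoc, q₂, q₁]
    | smul c h _ ih =>
      intro z hz
      have : Tendsto (fun p : X × ℝ => (p.1, p.2 * c)) (𝓝 (z, 0)) (𝓝 (z, 0)) := by
        have : Continuous (fun p : X × ℝ => (p.1, p.2 * c)) := by fun_prop
        simpa using this.tendsto (z, 0)
      filter_upwards [this.eventually (ih z hz)] with p q
      rwa [smul_smul]
  have hglob : ∀ h ∈ Submodule.span ℝ S, x + h ∈ V → F (x + h) = F x := by
    intro h hh hxh
    have hmem : ∀ t ∈ Icc (0 : ℝ) 1, x + t • h ∈ V := fun t ht => by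
      simpa using hV.add_smul_mem hx hxh ht
    have := constant_of_has_deriv_right_zero (f := fun t : ℝ => F (x + t • h)) (a := 0) (b := 1)
      (hF.comp (by fun_prop) hmem) ?_ 1 (by simp)
    · simpa using this
    · intro t ht
      have htend : Tendsto (fun s : ℝ => (x + t • h, s - t)) (𝓝 t) (𝓝 (x + t • h, 0)) := by
        have : Continuous (fun s : ℝ => (x + t • h, s - t)) := by fun_prop
        simpa using this.tendsto t
      refine ((hasDerivAt_const t (F (x + t • h))).congr_of_eventuallyEq ?_).hasDerivWithinAt
      filter_upwards [htend.eventually (hloc h hh _ (hmem t (Ico_subset_Icc_self ht)))] with s hs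
      rw [← hs]
      congr 1; module
  obtain ⟨u, hu, hlim⟩ := mem_closure_iff_seq_limit.mp (hS (y - x))
  have hlim' : Tendsto (fun n => x + u n) atTop (𝓝 y) := by
    simpa using hlim.const_add x
  have hFlim := ((hF.continuousAt (hVo.mem_nhds hy)).tendsto).comp hlim'
  refine tendsto_nhds_unique hFlim (tendsto_const_nhds.congr' ?_)
  filter_upwards [hlim'.eventually (hVo.mem_nhds hy)] with n hn
  exact (hglob _ (hu n) hn).symm

/-- A bounded function on `[0, 1]` that respects midpoints is determined by its endpoints. -/
theorem eq_of_bounded_of_midpoint {φ : ℝ → Y} {M : ℝ} (hM : ∀ t ∈ Icc (0 : ℝ) 1, ‖φ t‖ ≤ M)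
    (hmid : ∀ s ∈ Icc (0 : ℝ) 1, ∀ t ∈ Icc (0 : ℝ) 1,
      φ ((s + t) / 2) = (1 / 2 : ℝ) • φ s + (1 / 2 : ℝ) • φ t)
    {t : ℝ} (ht : t ∈ Icc (0 : ℝ) 1) : φ t = t • φ 1 + (1 - t) • φ 0 := by
  set ψ : ℝ → Y := fun t => φ t - (t • φ 1 + (1 - t) • φ 0) with hψ
  have hhalf : ∀ t ∈ Icc (0 : ℝ) 1, ∃ s ∈ Icc (0 : ℝ) 1, ψ t = (1 / 2 : ℝ) • ψ s := by
    intro t ht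
    rcases le_total t (1 / 2) with h | h
    · refine ⟨2 * t, ⟨by linarith [ht.1], by linarith⟩, ?_⟩
      have := hmid (2 * t) ⟨by linarith [ht.1], by linarith⟩ 0 (by simp)
      rw [show (2 * t + 0) / 2 = t by ring] at this
      simp only [hψ, this]
      module
    · refine ⟨2 * t - 1, ⟨by linarith, by linarith [ht.2]⟩, ?_⟩
      have := hmid (2 * t - 1) ⟨by linarith, by linarith [ht.2]⟩ 1 (by simp)
      rw [show (2 * t - 1 + 1) / 2 = t by ring] at this
      simp only [hψ, this]
      module
  have hb : ∀ t ∈ Icc (0 : ℝ) 1, ‖ψ t‖ ≤ 3 * M := by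
    intro t ht
    have h0 := hM 0 (by simp)
    have h1 := hM 1 (by simp)
    have e1 : ‖t • φ 1‖ ≤ M := by
      rw [norm_smul, Real.norm_of_nonneg ht.1]
      nlinarith [ht.1, ht.2, norm_nonneg (φ 1)]
    have e0 : ‖(1 - t) • φ 0‖ ≤ M := by
      rw [norm_smul, Real.norm_of_nonneg (by linarith [ht.2])]
      nlinarith [ht.1, ht.2, norm_nonneg (φ 0)]
    linarith [norm_sub_le (φ t) (t • φ 1 + (1 - t) • φ 0), hM t ht,
      norm_add_le (t • φ 1) ((1 - t) • φ 0)]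
  have hn : ∀ n : ℕ, ∀ t ∈ Icc (0 : ℝ) 1, ‖ψ t‖ ≤ (1 / 2) ^ n * (3 * M) := by
    intro n
    induction n with
    | zero => simpa using hb
    | succ n ih =>
      intro t ht
      obtain ⟨s, hs, e⟩ := hhalf t ht
      rw [e, norm_smul, pow_succ', mul_assoc, Real.norm_of_nonneg (by norm_num)]
      exact mul_le_mul_of_nonneg_left (ih s hs) (by norm_num)
  have hlim : Tendsto (fun n : ℕ => (1 / 2 : ℝ) ^ n * (3 * M)) atTop (𝓝 0) := by
    simpa using (tendsto_pow_atTop_nhds_zero_of_lt_one (r := (1 / 2 : ℝ)) (by norm_num)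
      (by norm_num)).mul_const (3 * M)
  have h0 : ‖ψ t‖ ≤ 0 := ge_of_tendsto' hlim fun n => hn n t ht
  exact sub_eq_zero.mp (norm_le_zero_iff.mp h0)

theorem dense_span_of_interior_closure_convexHull {S : Set X}
    (hS : (interior (closure (convexHull ℝ S))).Nonempty) :
    Dense (Submodule.span ℝ S : Set X) := by
  rw [Submodule.dense_iff_topologicalClosure_eq_top]
  refine Submodule.eq_top_of_nonempty_interior' _ (hS.mono (interior_mono ?_))
  rw [Submodule.topologicalClosure_coe]
  exact closure_mono (convexHull_min Submodule.subset_span (Submodule.convex _))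

/-- If the directions with unique midpoints span a dense subspace, a surjective isometry between
convex sets respects midpoints in the interior of its domain. -/
theorem IsometricOn.map_midpoint_interior {T : X → Y} {K S : Set X} (hT : IsometricOn T K)
    (hK : Convex ℝ K) (hL : Convex ℝ (T '' K)) (hS : Dense (Submodule.span ℝ S : Set X))
    (hSu : ∀ e ∈ S, UniqueMidpoint e) {x y : X} (hx : x ∈ interior K) (hy : y ∈ interior K) :
    T ((1 / 2 : ℝ) • x + (1 / 2 : ℝ) • y) = (1 / 2 : ℝ) • T x + (1 / 2 : ℝ) • T y := by
  have hU : Convex ℝ (interior K) := hK.interior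
  have hVc : ∀ h : X, Convex ℝ (interior K ∩ (fun z => z + h) ⁻¹' interior K) :=
    fun h => hU.inter (hU.translate_preimage_left h)
  have hVo : ∀ h : X, IsOpen (interior K ∩ (fun z => z + h) ⁻¹' interior K) :=
    fun h => isOpen_interior.inter (isOpen_interior.preimage (by fun_prop))
  have hcont : ContinuousOn T (interior K) := hT.continuousOn.mono interior_subset
  have hD : ∀ h : X, ContinuousOn (fun z => T (z + h) - T z)
      (interior K ∩ (fun z => z + h) ⁻¹' interior K) := fun h =>
    (hcont.comp (by fun_prop) fun z hz => hz.2).sub (hcont.mono inter_subset_left)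
  have hdir : ∀ e ∈ S, ∀ (t : ℝ) (u v : X), u ∈ interior K → u + t • e ∈ interior K →
      v ∈ interior K → v + t • e ∈ interior K →
      T (v + t • e) - T v = T (u + t • e) - T u := by
    intro e he t u v hu hu' hv hv'
    refine eq_of_invariant_of_dense_span hS (hVc (t • e)) (hVo _) (hD _) ?_ ⟨hu, hu'⟩ ⟨hv, hv'⟩
    intro g hg z hz s hzs
    exact hT.map_parallelogram hK hL ((hSu g hg).smul s) ((hSu e he).smul t)
      (interior_subset hz.1) (interior_subset hzs.1) (interior_subset hz.2)
      (interior_subset hzs.2)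
  have hm : (1 / 2 : ℝ) • x + (1 / 2 : ℝ) • y ∈ interior K :=
    hU hx hy (by norm_num) (by norm_num) (by norm_num)
  have e₁ : x + (1 / 2 : ℝ) • (y - x) = (1 / 2 : ℝ) • x + (1 / 2 : ℝ) • y := by module
  have e₂ : (1 / 2 : ℝ) • x + (1 / 2 : ℝ) • y + (1 / 2 : ℝ) • (y - x) = y := by module
  have key := eq_of_invariant_of_dense_span hS (hVc ((1 / 2 : ℝ) • (y - x))) (hVo _) (hD _)
    (x := x) (y := (1 / 2 : ℝ) • x + (1 / 2 : ℝ) • y) ?_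
    ⟨hx, by rwa [mem_preimage, e₁]⟩ ⟨hm, by rwa [mem_preimage, e₂]⟩
  · simp only [e₁, e₂] at key
    rw [sub_eq_sub_iff_add_eq_add] at key
    rw [← smul_add (1 / 2 : ℝ) (T x), add_comm (T x), key]
    module
  · intro e he z hz t hzt
    have := hdir e he t z (z + (1 / 2 : ℝ) • (y - x)) hz.1 hzt.1 hz.2
      (by rw [add_right_comm]; exact hzt.2)
    rw [add_right_comm, sub_eq_sub_iff_add_eq_add] at this
    rw [sub_eq_sub_iff_add_eq_add, this, add_comm]

theorem IsometricOn.map_midpoint {T : X → Y} {K S : Set X} (hT : IsometricOn T K)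
    (hK : Convex ℝ K) (hKi : (interior K).Nonempty) (hL : Convex ℝ (T '' K))
    (hS : Dense (Submodule.span ℝ S : Set X)) (hSu : ∀ e ∈ S, UniqueMidpoint e)
    {x y : X} (hx : x ∈ K) (hy : y ∈ K) :
    T ((1 / 2 : ℝ) • x + (1 / 2 : ℝ) • y) = (1 / 2 : ℝ) • T x + (1 / 2 : ℝ) • T y := by
  obtain ⟨c, hc⟩ := hKi
  have hpos : ∀ᶠ t : ℝ in 𝓝[>] 0, t ∈ Ioc (0 : ℝ) 1 := Ioc_mem_nhdsGT one_pos
  have hint : ∀ z ∈ K, ∀ t ∈ Ioc (0 : ℝ) 1, z + t • (c - z) ∈ interior K :=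
    fun z hz t ht => hK.add_smul_sub_mem_interior' (subset_closure hz) hc ht
  have hlim : ∀ z ∈ K, Tendsto (fun t : ℝ => T (z + t • (c - z))) (𝓝[>] 0) (𝓝 (T z)) := by
    intro z hz
    refine (hT.continuousOn z hz).tendsto.comp (tendsto_nhdsWithin_iff.mpr ⟨?_, ?_⟩)
    · have : Continuous (fun t : ℝ => z + t • (c - z)) := by fun_prop
      simpa using (this.tendsto 0).mono_left nhdsWithin_le_nhds
    · exact hpos.mono fun t ht => interior_subset (hint z hz t ht)
  refine tendsto_nhds_unique (hlim _ (hK hx hy (by norm_num) (by norm_num) (by norm_num)))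
    ((((hlim x hx).const_smul (1 / 2 : ℝ)).add ((hlim y hy).const_smul (1 / 2 : ℝ))).congr' ?_)
  filter_upwards [hpos] with t ht
  rw [← hT.map_midpoint_interior hK hL hS hSu (hint x hx t ht) (hint y hy t ht)]
  congr 1; module

end

/-- If `X` is a real Banach space such that the closed convex hull of the extreme points of the
closed unit ball of `X` has non-empty interior, then every convex body `K ⊆ X` has the strong
Mankiewicz property. -/
theorem strongMankiewicz_of_extremePoints
    (X : Type*) [NormedAddCommGroup X] [NormedSpace ℝ X] [CompleteSpace X]
    (hX : (interior (closure (convexHull ℝ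
      (Set.extremePoints ℝ (Metric.closedBall (0 : X) 1))))).Nonempty)
    (K : Set X) (hK : Convex ℝ K) (hKi : (interior K).Nonempty) :
    StrongMankiewiczProp K := by
  intro Y _ _ L hL T hT hTL x hx y hy α hα
  subst hTL
  have hiso : IsometricOn T K := hT
  have hmem : ∀ t ∈ Icc (0 : ℝ) 1, t • x + (1 - t) • y ∈ K := fun t ht =>
    hK hx hy ht.1 (by linarith [ht.2]) (by ring)
  have := eq_of_bounded_of_midpoint (φ := fun t : ℝ => T (t • x + (1 - t) • y))
    (M := ‖x - y‖ + ‖T y‖) ?_ ?_ hα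
  · simpa using this
  · intro t ht
    have hd : ‖T (t • x + (1 - t) • y) - T y‖ ≤ ‖x - y‖ := by
      rw [← dist_eq_norm, hT _ (hmem t ht) _ hy, dist_eq_norm,
        show t • x + (1 - t) • y - y = t • (x - y) by module, norm_smul,
        Real.norm_of_nonneg ht.1]
      exact mul_le_of_le_one_left (norm_nonneg _) ht.2
    have := norm_add_le (T (t • x + (1 - t) • y) - T y) (T y)
    rw [sub_add_cancel] at this
    linarith
  · intro s hs t ht
    rw [← hiso.map_midpoint hK hKi hL (dense_span_of_interior_closure_convexHull hX)
      (fun e he => uniqueMidpoint_of_mem_extremePoints he) (hmem s hs) (hmem t ht)]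
    congr 1; module
end

section
/- Let A be either a unital complex C*-algebra, or a real von Neumann algebra, i.e., the fixed-point real subalgebra {x ∈ M : J(x) = x} of a von Neumann algebra M under a conjugate-linear *-automorphism J with J² = id, in each case regarded as a real Banach space. Then every convex body in A has the strong Mankiewicz property. -/
open Metric Set

section StrongMankiewicz

variable {X Y : Type*} [NormedAddCommGroup X] [NormedSpace ℝ X]
  [NormedAddCommGroup Y]

/-- A segment whose direction is an extreme point of the unit ball has a unique metric midpoint. -/
theorem eq_add_smul_of_dist_le_of_mem_extremePoints {u p z : X} {c : ℝ} (hc : 0 < c)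
    (hu : u ∈ extremePoints ℝ (closedBall (0 : X) 1))
    (h₁ : dist p z ≤ c / 2) (h₂ : dist z (p + c • u) ≤ c / 2) : z = p + (c / 2) • u := by
  have hc2 : 0 < 2 / c := by positivity
  have hball : ∀ v : X, ‖v‖ ≤ c / 2 → (2 / c) • v ∈ closedBall (0 : X) 1 := by
    intro v hv
    rw [mem_closedBall_zero_iff, norm_smul, Real.norm_of_nonneg hc2.le]
    calc 2 / c * ‖v‖ ≤ 2 / c * (c / 2) := by gcongr
      _ = 1 := by field_simp
  have hv := hball (z - p) (by rwa [← dist_eq_norm, dist_comm])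
  have hw := hball (p + c • u - z) (by rwa [← dist_eq_norm, dist_comm])
  have hseg : u ∈ openSegment ℝ ((2 / c) • (z - p)) ((2 / c) • (p + c • u - z)) := by
    refine ⟨1 / 2, 1 / 2, by norm_num, by norm_num, by norm_num, ?_⟩
    match_scalars <;> field_simp <;> ring
  have heq : (2 / c) • (z - p) = u := (mem_extremePoints.1 hu).2 _ hv _ hw hseg |>.1
  rw [← heq]
  match_scalars <;> field_simp
  ring

variable {K : Set X} {L : Set Y} {T : X → Y}

/-- A metric midpoint in the image of a segment with extreme direction is the image of the
midpoint. -/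
theorem eq_map_add_smul_of_dist_le (hT : ∀ x ∈ K, ∀ y ∈ K, dist (T x) (T y) = dist x y)
    (hTL : T '' K = L) {u p : X} {c : ℝ} (hc : 0 < c)
    (hu : u ∈ extremePoints ℝ (closedBall (0 : X) 1)) (hp : p ∈ K) (hq : p + c • u ∈ K)
    {m : Y} (hm : m ∈ L) (h₁ : dist (T p) m ≤ c / 2) (h₂ : dist m (T (p + c • u)) ≤ c / 2) :
    m = T (p + (c / 2) • u) := by
  rw [← hTL] at hm
  obtain ⟨z, hz, rfl⟩ := hm
  rw [hT _ hp _ hz] at h₁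
  rw [hT _ hz _ hq] at h₂
  rw [← eq_add_smul_of_dist_le_of_mem_extremePoints hc hu h₁ h₂]

theorem norm_le_one_of_mem_extremePoints {u : X}
    (hu : u ∈ extremePoints ℝ (closedBall (0 : X) 1)) : ‖u‖ ≤ 1 :=
  mem_closedBall_zero_iff.1 (extremePoints_subset hu)

/-- The parallelogram identity in a fixed direction `b` passes from a set of directions to its
closed convex hull. -/
theorem map_parallelogram_of_mem_closure_convexHull {U : Set X} (hU : U ⊆ closedBall 0 1)
    (hTc : ContinuousOn T K) {b : X} {r : ℝ} (hb : ‖b‖ ≤ r)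
    (h : ∀ u ∈ U, ∀ t : ℝ, 0 ≤ t → ∀ x, closedBall x (t + r) ⊆ K →
      T (x + t • u + b) + T x = T (x + t • u) + T (x + b))
    {a : X} (ha : a ∈ closure (convexHull ℝ U)) {t : ℝ} (ht : 0 ≤ t) {x : X}
    (hx : closedBall x (t + r) ⊆ K) :
    T (x + t • a + b) + T x = T (x + t • a) + T (x + b) := by
  have hr : 0 ≤ r := (norm_nonneg b).trans hb
  have hnorm : ∀ {v : X} {s : ℝ}, 0 ≤ s → v ∈ closedBall (0 : X) 1 → ‖s • v‖ ≤ s := by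
    intro v s hs hv
    rw [norm_smul, Real.norm_of_nonneg hs]
    exact mul_le_of_le_one_right hs (mem_closedBall_zero_iff.1 hv)
  have hconv : Convex ℝ {a : X | a ∈ closedBall (0 : X) 1 ∧ ∀ t : ℝ, 0 ≤ t →
      ∀ x, closedBall x (t + r) ⊆ K → T (x + t • a + b) + T x = T (x + t • a) + T (x + b)} := by
    rintro a₁ ⟨h₁, h₁'⟩ a₂ ⟨h₂, h₂'⟩ α β hα hβ hαβ
    refine ⟨convex_closedBall (0 : X) 1 h₁ h₂ hα hβ hαβ, fun t ht x hx => ?_⟩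
    have hadd : x + t • (α • a₁ + β • a₂) = x + (t * β) • a₂ + (t * α) • a₁ := by module
    have e₁ := h₁' (t * α) (by positivity) (x + (t * β) • a₂) (by
      refine (closedBall_subset_closedBall' ?_).trans hx
      rw [dist_self_add_left]
      have := hnorm (mul_nonneg ht hβ) h₂
      have : t * α + t * β = t := by rw [← mul_add, hαβ, mul_one]
      linarith)
    have e₂ := h₂' (t * β) (by positivity) x (by
      refine (closedBall_subset_closedBall ?_).trans hx
      have : t * β ≤ t := mul_le_of_le_one_right ht (by linarith)
      linarith)
    rw [hadd]
    have e := congrArg₂ (· + ·) e₁ e₂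
    rw [← sub_eq_zero] at e ⊢
    rw [← e]
    abel
  have hhull := hconv.convexHull_subset_iff.2 fun u hu => ⟨hU hu, h u hu⟩
  have hcl : closure (convexHull ℝ U) ⊆ closedBall (0 : X) 1 :=
    closure_minimal (convexHull_min hU (convex_closedBall 0 1)) isClosed_closedBall
  have hmaps : ∀ v : X, ‖v‖ ≤ r →
      ContinuousOn (fun a : X => T (x + t • a + v)) (closure (convexHull ℝ U)) := by
    intro v hv
    refine hTc.comp (by fun_prop) fun a ha => hx ?_
    rw [mem_closedBall, add_assoc, dist_self_add_left]
    exact (norm_add_le _ _).trans (add_le_add (hnorm ht (hcl ha)) hv)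
  have hmap₀ := hmaps 0 (by simpa using hr)
  simp only [add_zero] at hmap₀
  have heq : EqOn (fun a : X => T (x + t • a + b) + T x) (fun a : X => T (x + t • a) + T (x + b))
      (convexHull ℝ U) := fun a ha => (hhull ha).2 t ht x hx
  exact heq.of_subset_closure ((hmaps b hb).add continuousOn_const)
    (hmap₀.add continuousOn_const) subset_closure subset_rfl ha

variable [NormedSpace ℝ Y]

/-- Isometries preserve midpoints of segments with extreme direction. -/
theorem map_add_half_smul (hL : Convex ℝ L)
    (hT : ∀ x ∈ K, ∀ y ∈ K, dist (T x) (T y) = dist x y) (hTL : T '' K = L)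
    {u p : X} {c : ℝ} (hc : 0 < c) (hu : u ∈ extremePoints ℝ (closedBall (0 : X) 1))
    (hp : p ∈ K) (hq : p + c • u ∈ K) :
    T (p + (c / 2) • u) = midpoint ℝ (T p) (T (p + c • u)) := by
  have hd : dist (T p) (T (p + c • u)) ≤ c := by
    rw [hT _ hp _ hq, dist_self_add_right, norm_smul, Real.norm_of_nonneg hc.le]
    exact mul_le_of_le_one_right hc.le (norm_le_one_of_mem_extremePoints hu)
  refine (eq_map_add_smul_of_dist_le hT hTL hc hu hp hq
    (hL.midpoint_mem (hTL ▸ mem_image_of_mem T hp) (hTL ▸ mem_image_of_mem T hq)) ?_ ?_).symm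
  · rw [dist_left_midpoint, Real.norm_of_nonneg zero_le_two]
    linarith
  · rw [dist_midpoint_right, Real.norm_of_nonneg zero_le_two]
    linarith

/-- Isometries send parallelograms with extreme directions to parallelograms. -/
theorem map_parallelogram_of_mem_extremePoints (hK : Convex ℝ K) (hL : Convex ℝ L)
    (hT : ∀ x ∈ K, ∀ y ∈ K, dist (T x) (T y) = dist x y) (hTL : T '' K = L)
    {u w x : X} (hu : u ∈ extremePoints ℝ (closedBall (0 : X) 1))
    (hw : w ∈ extremePoints ℝ (closedBall (0 : X) 1)) {s t : ℝ} (hs : 0 ≤ s) (ht : 0 ≤ t)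
    (hx : x ∈ K) (hxs : x + s • u ∈ K) (hxt : x + t • w ∈ K) (hxst : x + s • u + t • w ∈ K) :
    T (x + s • u + t • w) + T x = T (x + s • u) + T (x + t • w) := by
  rcases hs.eq_or_lt with rfl | hs
  · simp [add_comm]
  rcases ht.eq_or_lt with rfl | ht
  · simp
  have hcomm : x + s • u + t • w = x + t • w + s • u := by abel
  have hleft := map_add_half_smul hL hT hTL ht hw hx hxt
  have hright := map_add_half_smul hL hT hTL ht hw hxs hxst
  have hmem : x + (t / 2) • w ∈ K := by
    convert hK.midpoint_mem hx hxt using 1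
    rw [midpoint_eq_smul_add, invOf_eq_inv]
    module
  have hmem' : x + (t / 2) • w + s • u ∈ K := by
    convert hK.midpoint_mem hxs hxst using 1
    rw [midpoint_eq_smul_add, invOf_eq_inv]
    module
  have hcomm' : x + (t / 2) • w + s • u = x + s • u + (t / 2) • w := by abel
  have hcenter := map_add_half_smul hL hT hTL hs hu hmem hmem'
  have hnorm : s * ‖u‖ ≤ s :=
    mul_le_of_le_one_right hs.le (norm_le_one_of_mem_extremePoints hu)
  have hd₁ : dist (T (x + t • w)) (T (x + s • u + t • w)) ≤ s := by
    rwa [hT _ hxt _ hxst, hcomm, dist_self_add_right, norm_smul, Real.norm_of_nonneg hs.le]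
  have hd₂ : dist (T x) (T (x + s • u)) ≤ s := by
    rwa [hT _ hx _ hxs, dist_self_add_right, norm_smul, Real.norm_of_nonneg hs.le]
  have hdiag := eq_map_add_smul_of_dist_le hT hTL hs hu hmem hmem'
    (hL.midpoint_mem (hTL ▸ mem_image_of_mem T hx) (hTL ▸ mem_image_of_mem T hxst))
    (by
      rw [hleft, dist_eq_norm]
      rw [dist_eq_norm] at hd₁
      have : midpoint ℝ (T x) (T (x + t • w)) - midpoint ℝ (T x) (T (x + s • u + t • w))
          = (2⁻¹ : ℝ) • (T (x + t • w) - T (x + s • u + t • w)) := by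
        simp only [midpoint_eq_smul_add, invOf_eq_inv]
        module
      rw [this, norm_smul]
      norm_num
      linarith)
    (by
      rw [hcomm', hright, dist_eq_norm]
      rw [dist_eq_norm] at hd₂
      have : midpoint ℝ (T x) (T (x + s • u + t • w))
            - midpoint ℝ (T (x + s • u)) (T (x + s • u + t • w))
          = (2⁻¹ : ℝ) • (T x - T (x + s • u)) := by
        simp only [midpoint_eq_smul_add, invOf_eq_inv]
        module
      rw [this, norm_smul]
      norm_num
      linarith)
  rw [hcenter, hcomm', hleft, hright] at hdiag
  simp only [midpoint_eq_smul_add, invOf_eq_inv] at hdiag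
  have h4 := congrArg (fun v : Y => (4 : ℝ) • v) hdiag
  have key : T (x + s • u + t • w) + T x - (T (x + s • u) + T (x + t • w)) =
     (4 : ℝ) • ((2⁻¹ : ℝ) • (T x + T (x + s • u + t • w)))
      - (4 : ℝ) • ((2⁻¹ : ℝ) • ((2⁻¹ : ℝ) • (T x + T (x + t • w))
        + (2⁻¹ : ℝ) • (T (x + s • u) + T (x + s • u + t • w)))) := by
    module
  rw [← sub_eq_zero, key, sub_eq_zero]
  exact h4

/-- A continuous real function that is locally midpoint affine and vanishes at the endpoints is
nonpositive. -/
theorem nonpos_of_locally_midpoint_affine {g : ℝ → ℝ} (hg : ContinuousOn g (Icc 0 1))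
    (h : ∀ t ∈ Ioo (0 : ℝ) 1, ∃ ε > 0, ∀ s : ℝ, |s| < ε → g (t + s) + g (t - s) = 2 * g t)
    (h₀ : g 0 = 0) (h₁ : g 1 = 0) {t : ℝ} (ht : t ∈ Icc (0 : ℝ) 1) : g t ≤ 0 := by
  by_contra! hpos
  obtain ⟨m, hm, hmax⟩ := isCompact_Icc.exists_isMaxOn ⟨t, ht⟩ hg
  have hmpos : 0 < g m := hpos.trans_le (hmax ht)
  have hcomp : IsCompact (Icc (0 : ℝ) 1 ∩ g ⁻¹' {g m}) :=
    isCompact_Icc.of_isClosed_subset (hg.preimage_isClosed_of_isClosed isClosed_Icc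
      isClosed_singleton) inter_subset_left
  obtain ⟨p, ⟨hp, hpm⟩, hleast⟩ := hcomp.exists_isLeast ⟨m, hm, rfl⟩
  have hpm : g p = g m := hpm
  have hp₀ : 0 < p := hp.1.lt_of_ne (by rintro rfl; linarith)
  have hp₁ : p < 1 := hp.2.lt_of_ne (by rintro rfl; linarith)
  obtain ⟨ε, hε, hmid⟩ := h p ⟨hp₀, hp₁⟩
  obtain ⟨s, hs₀, hs⟩ := exists_between (lt_min hε (lt_min hp₀ (sub_pos.2 hp₁)))
  simp only [lt_min_iff] at hs
  have hsum := hmid s (by rw [abs_of_pos hs₀]; exact hs.1)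
  have hplus : g (p + s) ≤ g m := hmax ⟨by linarith, by linarith⟩
  have hmem : p - s ∈ Icc (0 : ℝ) 1 := ⟨by linarith, by linarith⟩
  have hminus : g (p - s) ≤ g m := hmax hmem
  have := hleast ⟨hmem, show g (p - s) = g m by linarith⟩
  linarith

/-- A continuous curve that is locally midpoint affine is affine. -/
theorem eq_lineMap_of_locally_midpoint_affine {g : ℝ → Y} (hg : ContinuousOn g (Icc 0 1))
    (h : ∀ t ∈ Ioo (0 : ℝ) 1, ∃ ε > 0, ∀ s : ℝ, |s| < ε →
      g (t + s) + g (t - s) = (2 : ℝ) • g t) {t : ℝ} (ht : t ∈ Icc (0 : ℝ) 1) :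
    g t = (1 - t) • g 0 + t • g 1 := by
  have hle : ∀ φ : StrongDual ℝ Y, φ (g t) ≤ φ ((1 - t) • g 0 + t • g 1) := by
    intro φ
    rw [← sub_nonpos]
    refine nonpos_of_locally_midpoint_affine
      (g := fun t => φ (g t) - φ ((1 - t) • g 0 + t • g 1)) ?_ ?_ ?_ ?_ ht
    · exact (φ.continuous.comp_continuousOn hg).sub (Continuous.continuousOn (by fun_prop))
    · intro t ht
      obtain ⟨ε, hε, hmid⟩ := h t ht
      refine ⟨ε, hε, fun s hs => ?_⟩
      have := congrArg φ (hmid s hs)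
      simp only [map_add, map_smul, smul_eq_mul] at this ⊢
      linear_combination this
    · simp
    · simp
  refine (SeparatingDual.eq_iff_forall_dual_eq (R := ℝ)).2 fun φ => (hle φ).antisymm ?_
  simpa using hle (-φ)

/-- If the closed convex hull of a set of extreme points of the unit ball contains a ball around
the origin, then every convex body has the strong Mankiewicz property. -/
theorem strongMankiewiczProp_of_ball_subset_closure_convexHull {U : Set X}
    (hU : U ⊆ extremePoints ℝ (closedBall (0 : X) 1)) {δ : ℝ} (hδ : 0 < δ)
    (hball : ball (0 : X) δ ⊆ closure (convexHull ℝ U)) {K : Set X} (hK : Convex ℝ K)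
    (hKi : (interior K).Nonempty) : StrongMankiewiczProp K := by
  intro Y _ _ L hL T hT hTL
  have hTc : ContinuousOn T K :=
    (LipschitzOnWith.of_dist_le_mul (K := 1) fun x hx y hy => by simp [hT x hx y hy]).continuousOn
  have hU' : U ⊆ closedBall 0 1 := hU.trans extremePoints_subset
  have hcl : closure (convexHull ℝ U) ⊆ closedBall (0 : X) 1 :=
    closure_minimal (convexHull_min hU' (convex_closedBall 0 1)) isClosed_closedBall
  have hnorm : ∀ {v : X} {s : ℝ}, 0 ≤ s → v ∈ closedBall (0 : X) 1 → ‖s • v‖ ≤ s := by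
    intro v s hs hv
    rw [norm_smul, Real.norm_of_nonneg hs]
    exact mul_le_of_le_one_right hs (mem_closedBall_zero_iff.1 hv)
  have hpar : ∀ a ∈ closure (convexHull ℝ U), ∀ b ∈ closure (convexHull ℝ U), ∀ s t : ℝ,
      0 ≤ s → 0 ≤ t → ∀ x, closedBall x (s + t) ⊆ K →
      T (x + s • a + t • b) + T x = T (x + s • a) + T (x + t • b) := by
    intro a ha b hb s t hs ht x hx
    refine map_parallelogram_of_mem_closure_convexHull hU' hTc (hnorm ht (hcl hb)) ?_ ha hs hx
    intro u hu s hs x hx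
    rw [add_comm (T (x + s • u)), add_right_comm]
    refine map_parallelogram_of_mem_closure_convexHull hU' hTc (hnorm hs (hU' hu)) ?_ hb ht
      (by rwa [add_comm t s])
    intro w hw t ht x hx
    have hmem : ∀ v : X, ‖v‖ ≤ t + s → x + v ∈ K := fun v hv =>
      hx (by rwa [mem_closedBall, dist_self_add_left])
    have h₁ := hnorm hs (hU' hu)
    have h₂ := hnorm ht (hU' hw)
    refine map_parallelogram_of_mem_extremePoints hK hL hT hTL (hU hw) (hU hu) ht hs
      (by simpa using hmem 0 (by simpa using by positivity)) (hmem _ (by linarith))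
      (hmem _ (by linarith)) ?_
    rw [add_assoc]
    exact hmem _ ((norm_add_le _ _).trans (by linarith))
  have hlocal : ∀ z ∈ interior K, ∃ ρ > 0, ∀ y : X, ‖y‖ < ρ →
      T (z + y) + T (z - y) = (2 : ℝ) • T z := by
    intro z hz
    obtain ⟨ε, hε, hεK⟩ := nhds_basis_closedBall.mem_iff.1 (mem_interior_iff_mem_nhds.1 hz)
    refine ⟨ε / 4 * δ, by positivity, fun y hy => ?_⟩
    have hya : (ε / 4) • ((ε / 4)⁻¹ • y) = y := smul_inv_smul₀ (by positivity) y
    have ha : (ε / 4)⁻¹ • y ∈ closure (convexHull ℝ U) := by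
      refine hball ?_
      rw [mem_ball_zero_iff, norm_smul, norm_inv, Real.norm_of_nonneg (by positivity : 0 ≤ ε / 4)]
      rwa [inv_mul_lt_iff₀ (by positivity)]
    have hyε : ‖y‖ ≤ ε / 4 := by
      rw [← hya]
      exact hnorm (by positivity) (hcl ha)
    have := hpar _ ha _ ha (ε / 4) (ε / 4) (by positivity) (by positivity) (z - y) (by
      refine (closedBall_subset_closedBall' ?_).trans hεK
      rw [dist_self_sub_left]
      linarith)
    rw [hya, sub_add_cancel] at this
    rw [this, two_smul]
  have hint : ∀ x ∈ interior K, ∀ y ∈ interior K, ∀ α ∈ Icc (0 : ℝ) 1,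
      T (α • x + (1 - α) • y) = α • T x + (1 - α) • T y := by
    intro x hx y hy α hα
    have hseg : ∀ t ∈ Icc (0 : ℝ) 1, t • x + (1 - t) • y ∈ interior K := fun t ht =>
      hK.interior hx hy ht.1 (by linarith [ht.2]) (by ring)
    have := eq_lineMap_of_locally_midpoint_affine
      (g := fun t : ℝ => T (t • x + (1 - t) • y)) ?_ ?_ hα
    · simpa [add_comm] using this
    · exact hTc.comp (by fun_prop) fun t ht => interior_subset (hseg t ht)
    · intro t ht
      obtain ⟨ρ, hρ, hmid⟩ := hlocal _ (hseg t (Ioo_subset_Icc_self ht))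
      refine ⟨ρ / (‖x - y‖ + 1), by positivity, fun s hs => ?_⟩
      have := hmid (s • (x - y)) (by
        rw [lt_div_iff₀ (by positivity)] at hs
        rw [norm_smul, Real.norm_eq_abs]
        nlinarith [abs_nonneg s])
      rw [← this]
      congr 2 <;> module
  intro x hx y hy α hα
  have hKcl : K ⊆ closure (interior K) := by
    rw [hK.closure_interior_eq_closure_of_nonempty_interior hKi]
    exact subset_closure
  have hfst : MapsTo (fun p : X × X => p.1) (K ×ˢ K) K := fun p hp => hp.1
  have hsnd : MapsTo (fun p : X × X => p.2) (K ×ˢ K) K := fun p hp => hp.2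
  have hcomb : MapsTo (fun p : X × X => α • p.1 + (1 - α) • p.2) (K ×ˢ K) K := fun p hp =>
    hK hp.1 hp.2 hα.1 (by linarith [hα.2]) (by ring)
  have heq : EqOn (fun p : X × X => T (α • p.1 + (1 - α) • p.2))
      (fun p : X × X => α • T p.1 + (1 - α) • T p.2) (interior K ×ˢ interior K) :=
    fun p hp => hint _ hp.1 _ hp.2 α hα
  refine heq.of_subset_closure (t := K ×ˢ K) (hTc.comp (by fun_prop) hcomb)
    (((hTc.comp (by fun_prop) hfst).const_smul α).add
      ((hTc.comp (by fun_prop) hsnd).const_smul (1 - α)))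
    (prod_mono interior_subset interior_subset) ?_ (⟨hx, hy⟩ : (x, y) ∈ K ×ˢ K)
  rw [closure_prod_eq]
  exact prod_mono hKcl hKcl

end StrongMankiewicz

section CStar

variable {B : Type*} [CStarAlgebra B] [PartialOrder B] [StarOrderedRing B]

theorem star_mul_self_le_one_of_norm_le_one {a : B} (ha : ‖a‖ ≤ 1) : star a * a ≤ 1 := by
  rw [← CStarAlgebra.norm_le_one_iff_of_nonneg _ (star_mul_self_nonneg a),
    CStarRing.norm_star_mul_self]
  exact mul_le_one₀ ha (norm_nonneg a) ha

/-- A unitary that is a proper convex combination of two contractions equals both of them. -/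
theorem eq_of_mem_openSegment_of_mem_unitary {u a b : B} (hu : u ∈ unitary B)
    (ha : ‖a‖ ≤ 1) (hb : ‖b‖ ≤ 1) (h : u ∈ openSegment ℝ a b) : a = u := by
  obtain ⟨α, β, hα, hβ, hαβ, rfl⟩ := h
  obtain rfl : β = 1 - α := by linarith
  have hpos : (α * (1 - α)) • (star (a - b) * (a - b)) ≤ 0 := by
    have hid : (α * (1 - α)) • (star (a - b) * (a - b)) =
        α • (star a * a) + (1 - α) • (star b * b)
          - star (α • a + (1 - α) • b) * (α • a + (1 - α) • b) := by
      simp only [star_sub, star_add, star_smul, star_trivial, sub_mul, mul_sub, add_mul, mul_add,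
        smul_mul_assoc, mul_smul_comm]
      module
    have h₁ : α • (star a * a) ≤ α • (1 : B) :=
      smul_le_smul_of_nonneg_left (star_mul_self_le_one_of_norm_le_one ha) hα.le
    have h₂ : (1 - α) • (star b * b) ≤ (1 - α) • (1 : B) :=
      smul_le_smul_of_nonneg_left (star_mul_self_le_one_of_norm_le_one hb) hβ.le
    rw [hid, (Unitary.mem_iff.1 hu).1, sub_nonpos]
    calc _ ≤ α • (1 : B) + (1 - α) • (1 : B) := add_le_add h₁ h₂
      _ = 1 := by module
  have hzero : star (a - b) * (a - b) = 0 := by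
    have := hpos.antisymm (smul_nonneg (mul_pos hα hβ).le (star_mul_self_nonneg (a - b)))
    exact (smul_eq_zero.1 this).resolve_left (mul_pos hα hβ).ne'
  have hab : a = b := sub_eq_zero.1 ((CStarRing.star_mul_self_eq_zero_iff _).1 hzero)
  rw [← hab]
  module

theorem mem_extremePoints_closedBall_of_mem_unitary {X : Type*} [NormedAddCommGroup X]
    [NormedSpace ℝ X] (φ : X →ₗᵢ[ℝ] B) {u : X} (hu : φ u ∈ unitary B) :
    u ∈ extremePoints ℝ (closedBall (0 : X) 1) := by
  rw [mem_extremePoints_iff_left]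
  refine ⟨?_, fun a ha b hb hab => φ.injective ?_⟩
  · rw [mem_closedBall_zero_iff, ← φ.norm_map]
    obtain _ | _ := subsingleton_or_nontrivial B
    · simp [Subsingleton.elim (φ u) 0]
    · exact (CStarRing.norm_of_mem_unitary hu).le
  · rw [mem_closedBall_zero_iff, ← φ.norm_map] at ha hb
    refine eq_of_mem_openSegment_of_mem_unitary hu ha hb ?_
    obtain ⟨α, β, hα, hβ, hαβ, rfl⟩ := hab
    exact ⟨α, β, hα, hβ, hαβ, by simp⟩

/-- A bounded set whose points `h` admit `w` in a convex set `C` such that `2 h - w` is again in the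
set, is contained in the closure of `C`. -/
theorem subset_closure_of_two_smul_sub_mem {X : Type*} [NormedAddCommGroup X] [NormedSpace ℝ X]
    {C S : Set X} (hC : Convex ℝ C) {r : ℝ} (hr : ∀ h ∈ S, ∀ w ∈ C, ‖h - w‖ ≤ r)
    (h : ∀ h ∈ S, ∃ w ∈ C, (2 : ℝ) • h - w ∈ S) : S ⊆ closure C := by
  have happrox : ∀ n : ℕ, ∀ x ∈ S, ∃ c ∈ C, ‖x - c‖ ≤ r * (1 / 2) ^ n := by
    intro n
    induction n with
    | zero =>
      intro x hx
      obtain ⟨w, hw, -⟩ := h x hx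
      exact ⟨w, hw, by simpa using hr x hx w hw⟩
    | succ n ih =>
      intro x hx
      obtain ⟨w, hw, hxw⟩ := h x hx
      obtain ⟨c, hc, hxc⟩ := ih _ hxw
      refine ⟨(1 / 2 : ℝ) • w + (1 / 2 : ℝ) • c,
        hC hw hc (by norm_num) (by norm_num) (by norm_num), ?_⟩
      have : x - ((1 / 2 : ℝ) • w + (1 / 2 : ℝ) • c) = (1 / 2 : ℝ) • ((2 : ℝ) • x - w - c) := by
        module
      rw [this, norm_smul, pow_succ]
      norm_num at hxc ⊢
      linarith
  intro x hx
  rw [Metric.mem_closure_iff]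
  intro ε hε
  have hlim : Filter.Tendsto (fun n : ℕ => r * (1 / 2 : ℝ) ^ n) Filter.atTop (nhds (r * 0)) :=
    (tendsto_pow_atTop_nhds_zero_of_lt_one (by norm_num) (by norm_num)).const_mul r
  rw [mul_zero] at hlim
  obtain ⟨n, hn⟩ := (hlim.eventually_lt_const hε).exists
  obtain ⟨c, hc, hxc⟩ := happrox n x hx
  exact ⟨c, hc, by rw [dist_eq_norm]; exact hxc.trans_lt hn⟩

theorem norm_two_smul_sub_one_le_one {b : B} (hb : 0 ≤ b) (hb₁ : b ≤ 1) :
    ‖(2 : ℝ) • b - 1‖ ≤ 1 := by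
  have hsa : IsSelfAdjoint ((2 : ℝ) • b - 1) :=
    ((IsSelfAdjoint.all (2 : ℝ)).smul (.of_nonneg hb)).sub (.one B)
  have hsq : b * b ≤ b := by
    simpa [pow_two] using CStarAlgebra.pow_antitone hb hb₁ one_le_two
  have hle : ((2 : ℝ) • b - 1) * ((2 : ℝ) • b - 1) ≤ 1 := by
    have : ((2 : ℝ) • b - 1) * ((2 : ℝ) • b - 1) = 1 - (4 : ℝ) • (b - b * b) := by
      simp only [sub_mul, mul_sub, smul_mul_assoc, mul_smul_comm, mul_one, one_mul]
      module
    rw [this, sub_le_self_iff]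
    exact smul_nonneg (by norm_num) (sub_nonneg.2 hsq)
  rw [← CStarAlgebra.norm_le_one_iff_of_nonneg _ hsa.mul_self_nonneg, hsa.norm_mul_self] at hle
  exact (sq_le_one_iff₀ (norm_nonneg _)).1 hle

variable {R : StarSubalgebra ℝ B}

/-- If a real star subalgebra contains square roots and range projections, then its self-adjoint
contractions are in the closed convex hull of its unitaries. -/
theorem mem_closure_convexHull_unitary_of_isSelfAdjoint
    (hsqrt : ∀ a ∈ R, 0 ≤ a → CFC.sqrt a ∈ R)
    (hproj : ∀ a ∈ R, ∃ p ∈ R, IsStarProjection p ∧ p * a = a ∧ ∀ b, b * a = 0 → b * p = 0)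
    {h : B} (hR : h ∈ R) (hsa : IsSelfAdjoint h) (hn : ‖h‖ ≤ 1) :
    h ∈ closure (convexHull ℝ ((R : Set B) ∩ unitary B)) := by
  have hunit : ∀ w ∈ convexHull ℝ ((R : Set B) ∩ unitary B), ‖w‖ ≤ 1 := by
    intro w hw
    rw [← mem_closedBall_zero_iff]
    refine convexHull_min (fun u hu => ?_) (convex_closedBall 0 1) hw
    exact extremePoints_subset (mem_extremePoints_closedBall_of_mem_unitary .id hu.2)
  refine subset_closure_of_two_smul_sub_mem (S := {h | h ∈ R ∧ IsSelfAdjoint h ∧ ‖h‖ ≤ 1})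
    (r := 2) (convex_convexHull ℝ _) ?_ ?_ ⟨hR, hsa, hn⟩
  · rintro h ⟨-, -, hn⟩ w hw
    exact (norm_sub_le h w).trans (by linarith [hunit w hw])
  rintro h ⟨hR, hsa, hn⟩
  have habsR : CFC.abs h ∈ R :=
    hsqrt _ (mul_mem (star_mem hR) hR) (star_mul_self_nonneg h)
  have habs : 0 ≤ CFC.abs h := CFC.abs_nonneg h
  obtain ⟨p, hpR, hp, hpa, hann⟩ := hproj _ (add_mem habsR hR)
  have hcomm : CFC.abs h * h = h * CFC.abs h := (CFC.commute_abs_self h).eq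
  have hkill : (CFC.abs h - h) * p = 0 := hann _ (by
    rw [sub_mul, mul_add, mul_add, CFC.abs_mul_abs, hsa.star_eq, hcomm]
    abel)
  have hkill' : p * (CFC.abs h - h) = 0 := by
    have := congrArg star hkill
    simpa [hp.isSelfAdjoint.star_eq, hsa.star_eq, (IsSelfAdjoint.of_nonneg habs).star_eq] using this
  have hpp : p * p = p := hp.isIdempotentElem
  have hwsa : IsSelfAdjoint ((2 : ℝ) • p - 1) :=
    ((IsSelfAdjoint.all (2 : ℝ)).smul hp.isSelfAdjoint).sub (.one B)
  have hww : ((2 : ℝ) • p - 1) * ((2 : ℝ) • p - 1) = 1 := by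
    simp only [sub_mul, mul_sub, smul_mul_assoc, mul_smul_comm, mul_one, one_mul, hpp]
    module
  have hwu : (2 : ℝ) • p - 1 ∈ unitary B := by
    rw [Unitary.mem_iff, hwsa.star_eq]
    exact ⟨hww, hww⟩
  have hwR : (2 : ℝ) • p - 1 ∈ R := sub_mem (R.smul_mem hpR _) (one_mem R)
  have hwh : ((2 : ℝ) • p - 1) * h = CFC.abs h := by
    rw [mul_sub] at hkill'
    rw [mul_add, sub_eq_zero.1 hkill'] at hpa
    rw [sub_mul, smul_mul_assoc, two_smul, hpa]
    simp
  refine ⟨_, subset_convexHull ℝ _ ⟨hwR, hwu⟩, sub_mem (R.smul_mem hR _) hwR,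
    ((IsSelfAdjoint.all (2 : ℝ)).smul hsa).sub hwsa, ?_⟩
  have : (2 : ℝ) • h - ((2 : ℝ) • p - 1) =
      ((2 : ℝ) • p - 1) * ((2 : ℝ) • CFC.abs h - 1) := by
    rw [← hwh, mul_sub, mul_smul_comm, ← mul_assoc, hww, one_mul, mul_one]
  rw [this, CStarRing.norm_mem_unitary_mul _ hwu]
  refine norm_two_smul_sub_one_le_one habs ?_
  rwa [← CStarAlgebra.norm_le_one_iff_of_nonneg _ habs, CFC.norm_abs]

/-- If a real star subalgebra contains square roots, then its skew-adjoint contractions are in the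
convex hull of its unitaries. -/
theorem mem_convexHull_unitary_of_star_eq_neg (hsqrt : ∀ a ∈ R, 0 ≤ a → CFC.sqrt a ∈ R)
    {k : B} (hR : k ∈ R) (hk : star k = -k) (hn : ‖k‖ ≤ 1) :
    k ∈ convexHull ℝ ((R : Set B) ∩ unitary B) := by
  have hpos : 0 ≤ 1 - star k * k := sub_nonneg.2 (star_mul_self_le_one_of_norm_le_one hn)
  have hsR : CFC.sqrt (1 - star k * k) ∈ R :=
    hsqrt _ (sub_mem (one_mem R) (mul_mem (star_mem hR) hR)) hpos
  have hss := CFC.sqrt_mul_sqrt_self _ hpos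
  have hcomm : CFC.sqrt (1 - star k * k) * k = k * CFC.sqrt (1 - star k * k) :=
    Commute.cfcₙ_nnreal (show Commute (1 - star k * k) k by
      rw [hk]; exact (Commute.one_left k).sub_left ((Commute.refl k).neg_left.mul_left (.refl k))) _
  have hssa := (IsSelfAdjoint.of_nonneg (CFC.sqrt_nonneg (1 - star k * k))).star_eq
  generalize CFC.sqrt (1 - star k * k) = s at hsR hss hcomm hssa
  rw [hk] at hss
  have hu : k + s ∈ unitary B := by
    rw [Unitary.mem_iff, star_add, hk, hssa]
    simp only [add_mul, mul_add, neg_mul, mul_neg, hss, hcomm]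
    constructor <;> abel
  have hv : k - s ∈ unitary B := by
    rw [Unitary.mem_iff, star_sub, hk, hssa]
    simp only [sub_mul, mul_sub, neg_mul, mul_neg, hss, hcomm]
    constructor <;> abel
  have := convex_convexHull ℝ ((R : Set B) ∩ unitary B)
    (subset_convexHull ℝ _ ⟨add_mem hR hsR, hu⟩) (subset_convexHull ℝ _ ⟨sub_mem hR hsR, hv⟩)
    (a := 1 / 2) (b := 1 / 2) (by norm_num) (by norm_num) (by norm_num)
  convert this using 1
  module

/-- If a real star subalgebra contains square roots and range projections, then its elements of
norm at most `1 / 2` are in the closed convex hull of its unitaries. -/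
theorem mem_closure_convexHull_unitary_of_norm_le_half
    (hsqrt : ∀ a ∈ R, 0 ≤ a → CFC.sqrt a ∈ R)
    (hproj : ∀ a ∈ R, ∃ p ∈ R, IsStarProjection p ∧ p * a = a ∧ ∀ b, b * a = 0 → b * p = 0)
    {x : B} (hR : x ∈ R) (hn : ‖x‖ ≤ 1 / 2) :
    x ∈ closure (convexHull ℝ ((R : Set B) ∩ unitary B)) := by
  have hplus := mem_closure_convexHull_unitary_of_isSelfAdjoint hsqrt hproj
    (add_mem hR (star_mem hR)) (.add_star_self x)
    ((norm_add_le _ _).trans (by rw [norm_star]; linarith))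
  have hminus := mem_convexHull_unitary_of_star_eq_neg hsqrt
    (sub_mem hR (star_mem hR)) (by simp) ((norm_sub_le _ _).trans (by rw [norm_star]; linarith))
  have := (convex_convexHull ℝ ((R : Set B) ∩ unitary B)).closure hplus (subset_closure hminus)
    (a := 1 / 2) (b := 1 / 2) (by norm_num) (by norm_num) (by norm_num)
  convert this using 1
  module

end CStar

section VonNeumann

variable {H : Type*} [NormedAddCommGroup H] [InnerProductSpace ℂ H] [CompleteSpace H]

theorem VonNeumannAlgebra.sqrt_mem (M : VonNeumannAlgebra H) {a : H →L[ℂ] H} (ha : a ∈ M) :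
    CFC.sqrt a ∈ M := by
  rw [← M.commutant_commutant, VonNeumannAlgebra.mem_commutant_iff]
  intro y hy
  have hcomm : Commute a y := VonNeumannAlgebra.mem_commutant_iff.1 hy a ha
  exact (Commute.cfcₙ_nnreal hcomm _).symm.eq

/-- The orthogonal projection onto the closure of the range of an operator. -/
noncomputable def rangeProjection (a : H →L[ℂ] H) : H →L[ℂ] H :=
  a.range.topologicalClosure.starProjection

theorem isStarProjection_rangeProjection (a : H →L[ℂ] H) :
    IsStarProjection (rangeProjection a) :=
  isStarProjection_starProjection

theorem rangeProjection_mul_self (a : H →L[ℂ] H) : rangeProjection a * a = a := by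
  ext v
  exact Submodule.starProjection_eq_self_iff.2
    (a.range.le_topologicalClosure (LinearMap.mem_range_self _ v))

theorem mul_rangeProjection_eq_zero {a b : H →L[ℂ] H} (h : b * a = 0) :
    b * rangeProjection a = 0 := by
  have hle : a.range.topologicalClosure ≤ b.ker := by
    refine Submodule.topologicalClosure_minimal _ ?_ b.isClosed_ker
    rintro _ ⟨v, rfl⟩
    exact congrArg (fun T : H →L[ℂ] H => T v) h
  ext v
  exact hle (Submodule.starProjection_apply_mem _ v)

theorem VonNeumannAlgebra.rangeProjection_mem (M : VonNeumannAlgebra H) {a : H →L[ℂ] H}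
    (ha : a ∈ M) : rangeProjection a ∈ M := by
  rw [VonNeumannAlgebra.IsStarProjection.mem_iff (isStarProjection_rangeProjection a)]
  intro y hy
  rw [rangeProjection, Submodule.range_starProjection, Module.End.mem_invtSubmodule]
  refine Submodule.topologicalClosure_minimal _ ?_
    (a.range.isClosed_topologicalClosure.preimage y.continuous)
  rintro _ ⟨v, rfl⟩
  have hcomm : a * y = y * a := VonNeumannAlgebra.mem_commutant_iff.1 hy a ha
  refine a.range.le_topologicalClosure ⟨y v, ?_⟩
  exact congrArg (fun T : H →L[ℂ] H => T v) hcomm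

variable {M : VonNeumannAlgebra H} {J : (H →L[ℂ] H) → (H →L[ℂ] H)}

theorem map_sqrt_of_fixed (hmul : ∀ x ∈ M, ∀ y ∈ M, J (x * y) = J x * J y)
    (hstar : ∀ x ∈ M, J (star x) = star (J x))
    {a : H →L[ℂ] H} (haM : a ∈ M) (ha : J a = a) (hpos : 0 ≤ a) :
    J (CFC.sqrt a) = CFC.sqrt a := by
  have hs := M.sqrt_mem haM
  have hq := M.sqrt_mem hs
  have hqsa := (IsSelfAdjoint.of_nonneg (CFC.sqrt_nonneg (CFC.sqrt a))).star_eq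
  have hJs : 0 ≤ J (CFC.sqrt a) := by
    rw [← CFC.sqrt_mul_sqrt_self (CFC.sqrt a) (CFC.sqrt_nonneg a), hmul _ hq _ hq]
    nth_rw 1 [← hqsa]
    rw [hstar _ hq]
    exact star_mul_self_nonneg _
  refine (CFC.sqrt_unique ?_ hJs).symm
  rw [← hmul _ hs _ hs, CFC.sqrt_mul_sqrt_self a hpos, ha]

theorem map_rangeProjection_of_fixed (hmem : ∀ x ∈ M, J x ∈ M)
    (hmul : ∀ x ∈ M, ∀ y ∈ M, J (x * y) = J x * J y)
    (hstar : ∀ x ∈ M, J (star x) = star (J x)) (hinv : ∀ x ∈ M, J (J x) = x)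
    {a : H →L[ℂ] H} (haM : a ∈ M) (ha : J a = a) :
    J (rangeProjection a) = rangeProjection a := by
  have hp := M.rangeProjection_mem haM
  have hpsa := (isStarProjection_rangeProjection a).isSelfAdjoint.star_eq
  have hqa : J (rangeProjection a) * a = a := by
    have := hmul _ hp _ haM
    rwa [rangeProjection_mul_self, ha, eq_comm] at this
  have hqp : J (rangeProjection a) * rangeProjection a = rangeProjection a := by
    have := mul_rangeProjection_eq_zero (a := a) (b := J (rangeProjection a) - 1)
      (by rw [sub_mul, hqa, one_mul, sub_self])
    rwa [sub_mul, one_mul, sub_eq_zero] at this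
  have hpq := congrArg star hqp
  rw [star_mul, ← hstar _ hp, hpsa] at hpq
  have hJ := hmul _ (hmem _ hp) _ hp
  rw [hqp, hinv _ hp, hpq] at hJ
  exact hJ

end VonNeumann

/-- A ball around the origin of a unital C⋆-algebra is in the convex hull of the unitaries. -/
theorem ball_subset_convexHull_unitary {A : Type*} [CStarAlgebra A] :
    ball (0 : A) (1 / 2) ⊆ convexHull ℝ (unitary A : Set A) := by
  let _ := CStarAlgebra.spectralOrder A
  let _ := CStarAlgebra.spectralOrderedRing A
  intro x hx
  have hnorm := mem_ball_zero_iff.1 hx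
  have hskew := mem_convexHull_unitary_of_star_eq_neg (R := (⊤ : StarSubalgebra ℝ A))
    (fun _ _ _ => StarSubalgebra.mem_top) (k := x - star x) StarSubalgebra.mem_top (by simp)
    ((norm_sub_le _ _).trans (by rw [norm_star]; linarith))
  rw [StarSubalgebra.coe_top, univ_inter] at hskew
  have hsa : x + star x ∈ convexHull ℝ (unitary A : Set A) := by
    have hmem := (IsSelfAdjoint.add_star_self x).self_add_I_smul_cfcSqrt_sub_sq_mem_unitary
      _ ((norm_add_le _ _).trans (by rw [norm_star]; linarith))
    have := convex_convexHull ℝ (unitary A : Set A) (subset_convexHull ℝ _ hmem)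
      (subset_convexHull ℝ _ (Unitary.star_mem hmem))
      (a := 1 / 2) (b := 1 / 2) (by norm_num) (by norm_num) (by norm_num)
    convert this using 1
    simp only [star_add, star_star, star_smul,
      (IsSelfAdjoint.of_nonneg (CFC.sqrt_nonneg (1 - (x + star x) ^ 2))).star_eq,
      Complex.star_def, Complex.conj_I, neg_smul]
    module
  have := convex_convexHull ℝ (unitary A : Set A) hsa hskew
    (a := 1 / 2) (b := 1 / 2) (by norm_num) (by norm_num) (by norm_num)
  convert this using 1
  module

/-- Every convex body in a unital complex C*-algebra, and every convex body in a real
von Neumann algebra (the fixed points of a conjugate-linear *-automorphism `J` with `J² = id`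
of a von Neumann algebra), has the strong Mankiewicz property. -/
theorem convexBody_strongMankiewicz_of_cstar_or_realVonNeumann :
    (∀ (A : Type*) [CStarAlgebra A] (K : Set A),
      Convex ℝ K → (interior K).Nonempty → StrongMankiewiczProp K) ∧
    (∀ (H : Type*) [NormedAddCommGroup H] [InnerProductSpace ℂ H] [CompleteSpace H]
      (M : VonNeumannAlgebra H) (J : (H →L[ℂ] H) → (H →L[ℂ] H)),
      (∀ x ∈ M, J x ∈ M) →
      (∀ x ∈ M, ∀ y ∈ M, J (x + y) = J x + J y) →
      (∀ (c : ℂ), ∀ x ∈ M, J (c • x) = (starRingEnd ℂ c) • J x) →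
      (∀ x ∈ M, ∀ y ∈ M, J (x * y) = J x * J y) →
      (∀ x ∈ M, J (star x) = star (J x)) →
      (∀ x ∈ M, J (J x) = x) →
      ∀ (A : Submodule ℝ (H →L[ℂ] H)), (∀ x, x ∈ A ↔ x ∈ M ∧ J x = x) →
      ∀ K : Set A, Convex ℝ K → (interior K).Nonempty → StrongMankiewiczProp K) := by
  refine ⟨fun A _ K hK hKi => ?_,
    fun H _ _ _ M J hmem _ _ hmul hstar hinv A hA K hK hKi => ?_⟩
  · let _ := CStarAlgebra.spectralOrder A
    let _ := CStarAlgebra.spectralOrderedRing A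
    exact strongMankiewiczProp_of_ball_subset_closure_convexHull
      (fun u hu => mem_extremePoints_closedBall_of_mem_unitary .id hu) one_half_pos
      (ball_subset_convexHull_unitary.trans subset_closure) hK hKi
  · have hone : J 1 = 1 := by
      have := hmul _ (hmem 1 (one_mem M)) 1 (one_mem M)
      rwa [mul_one, hinv 1 (one_mem M), one_mul, eq_comm] at this
    let R : StarSubalgebra ℝ (H →L[ℂ] H) :=
      { carrier := A
        mul_mem' := fun {x y} hx hy => by
          rw [SetLike.mem_coe, hA] at hx hy ⊢
          exact ⟨mul_mem hx.1 hy.1, by rw [hmul _ hx.1 _ hy.1, hx.2, hy.2]⟩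
        one_mem' := (hA 1).2 ⟨one_mem M, hone⟩
        add_mem' := A.add_mem
        zero_mem' := A.zero_mem
        algebraMap_mem' := fun r => by
          rw [Algebra.algebraMap_eq_smul_one]
          exact A.smul_mem r ((hA 1).2 ⟨one_mem M, hone⟩)
        star_mem' := fun {x} hx => by
          have hx := (hA x).1 hx
          exact (hA _).2 ⟨star_mem hx.1, by rw [hstar _ hx.1, hx.2]⟩ }
    have hsqrt : ∀ a ∈ R, 0 ≤ a → CFC.sqrt a ∈ R := by
      intro a ha hpos
      have ha := (hA a).1 ha
      exact (hA _).2 ⟨M.sqrt_mem ha.1, map_sqrt_of_fixed hmul hstar ha.1 ha.2 hpos⟩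
    have hproj : ∀ a ∈ R, ∃ p ∈ R, IsStarProjection p ∧ p * a = a ∧
        ∀ b, b * a = 0 → b * p = 0 := by
      intro a ha
      have ha := (hA a).1 ha
      exact ⟨rangeProjection a, (hA _).2 ⟨M.rangeProjection_mem ha.1,
        map_rangeProjection_of_fixed hmem hmul hstar hinv ha.1 ha.2⟩,
        isStarProjection_rangeProjection a, rangeProjection_mul_self a,
        fun b => mul_rangeProjection_eq_zero⟩
    refine strongMankiewiczProp_of_ball_subset_closure_convexHull
      (U := A.subtype ⁻¹' (unitary (H →L[ℂ] H) : Set (H →L[ℂ] H)))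
      (fun u hu => mem_extremePoints_closedBall_of_mem_unitary A.subtypeₗᵢ hu) one_half_pos
      (fun x hx => ?_) hK hKi
    have himage : A.subtype '' (A.subtype ⁻¹' (unitary (H →L[ℂ] H) : Set (H →L[ℂ] H))) =
        (R : Set (H →L[ℂ] H)) ∩ unitary (H →L[ℂ] H) := by
      rw [image_preimage_eq_range_inter, A.coe_subtype, Subtype.range_coe]
      rfl
    have hind : Topology.IsInducing A.subtype := .subtypeVal
    rw [hind.closure_eq_preimage_closure_image, A.subtype.image_convexHull, himage]
    exact mem_closure_convexHull_unitary_of_norm_le_half hsqrt hproj x.2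
      (mem_ball_zero_iff.1 hx).le
end

section
/- Let X be a real Banach space. If the closed unit ball B_X has the strong Mankiewicz property, then every convex body K ⊂ X has the strong Mankiewicz property. -/
/-- In a bounded metric space with an isometric reflection through `o`, the point `o` is fixed by
every self-isometry. -/
theorem IsometryEquiv.apply_eq_of_reflection {M : Type*} [MetricSpace M] (ρ : M ≃ᵢ M) (o : M)
    (C : ℝ) (hC : ∀ z, dist z o ≤ C) (hρ : ∀ z, dist (ρ z) z = 2 * dist z o) (e : M ≃ᵢ M) :
    e o = o := by
  have hρo : ρ o = o := by
    have := hρ o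
    rw [dist_self, mul_zero] at this
    exact dist_eq_zero.mp this
  have hbdd : BddAbove (Set.range fun f : M ≃ᵢ M => dist (f o) o) :=
    ⟨C, by rintro _ ⟨f, rfl⟩; exact hC _⟩
  have key : ∀ f : M ≃ᵢ M, 2 * dist (f o) o ≤ ⨆ f : M ≃ᵢ M, dist (f o) o := by
    intro f
    have h1 : dist ((((f.trans ρ).trans f.symm).trans ρ) o) o = 2 * dist (f o) o := by
      calc dist ((((f.trans ρ).trans f.symm).trans ρ) o) o
          = dist (ρ (f.symm (ρ (f o)))) (ρ o) := by rw [hρo]; rfl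
        _ = dist (f.symm (ρ (f o))) (f.symm (f o)) := by
            rw [ρ.dist_eq, IsometryEquiv.symm_apply_apply]
        _ = 2 * dist (f o) o := by rw [f.symm.dist_eq, hρ]
    rw [← h1]
    exact le_ciSup hbdd (((f.trans ρ).trans f.symm).trans ρ)
  have hsup : (⨆ f : M ≃ᵢ M, dist (f o) o) ≤ (⨆ f : M ≃ᵢ M, dist (f o) o) / 2 :=
    haveI : Nonempty (M ≃ᵢ M) := ⟨e⟩
    ciSup_le fun f => by linarith [key f]
  have := key e
  exact dist_le_zero.mp (by linarith)

theorem exists_preimage_midpoint {X Y : Type*} [NormedAddCommGroup Y] [NormedSpace ℝ Y]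
    {K : Set X} {T : X → Y} (hL : Convex ℝ (T '' K)) {x y : X}
    (hx : x ∈ K) (hy : y ∈ K) :
    ∃ m ∈ K, (2 : ℝ) • T m = T x + T y := by
  obtain ⟨m, hm, h⟩ := hL (Set.mem_image_of_mem T hx) (Set.mem_image_of_mem T hy)
    (by norm_num : (0 : ℝ) ≤ 1 / 2) (by norm_num : (0 : ℝ) ≤ 1 / 2) (by norm_num)
  exact ⟨m, hm, by rw [h]; module⟩

section NormedGroup

variable {X Y : Type*} [NormedAddCommGroup X] [NormedAddCommGroup Y] [NormedSpace ℝ Y]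
  {K : Set X} {T : X → Y}

theorem two_mul_norm_sub_of_preimage_midpoint
    (hT : ∀ x ∈ K, ∀ y ∈ K, ‖T x - T y‖ = ‖x - y‖) {z p q m n : X}
    (hp : p ∈ K) (hq : q ∈ K) (hm : m ∈ K) (hn : n ∈ K)
    (h : (2 : ℝ) • T m = T z + T p) (h' : (2 : ℝ) • T n = T z + T q) :
    2 * ‖m - n‖ = ‖p - q‖ := by
  rw [← hT m hm n hn, ← hT p hp q hq]
  have : T p - T q = (2 : ℝ) • (T m - T n) := by
    rw [smul_sub, h, h']; abel
  rw [this, norm_smul]; norm_num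

theorem two_mul_norm_sub_le_of_preimage_midpoint
    (hT : ∀ x ∈ K, ∀ y ∈ K, ‖T x - T y‖ = ‖x - y‖) {x y m p : X}
    (hx : x ∈ K) (hy : y ∈ K) (hm : m ∈ K) (hp : p ∈ K) (h : (2 : ℝ) • T m = T x + T y) :
    2 * ‖m - p‖ ≤ ‖x - p‖ + ‖y - p‖ := by
  rw [← hT m hm p hp, ← hT x hx p hp, ← hT y hy p hp]
  have : (2 : ℝ) • (T m - T p) = (T x - T p) + (T y - T p) := by
    rw [smul_sub, h, two_smul]; abel
  have h2 : 2 * ‖T m - T p‖ = ‖(2 : ℝ) • (T m - T p)‖ := by rw [norm_smul]; norm_num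
  rw [h2, this]
  exact norm_add_le _ _

end NormedGroup

section NormedSpace

variable {X Y : Type*} [NormedAddCommGroup X] [NormedSpace ℝ X]
  [NormedAddCommGroup Y] [NormedSpace ℝ Y] {K : Set X} {T : X → Y}

/-- The preimage of the midpoint of two images is quadratically close to the midpoint. -/
theorem norm_preimage_midpoint_sub_center_le
    (hT : ∀ x ∈ K, ∀ y ∈ K, ‖T x - T y‖ = ‖x - y‖) {c x m : X} {R : ℝ} (hR : 0 < R)
    (hK : Metric.closedBall c (2 * R) ⊆ K) (hxR : ‖x‖ ≤ R) (hm : m ∈ K)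
    (h : (2 : ℝ) • T m = T (c + x) + T (c - x)) :
    R * ‖m - c‖ ≤ 16 * ‖x‖ ^ 2 := by
  have mem : ∀ v : X, ‖v‖ ≤ 2 * R → c + v ∈ K := fun v hv => hK (by simpa using hv)
  have hxp : c + x ∈ K := mem x (by linarith)
  have hxm : c - x ∈ K := by
    rw [sub_eq_add_neg]; exact mem (-x) (by rw [norm_neg]; linarith)
  have hc : c ∈ K := by simpa using mem 0 (by simpa using hR.le)
  set d := m - c with hd
  have hmd : m = c + d := by rw [hd]; abel
  have hdx : ‖d‖ ≤ ‖x‖ := by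
    have := two_mul_norm_sub_le_of_preimage_midpoint hT hxp hxm hm hc h
    rw [← hd] at this
    have e1 : c + x - c = x := by abel
    have e2 : c - x - c = -x := by abel
    rw [e1, e2, norm_neg] at this
    linarith
  by_cases hd0 : ‖d‖ = 0
  · rw [hd0, mul_zero]; positivity
  have hdpos : 0 < ‖d‖ := lt_of_le_of_ne (norm_nonneg _) (Ne.symm hd0)
  have hxpos : 0 < ‖x‖ := hdpos.trans_le hdx
  by_cases hsmall : R < 4 * ‖x‖
  · nlinarith
  push Not at hsmall
  have key : ∀ u : X, ‖u‖ ≤ 2 * R → 2 * (2 * ‖u‖) ≤ 2 * ‖u - d‖ + (‖u + x‖ + ‖u - x‖) := by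
    intro u hu
    have hup := mem u hu
    have hum : c + -u ∈ K := mem (-u) (by rwa [norm_neg])
    have h1 := two_mul_norm_sub_le_of_preimage_midpoint hT hxp hxm hm hum h
    have h2 : ‖(c + u) - (c + -u)‖ ≤ ‖(c + u) - m‖ + ‖m - (c + -u)‖ :=
      norm_sub_le_norm_sub_add_norm_sub _ _ _
    have e1 : c + x - (c + -u) = u + x := by abel
    have e2 : c - x - (c + -u) = u - x := by abel
    have e3 : (c + u) - (c + -u) = (2 : ℝ) • u := by module
    have e4 : c + u - m = u - d := by rw [hmd]; abel
    rw [e1, e2] at h1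
    rw [e3, e4, norm_smul, Real.norm_ofNat] at h2
    linarith
  set w := (R / ‖d‖) • d with hw
  have hwn : ‖w‖ = R := by
    rw [hw, norm_smul, Real.norm_of_nonneg (by positivity)]; field_simp
  have hdw : d = (‖d‖ / R) • w := by
    rw [hw, smul_smul]
    have : ‖d‖ / R * (R / ‖d‖) = 1 := by field_simp
    rw [this, one_smul]
  set n := ⌊R / (4 * ‖x‖)⌋₊ with hn
  have hn1 : (n : ℝ) * ‖x‖ ≤ R / 4 := by
    have : (n : ℝ) ≤ R / (4 * ‖x‖) := Nat.floor_le (by positivity)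
    calc (n : ℝ) * ‖x‖ ≤ R / (4 * ‖x‖) * ‖x‖ := by gcongr
      _ = R / 4 := by field_simp
  have hn2 : R ≤ 8 * (n * ‖x‖) := by
    have h1 : R / (4 * ‖x‖) < n + 1 := Nat.lt_floor_add_one _
    have h2 : 1 ≤ R / (4 * ‖x‖) := by rw [le_div_iff₀ (by positivity)]; linarith
    have h3 : (1 : ℝ) ≤ n := by
      have : 1 ≤ n := Nat.le_floor (by simpa using h2)
      exact_mod_cast this
    rw [div_lt_iff₀ (by positivity)] at h1
    nlinarith
  let a : ℕ → ℝ := fun k => ‖w + (k : ℝ) • x‖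
  have step : ∀ k : ℕ, k + 1 ≤ n → ‖d‖ ≤ a (k + 2) + a k - 2 * a (k + 1) := by
    intro k hk
    set u := w + ((k + 1 : ℕ) : ℝ) • x with hu
    have hkn : ((k + 1 : ℕ) : ℝ) * ‖x‖ ≤ R / 4 := by
      refine le_trans ?_ hn1
      gcongr
    have huw : ‖u - w‖ ≤ R / 4 := by
      rw [hu, add_sub_cancel_left, norm_smul, Real.norm_of_nonneg (by positivity)]
      exact hkn
    have hu1 : ‖u‖ ≤ R + R / 4 := by
      have := norm_le_norm_add_norm_sub w u
      rw [norm_sub_rev] at this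
      linarith
    have hu2 : R - R / 4 ≤ ‖u‖ := by
      have := norm_le_norm_add_norm_sub u w
      linarith
    have hud : ‖u - d‖ ≤ (1 - ‖d‖ / R) * ‖u‖ + ‖d‖ / R * (R / 4) := by
      have e : u - d = (1 - ‖d‖ / R) • u + (‖d‖ / R) • (u - w) := by
        conv_lhs => rw [hdw]
        module
      have hle : ‖d‖ / R ≤ 1 := by rw [div_le_one hR]; linarith
      rw [e]
      refine (norm_add_le _ _).trans ?_
      rw [norm_smul, norm_smul, Real.norm_of_nonneg (by linarith),
        Real.norm_of_nonneg (by positivity)]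
      gcongr
    have hgain : ‖d‖ / 2 ≤ ‖d‖ / R * (‖u‖ - R / 4) := by
      calc ‖d‖ / 2 = ‖d‖ / R * (R / 2) := by field_simp
        _ ≤ _ := by gcongr; linarith
    have hk := key u (by linarith)
    have e1 : u + x = w + ((k + 2 : ℕ) : ℝ) • x := by rw [hu]; push_cast; module
    have e2 : u - x = w + (k : ℝ) • x := by rw [hu]; push_cast; module
    rw [e1, e2] at hk
    change ‖d‖ ≤ ‖w + ((k + 2 : ℕ) : ℝ) • x‖ + ‖w + (k : ℝ) • x‖ - 2 * ‖u‖
    nlinarith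
  have tele : ∀ k : ℕ, k ≤ n → k * ‖d‖ ≤ (a (k + 1) - a k) - (a 1 - a 0) := by
    intro k
    induction k with
    | zero => intro _; simp
    | succ k ih =>
      intro hk
      have h1 := ih (by omega)
      have h2 := step k hk
      push_cast
      linarith
  have hlast : a (n + 1) - a n ≤ ‖x‖ := by
    have h1 := norm_sub_norm_le (w + ((n + 1 : ℕ) : ℝ) • x) (w + (n : ℝ) • x)
    have e : w + ((n + 1 : ℕ) : ℝ) • x - (w + (n : ℝ) • x) = x := by push_cast; module
    rw [e] at h1
    exact h1
  have hfirst : -‖x‖ ≤ a 1 - a 0 := by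
    have h1 := norm_sub_norm_le (w + ((0 : ℕ) : ℝ) • x) (w + ((1 : ℕ) : ℝ) • x)
    have e : w + ((0 : ℕ) : ℝ) • x - (w + ((1 : ℕ) : ℝ) • x) = -x := by push_cast; module
    rw [e, norm_neg] at h1
    change -‖x‖ ≤ ‖w + ((1 : ℕ) : ℝ) • x‖ - ‖w + ((0 : ℕ) : ℝ) • x‖
    linarith
  have htot := tele n le_rfl
  nlinarith [mul_le_mul_of_nonneg_right hn2 hdpos.le, mul_le_mul_of_nonneg_left
    (show n * ‖d‖ ≤ 2 * ‖x‖ by linarith) hxpos.le]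

/-- A bounded map with quadratically small second differences has small Lipschitz constant. -/
theorem norm_sub_le_of_second_difference_le {ψ : X → X} {c : X} {ρ A B : ℝ} (hρ : 0 < ρ)
    {z : X} (hA : ∀ q ∈ Metric.closedBall c ρ, ‖ψ q - z‖ ≤ A) (hB0 : 0 ≤ B)
    (hB : ∀ p h : X, p ∈ Metric.closedBall c ρ → p + (2 : ℝ) • h ∈ Metric.closedBall c ρ →
      ‖ψ p + ψ (p + (2 : ℝ) • h) - (2 : ℝ) • ψ (p + h)‖ ≤ B * ‖h‖ ^ 2)
    {p q : X} (hp : p ∈ Metric.closedBall c (ρ / 4)) (hq : q ∈ Metric.closedBall c (ρ / 4)) :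
    ‖ψ q - ψ p‖ ≤ (8 * A / ρ + B * ρ / 4) * ‖q - p‖ := by
  have hpρ : p ∈ Metric.closedBall c ρ := Metric.closedBall_subset_closedBall (by linarith) hp
  have hA0 : 0 ≤ A := (norm_nonneg _).trans (hA p hpρ)
  have doubling : ∀ n : ℕ, ∀ h : X, p + ((2 : ℝ) ^ n) • h ∈ Metric.closedBall c ρ →
      ‖ψ (p + h) - ψ p‖ ≤ 2 * A / 2 ^ n + B / 2 * (2 ^ n - 1) * ‖h‖ ^ 2 := by
    intro n
    induction n with
    | zero =>
      intro h hh
      rw [pow_zero, one_smul] at hh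
      have := norm_sub_le_norm_sub_add_norm_sub (ψ (p + h)) z (ψ p)
      rw [norm_sub_rev z] at this
      have h1 := hA _ hh
      have h2 := hA _ hpρ
      simp only [pow_zero, div_one, sub_self, mul_zero, zero_mul, add_zero]
      linarith
    | succ n ih =>
      intro h hh
      have e : p + ((2 : ℝ) ^ n) • ((2 : ℝ) • h) = p + ((2 : ℝ) ^ (n + 1)) • h := by
        rw [smul_smul, pow_succ]
      have h1 := ih ((2 : ℝ) • h) (by rw [e]; exact hh)
      have hseg : p + (2 : ℝ) • h ∈ Metric.closedBall c ρ := by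
        have hpow : (1 : ℝ) ≤ 2 ^ n := one_le_pow₀ (by norm_num)
        have := (convex_closedBall c ρ).add_smul_sub_mem hpρ hh
          (t := 1 / 2 ^ n) ⟨by positivity, by rw [div_le_one (by positivity)]; exact hpow⟩
        convert this using 2
        rw [add_sub_cancel_left, smul_smul, pow_succ]
        congr 1
        field_simp
      have h2 := hB p h hpρ hseg
      have e2 : (2 : ℝ) • (ψ (p + h) - ψ p) = (ψ (p + (2 : ℝ) • h) - ψ p)
          - (ψ p + ψ (p + (2 : ℝ) • h) - (2 : ℝ) • ψ (p + h)) := by module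
      have h3 : 2 * ‖ψ (p + h) - ψ p‖ ≤ ‖ψ (p + (2 : ℝ) • h) - ψ p‖
          + ‖ψ p + ψ (p + (2 : ℝ) • h) - (2 : ℝ) • ψ (p + h)‖ := by
        rw [← Real.norm_ofNat (n := 2), ← norm_smul, e2]
        simpa using norm_sub_le (ψ (p + (2 : ℝ) • h) - ψ p)
          (ψ p + ψ (p + (2 : ℝ) • h) - (2 : ℝ) • ψ (p + h))
      rw [norm_smul, Real.norm_ofNat] at h1
      have e3 : 2 * A / 2 ^ (n + 1) = (2 * A / 2 ^ n) / 2 := by rw [pow_succ]; field_simp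
      rw [e3, pow_succ]
      nlinarith
  obtain ⟨h, rfl⟩ : ∃ h, q = p + h := ⟨q - p, by abel⟩
  rw [add_sub_cancel_left]
  by_cases hh0 : ‖h‖ = 0
  · rw [norm_eq_zero] at hh0; simp [hh0]
  have hpos : 0 < ‖h‖ := lt_of_le_of_ne (norm_nonneg _) (Ne.symm hh0)
  rw [mem_closedBall_iff_norm] at hp hq
  have hle : ‖h‖ ≤ ρ / 2 := by
    have e : h = (p + h - c) - (p - c) := by abel
    have := norm_sub_le (p + h - c) (p - c)
    rw [← e] at this
    linarith
  obtain ⟨n, hn1, hn2⟩ := exists_nat_pow_near (x := ρ / 2 / ‖h‖) (y := (2 : ℝ))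
    (by rw [le_div_iff₀ hpos]; linarith) (by norm_num)
  rw [le_div_iff₀ hpos] at hn1
  rw [div_lt_iff₀ hpos, pow_succ] at hn2
  have hmem : p + ((2 : ℝ) ^ n) • h ∈ Metric.closedBall c ρ := by
    rw [mem_closedBall_iff_norm]
    have e : p + ((2 : ℝ) ^ n) • h - c = (p - c) + ((2 : ℝ) ^ n) • h := by abel
    rw [e]
    refine (norm_add_le _ _).trans ?_
    rw [norm_smul, Real.norm_of_nonneg (by positivity)]
    linarith
  have hfin := doubling n h hmem
  have t1 : 2 * A / 2 ^ n ≤ 8 * A / ρ * ‖h‖ := by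
    rw [div_mul_eq_mul_div, div_le_div_iff₀ (by positivity) hρ]
    nlinarith
  have t2 : B / 2 * (2 ^ n - 1) * ‖h‖ ^ 2 ≤ B * ρ / 4 * ‖h‖ := by
    have : (2 ^ n - 1) * ‖h‖ ≤ ρ / 2 := by linarith
    calc B / 2 * (2 ^ n - 1) * ‖h‖ ^ 2 = B / 2 * ((2 ^ n - 1) * ‖h‖) * ‖h‖ := by ring
      _ ≤ B / 2 * (ρ / 2) * ‖h‖ := by gcongr
      _ = _ := by ring
  linarith

theorem norm_preimage_midpoint_sub_le
    (hT : ∀ x ∈ K, ∀ y ∈ K, ‖T x - T y‖ = ‖x - y‖) {c x y m : X} {R : ℝ} (hR : 0 < R)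
    (hK : Metric.closedBall c (3 * R) ⊆ K) (hx : x ∈ Metric.closedBall c R)
    (hy : y ∈ Metric.closedBall c R) (hm : m ∈ K) (h : (2 : ℝ) • T m = T x + T y) :
    ‖m - (1 / 2 : ℝ) • (x + y)‖ ≤ 4 / R * ‖x - y‖ ^ 2 := by
  have hmid : (1 / 2 : ℝ) • (x + y) ∈ Metric.closedBall c R := by
    have := (convex_closedBall c R) hx hy (by norm_num : (0 : ℝ) ≤ 1 / 2)
      (by norm_num : (0 : ℝ) ≤ 1 / 2) (by norm_num)
    rwa [smul_add]
  have hsub : Metric.closedBall ((1 / 2 : ℝ) • (x + y)) (2 * R) ⊆ K := by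
    refine (Metric.closedBall_subset_closedBall' ?_).trans hK
    rw [Metric.mem_closedBall] at hmid
    linarith
  have hn : ‖(1 / 2 : ℝ) • (x - y)‖ = ‖x - y‖ / 2 := by
    rw [norm_smul]; norm_num; ring
  have hxy : ‖x - y‖ ≤ 2 * R := by
    rw [mem_closedBall_iff_norm] at hx hy
    have := norm_sub_le_norm_sub_add_norm_sub x c y
    rw [norm_sub_rev c y] at this
    linarith
  have := norm_preimage_midpoint_sub_center_le hT (x := (1 / 2 : ℝ) • (x - y)) hR hsub
    (by rw [hn]; linarith) hm (by
      rw [h]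
      congr 2 <;> module)
  rw [hn] at this
  rw [div_mul_eq_mul_div, le_div_iff₀ hR]
  nlinarith

/-- Near `c`, the point reflection in the codomain through the image of a point of the ball
lifts to the domain. -/
theorem exists_preimage_reflection [CompleteSpace X]
    (hT : ∀ x ∈ K, ∀ y ∈ K, ‖T x - T y‖ = ‖x - y‖) (hL : Convex ℝ (T '' K)) {c a z : X}
    {ρ : ℝ} (hρ : 0 < ρ) (hK : Metric.closedBall c (3000 * ρ) ⊆ K)
    (ha : a ∈ Metric.closedBall c (ρ / 64)) (hz : z ∈ Metric.closedBall c (ρ / 64)) :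
    ∃ p ∈ K, (2 : ℝ) • T a = T z + T p := by
  classical
  have hR : 0 < 1000 * ρ := by positivity
  have hK' : Metric.closedBall c (3 * (1000 * ρ)) ⊆ K := by
    rwa [← mul_assoc, show (3 : ℝ) * 1000 = 3000 by norm_num]
  have hsub : Metric.closedBall c ρ ⊆ K :=
    (Metric.closedBall_subset_closedBall (by linarith)).trans hK
  have hsubR : Metric.closedBall c ρ ⊆ Metric.closedBall c (1000 * ρ) :=
    Metric.closedBall_subset_closedBall (by linarith)
  set B : ℝ := 4 / (1000 * ρ) with hB
  have hB0 : 0 ≤ B := by positivity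
  have hBρ : B * ρ = 1 / 250 := by rw [hB]; field_simp; norm_num
  have hzρ : z ∈ Metric.closedBall c ρ := Metric.closedBall_subset_closedBall (by linarith) hz
  have hcρ : c ∈ Metric.closedBall c ρ := Metric.mem_closedBall_self hρ.le
  have bound : ∀ {x y m : X}, x ∈ Metric.closedBall c ρ → y ∈ Metric.closedBall c ρ → m ∈ K →
      (2 : ℝ) • T m = T x + T y → ‖m - (1 / 2 : ℝ) • (x + y)‖ ≤ B * ‖x - y‖ ^ 2 :=
    fun hx hy hm h => norm_preimage_midpoint_sub_le hT hR hK' (hsubR hx) (hsubR hy) hm h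
  have stay : ∀ {x y m : X}, x ∈ Metric.closedBall c ρ → y ∈ Metric.closedBall c ρ → m ∈ K →
      (2 : ℝ) • T m = T x + T y → m ∈ Metric.closedBall c ρ := by
    intro x y m hx hy hm h
    have := two_mul_norm_sub_le_of_preimage_midpoint hT (hsub hx) (hsub hy) hm (hsub hcρ) h
    rw [mem_closedBall_iff_norm] at hx hy ⊢
    linarith
  have hex : ∀ q : X, ∃ m : X, q ∈ Metric.closedBall c ρ →
      m ∈ K ∧ (2 : ℝ) • T m = T z + T q := by
    intro q
    by_cases hq : q ∈ Metric.closedBall c ρ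
    · obtain ⟨m, hm, h⟩ := exists_preimage_midpoint hL (hsub hzρ) (hsub hq)
      exact ⟨m, fun _ => ⟨hm, h⟩⟩
    · exact ⟨0, fun h => absurd h hq⟩
  choose φ hφ using hex
  have hφb : ∀ q ∈ Metric.closedBall c ρ,
      ‖(2 : ℝ) • φ q - q - z‖ ≤ 2 * (B * ‖z - q‖ ^ 2) := by
    intro q hq
    have e : (2 : ℝ) • φ q - q - z = (2 : ℝ) • (φ q - (1 / 2 : ℝ) • (z + q)) := by module
    rw [e, norm_smul, Real.norm_ofNat]
    gcongr
    exact bound hzρ hq (hφ q hq).1 (hφ q hq).2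
  have hA : ∀ q ∈ Metric.closedBall c ρ, ‖(2 : ℝ) • φ q - q - z‖ ≤ 8 * B * ρ ^ 2 := by
    intro q hq
    have hzq : ‖z - q‖ ≤ 2 * ρ := by
      have := norm_sub_le_norm_sub_add_norm_sub z c q
      rw [mem_closedBall_iff_norm] at hzρ hq
      rw [norm_sub_rev c q] at this
      linarith
    calc _ ≤ 2 * (B * ‖z - q‖ ^ 2) := hφb q hq
      _ ≤ 2 * (B * (2 * ρ) ^ 2) := by gcongr
      _ = _ := by ring
  have hdiff : ∀ p h : X, p ∈ Metric.closedBall c ρ → p + (2 : ℝ) • h ∈ Metric.closedBall c ρ →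
      ‖((2 : ℝ) • φ p - p) + ((2 : ℝ) • φ (p + (2 : ℝ) • h) - (p + (2 : ℝ) • h))
        - (2 : ℝ) • ((2 : ℝ) • φ (p + h) - (p + h))‖ ≤ 12 * B * ‖h‖ ^ 2 := by
    intro p h hp hq
    set q := p + (2 : ℝ) • h with hqdef
    have hmid : (1 / 2 : ℝ) • (p + q) = p + h := by rw [hqdef]; module
    have hph : p + h ∈ Metric.closedBall c ρ := by
      rw [← hmid, smul_add]
      exact (convex_closedBall c ρ) hp hq (by norm_num) (by norm_num) (by norm_num)
    have hpq : ‖p - q‖ = 2 * ‖h‖ := by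
      have e : p - q = -((2 : ℝ) • h) := by rw [hqdef]; module
      rw [e, norm_neg, norm_smul, Real.norm_ofNat]
    obtain ⟨m, hm, hTm⟩ := exists_preimage_midpoint hL (hsub hp) (hsub hq)
    have hmρ := stay hp hq hm hTm
    have h1 := bound hp hq hm hTm
    rw [hmid, hpq] at h1
    obtain ⟨hmzK, hTmz⟩ := hφ m hmρ
    obtain ⟨hp1, hp2⟩ := hφ p hp
    obtain ⟨hq1, hq2⟩ := hφ q hq
    obtain ⟨hh1, hh2⟩ := hφ (p + h) hph
    have h2 := two_mul_norm_sub_of_preimage_midpoint hT hm (hsub hph) hmzK hh1 hTmz hh2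
    have h3 := two_mul_norm_sub_of_preimage_midpoint hT (hsub hp) (hsub hq) hp1 hq1 hp2 hq2
    have hTT : (2 : ℝ) • T (φ m) = T (φ p) + T (φ q) := by
      have : (2 : ℝ) • ((2 : ℝ) • T (φ m)) = (2 : ℝ) • (T (φ p) + T (φ q)) := by
        rw [smul_add (2 : ℝ) (T (φ p)), hp2, hq2, hTmz, smul_add, hTm, two_smul]
        abel
      exact smul_right_injective Y (two_ne_zero' ℝ) this
    have h4 := bound (stay hzρ hp hp1 hp2) (stay hzρ hq hq1 hq2) hmzK hTT
    rw [show ‖φ p - φ q‖ = ‖h‖ by linarith] at h4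
    have e : ((2 : ℝ) • φ p - p) + ((2 : ℝ) • φ q - q) - (2 : ℝ) • ((2 : ℝ) • φ (p + h) - (p + h))
        = (4 : ℝ) • (φ m - φ (p + h)) - (4 : ℝ) • (φ m - (1 / 2 : ℝ) • (φ p + φ q)) := by
      rw [hqdef]; module
    rw [e]
    refine (norm_sub_le _ _).trans ?_
    rw [norm_smul, norm_smul, Real.norm_ofNat]
    nlinarith
  have hlip : ApproximatesLinearOn (fun q => (2 : ℝ) • φ q) (ContinuousLinearMap.id ℝ X)
      (Metric.closedBall c (ρ / 4)) (1 / 2) := by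
    intro q hq p hp
    have h1 := norm_sub_le_of_second_difference_le (ψ := fun q => (2 : ℝ) • φ q - q) hρ hA
      (by positivity) hdiff hp hq
    have e : (2 : ℝ) • φ q - (2 : ℝ) • φ p - ContinuousLinearMap.id ℝ X (q - p)
        = ((2 : ℝ) • φ q - q) - ((2 : ℝ) • φ p - p) := by
      rw [ContinuousLinearMap.id_apply]; abel
    rw [e]
    refine h1.trans ?_
    push_cast
    gcongr
    have : 8 * (8 * B * ρ ^ 2) / ρ = 64 * (B * ρ) := by field_simp; ring
    rw [this, show 12 * B * ρ / 4 = 3 * (B * ρ) by ring, hBρ]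
    norm_num
  let rinv : (ContinuousLinearMap.id ℝ X).NonlinearRightInverse :=
    { toFun := id
      nnnorm := 1
      bound' := fun y => by simp
      right_inv' := fun y => rfl }
  have hsurj := hlip.surjOn_closedBall_of_nonlinearRightInverse rinv (b := c) (ε := ρ / 4)
    (by positivity) subset_rfl
  have hmem : (2 : ℝ) • a ∈ Metric.closedBall ((2 : ℝ) • φ c)
      (((rinv.nnnorm : ℝ)⁻¹ - ((1 / 2 : NNReal) : ℝ)) * (ρ / 4)) := by
    have hr : ((rinv.nnnorm : ℝ)⁻¹ - ((1 / 2 : NNReal) : ℝ)) * (ρ / 4) = ρ / 8 := by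
      change (((1 : NNReal) : ℝ)⁻¹ - ((1 / 2 : NNReal) : ℝ)) * (ρ / 4) = ρ / 8
      push_cast
      ring
    rw [hr, mem_closedBall_iff_norm]
    rw [mem_closedBall_iff_norm] at ha hz
    have h1 := hφb c hcρ
    have h2 : 2 * (B * ‖z - c‖ ^ 2) ≤ ρ / 64 := by
      calc 2 * (B * ‖z - c‖ ^ 2) ≤ 2 * (B * (ρ / 64) ^ 2) := by gcongr
        _ = 2 * (B * ρ) * ρ / 64 ^ 2 := by ring
        _ ≤ ρ / 64 := by rw [hBρ]; linarith
    have e : (2 : ℝ) • a - (2 : ℝ) • φ c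
        = ((2 : ℝ) • (a - c) - (z - c)) - ((2 : ℝ) • φ c - c - z) := by module
    rw [e]
    have h3 := norm_sub_le ((2 : ℝ) • (a - c) - (z - c)) ((2 : ℝ) • φ c - c - z)
    have h4 := norm_sub_le ((2 : ℝ) • (a - c)) (z - c)
    rw [norm_smul, Real.norm_ofNat] at h4
    linarith
  obtain ⟨p, hp, hpa⟩ := hsurj hmem
  have hpρ : p ∈ Metric.closedBall c ρ := Metric.closedBall_subset_closedBall (by linarith) hp
  have hpa' : φ p = a := smul_right_injective X (two_ne_zero' ℝ) hpa
  refine ⟨p, hsub hpρ, ?_⟩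
  rw [← hpa']
  exact (hφ p hpρ).2

/-- An isometry onto a convex set preserves midpoints of short segments away from the boundary. -/
theorem map_add_add_map_sub_of_norm_le [CompleteSpace X]
    (hT : ∀ x ∈ K, ∀ y ∈ K, ‖T x - T y‖ = ‖x - y‖) (hL : Convex ℝ (T '' K)) {c x : X}
    {ρ : ℝ} (hρ : 0 < ρ) (hK : Metric.closedBall c (3000 * ρ) ⊆ K) (hx : ‖x‖ ≤ ρ / 64) :
    T (c + x) + T (c - x) = (2 : ℝ) • T c := by
  have hsub : Metric.closedBall c (ρ / 64) ⊆ K :=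
    (Metric.closedBall_subset_closedBall (by linarith)).trans hK
  have hcm : c ∈ Metric.closedBall c (ρ / 64) := Metric.mem_closedBall_self (by positivity)
  have hxp : c + x ∈ Metric.closedBall c (ρ / 64) := by simpa using hx
  have hxm : c - x ∈ Metric.closedBall c (ρ / 64) := by simpa [mem_closedBall_iff_norm] using hx
  let M : Set X := {z | ‖z - (c + x)‖ = ‖x‖ ∧ ‖z - (c - x)‖ = ‖x‖}
  have hM : ∀ z ∈ M, ‖z - c‖ ≤ ‖x‖ := by
    rintro z ⟨h1, h2⟩
    have e : (2 : ℝ) • (z - c) = (z - (c + x)) + (z - (c - x)) := by module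
    have := norm_add_le (z - (c + x)) (z - (c - x))
    rw [← e, norm_smul, Real.norm_ofNat] at this
    linarith
  have hMs : ∀ z ∈ M, z ∈ Metric.closedBall c (ρ / 64) := fun z hz =>
    mem_closedBall_iff_norm.mpr ((hM z hz).trans hx)
  obtain ⟨a, haK, ha⟩ := exists_preimage_midpoint hL (hsub hxp) (hsub hxm)
  have hac : a ∈ Metric.closedBall c (ρ / 64) := by
    have := two_mul_norm_sub_le_of_preimage_midpoint hT (hsub hxp) (hsub hxm) haK (hsub hcm) ha
    rw [mem_closedBall_iff_norm] at hxp hxm ⊢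
    linarith
  have hex : ∀ z : M, ∃ p ∈ K, (2 : ℝ) • T a = T z + T p := fun z =>
    exists_preimage_reflection hT hL hρ hK hac (hMs z z.2)
  choose g hgK hg using hex
  have hMK : ∀ z : M, (z : X) ∈ K := fun z => hsub (hMs z z.2)
  have hgT : ∀ z : M, T (g z) = T (c + x) + T (c - x) - T z := fun z => by
    rw [← ha, hg z]; abel
  have hgM : ∀ z : M, g z ∈ M := by
    intro z
    constructor
    · rw [← hT _ (hgK z) _ (hsub hxp), hgT]
      have e : T (c + x) + T (c - x) - T z - T (c + x) = T (c - x) - T z := by abel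
      rw [e, hT _ (hsub hxm) _ (hMK z), norm_sub_rev, z.2.2]
    · rw [← hT _ (hgK z) _ (hsub hxm), hgT]
      have e : T (c + x) + T (c - x) - T z - T (c - x) = T (c + x) - T z := by abel
      rw [e, hT _ (hsub hxp) _ (hMK z), norm_sub_rev, z.2.1]
  have hinj : ∀ u ∈ K, ∀ v ∈ K, T u = T v → u = v := by
    intro u hu v hv h
    have := hT u hu v hv
    rw [h, sub_self, norm_zero] at this
    exact sub_eq_zero.mp (norm_eq_zero.mp this.symm)
  have hginv : ∀ z : M, g ⟨g z, hgM z⟩ = z := by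
    intro z
    refine hinj _ (hgK _) _ (hMK z) ?_
    rw [hgT, hgT]
    abel
  let e : M ≃ᵢ M := IsometryEquiv.mk'
    (fun z => ⟨g z, hgM z⟩) (fun z => ⟨g z, hgM z⟩) (fun z => Subtype.ext (hginv z))
    (Isometry.of_dist_eq fun z w => by
      rw [Subtype.dist_eq, Subtype.dist_eq, dist_eq_norm, dist_eq_norm]
      change ‖g z - g w‖ = _
      rw [← hT _ (hgK z) _ (hgK w), hgT, hgT, sub_sub_sub_cancel_left,
        hT _ (hMK w) _ (hMK z), norm_sub_rev])
  have hrefl : ∀ z ∈ M, (2 : ℝ) • c - z ∈ M := by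
    rintro z ⟨h1, h2⟩
    constructor
    · rw [show (2 : ℝ) • c - z - (c + x) = -(z - (c - x)) by module, norm_neg, h2]
    · rw [show (2 : ℝ) • c - z - (c - x) = -(z - (c + x)) by module, norm_neg, h1]
  let r : M ≃ᵢ M := IsometryEquiv.mk'
    (fun z => ⟨(2 : ℝ) • c - z, hrefl z z.2⟩) (fun z => ⟨(2 : ℝ) • c - z, hrefl z z.2⟩)
    (fun z => Subtype.ext (sub_sub_cancel _ _))
    (Isometry.of_dist_eq fun z w => by
      rw [Subtype.dist_eq, Subtype.dist_eq]
      exact dist_sub_left _ _ _)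
  have hcM : c ∈ M := by
    constructor
    · rw [sub_add_cancel_left, norm_neg]
    · rw [sub_sub_cancel]
  have hfix : e ⟨c, hcM⟩ = ⟨c, hcM⟩ := by
    refine IsometryEquiv.apply_eq_of_reflection r ⟨c, hcM⟩ ‖x‖ ?_ ?_ e
    · intro z
      rw [Subtype.dist_eq, dist_eq_norm]
      exact hM z z.2
    · intro z
      rw [Subtype.dist_eq, Subtype.dist_eq, dist_eq_norm, dist_eq_norm]
      change ‖(2 : ℝ) • c - (z : X) - z‖ = 2 * ‖(z : X) - c‖
      rw [show (2 : ℝ) • c - (z : X) - z = (2 : ℝ) • (c - z) by module, norm_smul,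
        Real.norm_ofNat, norm_sub_rev]
  have hgc : g ⟨c, hcM⟩ = c := congrArg Subtype.val hfix
  have := hg ⟨c, hcM⟩
  rw [hgc, ha] at this
  rw [this, two_smul]

theorem eq_zero_of_forall_local_midpoint {f : ℝ → Y} (hf : ContinuousOn f (Set.Icc 0 1))
    (h0 : f 0 = 0) (h1 : f 1 = 0) {η : ℝ} (hη : 0 < η)
    (hmid : ∀ t s : ℝ, 0 ≤ s → s ≤ η → 0 ≤ t - s → t + s ≤ 1 →
      f (t + s) + f (t - s) = (2 : ℝ) • f t) {t : ℝ} (ht : t ∈ Set.Icc (0 : ℝ) 1) : f t = 0 := by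
  obtain ⟨u, huI, hu⟩ := isCompact_Icc.exists_isMaxOn ⟨t, ht⟩ hf.norm
  have hu' : ∀ v ∈ Set.Icc (0 : ℝ) 1, ‖f v‖ ≤ ‖f u‖ := fun v hv => hu hv
  let S : Set ℝ := Set.Icc 0 1 ∩ (fun v => ‖f v‖) ⁻¹' {‖f u‖}
  have hS : IsCompact S :=
    isCompact_Icc.of_isClosed_subset
      (hf.norm.preimage_isClosed_of_isClosed isClosed_Icc isClosed_singleton) Set.inter_subset_left
  obtain ⟨v, ⟨hvI, hv⟩, hleast⟩ := hS.exists_isLeast ⟨u, huI, rfl⟩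
  have hv' : ‖f v‖ = ‖f u‖ := hv
  suffices hzero : ‖f u‖ = 0 from norm_le_zero_iff.mp ((hu' t ht).trans hzero.le)
  by_contra hne
  have hv0 : v ≠ 0 := by
    rintro rfl
    exact hne (by rw [← hv', h0, norm_zero])
  have hv1 : v ≠ 1 := by
    rintro rfl
    exact hne (by rw [← hv', h1, norm_zero])
  have hvpos : 0 < v := lt_of_le_of_ne hvI.1 hv0.symm
  have hvlt : v < 1 := lt_of_le_of_ne hvI.2 hv1
  obtain ⟨s, hs0, hs⟩ := exists_between (lt_min hη (lt_min hvpos (sub_pos.mpr hvlt)))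
  rw [lt_min_iff, lt_min_iff] at hs
  obtain ⟨hsη, hsv, hsv'⟩ := hs
  have hm := hmid v s hs0.le hsη.le (by linarith) (by linarith)
  have hn := norm_add_le (f (v + s)) (f (v - s))
  rw [hm, norm_smul, Real.norm_ofNat, hv'] at hn
  have hp := hu' (v + s) ⟨by linarith, by linarith⟩
  have hq := hu' (v - s) ⟨by linarith, by linarith⟩
  have : v ≤ v - s := hleast ⟨⟨by linarith, by linarith⟩,
    show ‖f (v - s)‖ = ‖f u‖ by linarith⟩
  linarith

theorem map_add_smul_sub_of_mem_interior [CompleteSpace X] (hKc : Convex ℝ K)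
    (hT : ∀ x ∈ K, ∀ y ∈ K, ‖T x - T y‖ = ‖x - y‖) (hL : Convex ℝ (T '' K)) {p q : X}
    (hp : p ∈ interior K) (hq : q ∈ interior K) {t : ℝ} (ht : t ∈ Set.Icc (0 : ℝ) 1) :
    T (p + t • (q - p)) = T p + t • (T q - T p) := by
  have hγc : Continuous fun t : ℝ => p + t • (q - p) := by fun_prop
  have hγ : ∀ t ∈ Set.Icc (0 : ℝ) 1, p + t • (q - p) ∈ interior K :=
    fun t ht => hKc.interior.add_smul_sub_mem hp hq ht
  obtain ⟨δ, hδ, hδK⟩ := ((isCompact_Icc (a := (0 : ℝ)) (b := 1)).image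
    hγc).exists_cthickening_subset_open isOpen_interior (Set.image_subset_iff.mpr hγ)
  have hball : ∀ t ∈ Set.Icc (0 : ℝ) 1, Metric.closedBall (p + t • (q - p)) δ ⊆ K :=
    fun t ht => ((Metric.closedBall_subset_cthickening (Set.mem_image_of_mem _ ht) δ).trans
      hδK).trans interior_subset
  have hTc : ContinuousOn T K :=
    (LipschitzOnWith.of_dist_le_mul (K := 1) fun x hx y hy => by
      rw [dist_eq_norm, dist_eq_norm, hT x hx y hy]; simp).continuousOn
  let ρ := δ / 3000
  have hρ : 0 < ρ := by positivity
  let η := ρ / 64 / (‖q - p‖ + 1)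
  have hη : 0 < η := by positivity
  let f : ℝ → Y := fun t => T (p + t • (q - p)) - (T p + t • (T q - T p))
  suffices f t = 0 from sub_eq_zero.mp this
  refine eq_zero_of_forall_local_midpoint (f := f) ?_ ?_ ?_ hη ?_ ht
  · refine ContinuousOn.sub (hTc.comp hγc.continuousOn fun t ht => interior_subset (hγ t ht)) ?_
    fun_prop
  · simp [f]
  · simp [f]
  · intro t s hs hsη h0 h1
    have hts : t ∈ Set.Icc (0 : ℝ) 1 := ⟨by linarith, by linarith⟩
    have hnorm : ‖s • (q - p)‖ ≤ ρ / 64 := by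
      rw [norm_smul, Real.norm_of_nonneg hs]
      calc s * ‖q - p‖ ≤ η * (‖q - p‖ + 1) := by gcongr; linarith
        _ = ρ / 64 := div_mul_cancel₀ _ (by positivity)
    have hK' : Metric.closedBall (p + t • (q - p)) (3000 * ρ) ⊆ K := by
      rw [show 3000 * ρ = δ from mul_div_cancel₀ _ (by norm_num)]
      exact hball t hts
    have key := map_add_add_map_sub_of_norm_le hT hL hρ hK' hnorm
    have e1 : p + (t + s) • (q - p) = p + t • (q - p) + s • (q - p) := by module
    have e2 : p + (t - s) • (q - p) = p + t • (q - p) - s • (q - p) := by module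
    change T (p + (t + s) • (q - p)) - (T p + (t + s) • (T q - T p))
      + (T (p + (t - s) • (q - p)) - (T p + (t - s) • (T q - T p)))
      = (2 : ℝ) • (T (p + t • (q - p)) - (T p + t • (T q - T p)))
    rw [e1, e2, smul_sub (2 : ℝ), ← key]
    module

/-- An isometry from a convex body in a Banach space onto a convex set is affine. -/
theorem map_convex_combination_of_isometry [CompleteSpace X] (hKc : Convex ℝ K)
    (hKi : (interior K).Nonempty) (hT : ∀ x ∈ K, ∀ y ∈ K, ‖T x - T y‖ = ‖x - y‖)
    (hL : Convex ℝ (T '' K)) {x y : X} (hx : x ∈ K) (hy : y ∈ K) {α : ℝ}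
    (hα : α ∈ Set.Icc (0 : ℝ) 1) :
    T (α • x + (1 - α) • y) = α • T x + (1 - α) • T y := by
  obtain ⟨c, hc⟩ := hKi
  set z := α • x + (1 - α) • y with hz
  have hzK : z ∈ K := hKc hx hy hα.1 (sub_nonneg.mpr hα.2) (by ring)
  have hin : ∀ u ∈ K, ∀ s ∈ Set.Ioc (0 : ℝ) 1, u + s • (c - u) ∈ interior K :=
    fun u hu s hs => hKc.add_smul_sub_mem_interior hu hc hs
  have hclose : ∀ u ∈ K, ∀ s ∈ Set.Ioc (0 : ℝ) 1,
      ‖T (u + s • (c - u)) - T u‖ = s * ‖c - u‖ := by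
    intro u hu s hs
    rw [hT _ (interior_subset (hin u hu s hs)) _ hu, add_sub_cancel_left, norm_smul,
      Real.norm_of_nonneg hs.1.le]
  set C := ‖c - z‖ + ‖c - x‖ + ‖c - y‖ with hC
  set D := T z - (α • T x + (1 - α) • T y) with hD
  have hbound : ∀ s ∈ Set.Ioc (0 : ℝ) 1, ‖D‖ ≤ s * C := by
    intro s hs
    have haff := map_add_smul_sub_of_mem_interior hKc hT hL (hin y hy s hs) (hin x hx s hs) hα
    have e : y + s • (c - y) + α • (x + s • (c - x) - (y + s • (c - y))) = z + s • (c - z) := by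
      rw [hz]; module
    rw [e] at haff
    have eD : D = α • (T (x + s • (c - x)) - T x) + (1 - α) • (T (y + s • (c - y)) - T y)
        - (T (z + s • (c - z)) - T z) := by
      rw [haff, hD]; module
    rw [eD]
    refine (norm_sub_le _ _).trans ?_
    grw [norm_add_le]
    rw [norm_smul, norm_smul, hclose x hx s hs, hclose y hy s hs, hclose z hzK s hs,
      Real.norm_of_nonneg hα.1, Real.norm_of_nonneg (sub_nonneg.mpr hα.2), hC]
    have h1 : α * (s * ‖c - x‖) ≤ s * ‖c - x‖ :=
      mul_le_of_le_one_left (mul_nonneg hs.1.le (norm_nonneg _)) hα.2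
    have h2 : (1 - α) * (s * ‖c - y‖) ≤ s * ‖c - y‖ :=
      mul_le_of_le_one_left (mul_nonneg hs.1.le (norm_nonneg _)) (by linarith [hα.1])
    linarith
  suffices hD0 : ‖D‖ = 0 from sub_eq_zero.mp (norm_eq_zero.mp hD0)
  by_contra hne
  have hDpos : 0 < ‖D‖ := lt_of_le_of_ne (norm_nonneg _) (Ne.symm hne)
  have hDC : ‖D‖ ≤ C := by simpa using hbound 1 ⟨one_pos, le_rfl⟩
  have hCpos : 0 < C := hDpos.trans_le hDC
  have := hbound (‖D‖ / (2 * C)) ⟨by positivity, by rw [div_le_one (by positivity)]; linarith⟩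
  rw [show ‖D‖ / (2 * C) * C = ‖D‖ / 2 by field_simp] at this
  linarith

end NormedSpace

/-- If the closed unit ball of a real Banach space `X` has the strong Mankiewicz property,
then every convex body `K ⊆ X` has the strong Mankiewicz property. -/
theorem strongMankiewicz_of_ball
    (X : Type*) [NormedAddCommGroup X] [NormedSpace ℝ X] [CompleteSpace X]
    (hball : StrongMankiewiczProp (Metric.closedBall (0 : X) 1))
    (K : Set X) (hK : Convex ℝ K) (hKi : (interior K).Nonempty) :
    StrongMankiewiczProp K := by
  intro Y _ _ L hL T hT hTL x hx y hy α hα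
  subst hTL
  exact map_convex_combination_of_isometry hK hKi
    (fun u hu v hv => by rw [← dist_eq_norm, ← dist_eq_norm, hT u hu v hv]) hL hx hy hα
end

section
/- Let X be a real Banach space, Y a real normed space, L ⊂ Y a convex subset, and T : B_X → L a surjective isometry with T(0) = 0. Let a be an extreme point of B_X. Then for every x ∈ X and λ ∈ ℝ with ‖x‖ ≤ 1/2 and ‖x‖ + |λ| ≤ 1, one has ‖T(x + λa) − (T(x) + λT(a))‖ ≤ 4‖x‖·|λ|. -/
open Metric Set

/-- A point lying metrically between `-μ • a` and `μ • a`, with `a` extreme in the unit ball,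
lies on the segment joining them. -/
theorem eq_smul_of_mem_extremePoints_closedBall {X : Type*} [NormedAddCommGroup X]
    [NormedSpace ℝ X] {a v : X} (ha : a ∈ extremePoints ℝ (closedBall (0 : X) 1))
    {μ t : ℝ} (hμ : 0 < μ) (ht₁ : -1 < t) (ht₂ : t < 1)
    (h₁ : ‖v - μ • a‖ ≤ (1 - t) * μ) (h₂ : ‖v + μ • a‖ ≤ (1 + t) * μ) :
    v = (t * μ) • a := by
  have hr : 0 < (1 - t) * μ := mul_pos (by linarith) hμ
  have hs : 0 < (1 + t) * μ := mul_pos (by linarith) hμ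
  have hp : ((1 - t) * μ)⁻¹ • (μ • a - v) ∈ closedBall (0 : X) 1 := by
    rw [mem_closedBall_zero_iff, norm_smul, norm_inv, Real.norm_of_nonneg hr.le, norm_sub_rev]
    exact inv_mul_le_one_of_le₀ h₁ hr.le
  have hq : ((1 + t) * μ)⁻¹ • (v + μ • a) ∈ closedBall (0 : X) 1 := by
    rw [mem_closedBall_zero_iff, norm_smul, norm_inv, Real.norm_of_nonneg hs.le]
    exact inv_mul_le_one_of_le₀ h₂ hs.le
  have hseg : a ∈ openSegment ℝ (((1 + t) * μ)⁻¹ • (v + μ • a))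
      (((1 - t) * μ)⁻¹ • (μ • a - v)) := by
    refine ⟨(1 + t) / 2, (1 - t) / 2, by linarith, by linarith, by ring, ?_⟩
    have h1 : 1 - t ≠ 0 := by linarith
    have h2 : 1 + t ≠ 0 := by linarith
    match_scalars <;> field_simp <;> ring
  have hqa : ((1 + t) * μ)⁻¹ • (v + μ • a) = a := ha.2 hq hp hseg
  rw [inv_smul_eq_iff₀ hs.ne'] at hqa
  rw [eq_sub_of_add_eq hqa, ← sub_smul]
  congr 1
  ring

/-- An isometry of the unit ball onto a convex set is affine on chords parallel to an extreme
point of the ball. -/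
theorem isometry_closedBall_affine_on_chord {X Y : Type*} [NormedAddCommGroup X]
    [NormedSpace ℝ X] [NormedAddCommGroup Y] [NormedSpace ℝ Y] {T : X → Y}
    (hconv : Convex ℝ (T '' closedBall (0 : X) 1))
    (hiso : ∀ x ∈ closedBall (0 : X) 1, ∀ y ∈ closedBall (0 : X) 1, dist (T x) (T y) = dist x y)
    {a : X} (ha : a ∈ extremePoints ℝ (closedBall (0 : X) 1)) {x : X} {μ t : ℝ} (hμ : 0 < μ)
    (hp : x + μ • a ∈ closedBall (0 : X) 1) (hq : x - μ • a ∈ closedBall (0 : X) 1)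
    (ht : |t| ≤ 1) :
    T (x + (t * μ) • a) = T x + t • (T (x + μ • a) - T x) := by
  have hnorm : ‖a‖ ≤ 1 := mem_closedBall_zero_iff.mp ha.1
  have hdist : ‖T (x + μ • a) - T (x - μ • a)‖ ≤ 2 * μ := by
    rw [← dist_eq_norm, hiso _ hp _ hq, dist_eq_norm,
      show x + μ • a - (x - μ • a) = (2 * μ) • a by module, norm_smul,
      Real.norm_of_nonneg (by positivity)]
    exact mul_le_of_le_one_right (by positivity) hnorm
  have key : ∀ s : ℝ, -1 < s → s < 1 → T (x + (s * μ) • a) =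
      ((1 + s) / 2) • T (x + μ • a) + ((1 - s) / 2) • T (x - μ • a) := by
    intro s hs₁ hs₂
    obtain ⟨u, hu, hTu⟩ := hconv (mem_image_of_mem T hp) (mem_image_of_mem T hq)
      (show 0 ≤ (1 + s) / 2 by linarith) (show 0 ≤ (1 - s) / 2 by linarith) (by ring)
    rw [← hTu]
    have h₁ : ‖u - x - μ • a‖ ≤ (1 - s) * μ := by
      rw [sub_sub, ← dist_eq_norm, ← hiso _ hu _ hp, hTu, dist_eq_norm,
        show ((1 + s) / 2) • T (x + μ • a) + ((1 - s) / 2) • T (x - μ • a) - T (x + μ • a) =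
          (-((1 - s) / 2)) • (T (x + μ • a) - T (x - μ • a)) by module,
        norm_smul, norm_neg, Real.norm_of_nonneg (by linarith)]
      nlinarith
    have h₂ : ‖u - x + μ • a‖ ≤ (1 + s) * μ := by
      rw [show u - x + μ • a = u - (x - μ • a) by abel, ← dist_eq_norm, ← hiso _ hu _ hq, hTu,
        dist_eq_norm,
        show ((1 + s) / 2) • T (x + μ • a) + ((1 - s) / 2) • T (x - μ • a) - T (x - μ • a) =
          ((1 + s) / 2) • (T (x + μ • a) - T (x - μ • a)) by module,
        norm_smul, Real.norm_of_nonneg (by linarith)]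
      nlinarith
    have huv := eq_smul_of_mem_extremePoints_closedBall ha hμ hs₁ hs₂ h₁ h₂
    rw [← huv, add_sub_cancel]
  have hmid : T x = (1 / 2 : ℝ) • T (x + μ • a) + (1 / 2 : ℝ) • T (x - μ • a) := by
    simpa using key 0 (by norm_num) (by norm_num)
  have hTq : T (x - μ • a) = (2 : ℝ) • T x - T (x + μ • a) := by
    rw [hmid]
    module
  obtain ⟨ht₁, ht₂⟩ := abs_le.mp ht
  rcases ht₁.eq_or_lt with rfl | ht₁
  · rw [show x + (-1 * μ) • a = x - μ • a by module, hTq]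
    module
  rcases ht₂.eq_or_lt with rfl | ht₂
  · simp
  rw [key t ht₁ ht₂, hTq]
  module

/-- Let `X` be a real Banach space, `Y` a real normed space, `L ⊆ Y` a convex subset and
`T : B_X → L` a surjective isometry with `T 0 = 0`. If `a` is an extreme point of the closed
unit ball `B_X`, then for every `x ∈ X` and `λ ∈ ℝ` with `‖x‖ ≤ 1/2` and `‖x‖ + |λ| ≤ 1`,
one has `‖T (x + λ • a) - (T x + λ • T a)‖ ≤ 4 ‖x‖ |λ|`. -/
theorem norm_isometry_extremePoint_estimate
    (X : Type*) [NormedAddCommGroup X] [NormedSpace ℝ X] [CompleteSpace X]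
    (Y : Type*) [NormedAddCommGroup Y] [NormedSpace ℝ Y]
    (L : Set Y) (hL : Convex ℝ L) (T : X → Y)
    (hiso : ∀ x ∈ Metric.closedBall (0 : X) 1, ∀ y ∈ Metric.closedBall (0 : X) 1,
      dist (T x) (T y) = dist x y)
    (hsurj : T '' Metric.closedBall (0 : X) 1 = L)
    (hT0 : T 0 = 0)
    (a : X) (ha : a ∈ Set.extremePoints ℝ (Metric.closedBall (0 : X) 1))
    (x : X) (lam : ℝ) (hx : ‖x‖ ≤ 1 / 2) (hxl : ‖x‖ + |lam| ≤ 1) :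
    ‖T (x + lam • a) - (T x + lam • T a)‖ ≤ 4 * ‖x‖ * |lam| := by
  have hnorm : ‖a‖ ≤ 1 := mem_closedBall_zero_iff.mp ha.1
  have hconv : Convex ℝ (T '' closedBall (0 : X) 1) := hsurj ▸ hL
  obtain ⟨μ, hμ⟩ : ∃ μ, μ = 1 - ‖x‖ := ⟨_, rfl⟩
  have hμ_half : 1 / 2 ≤ μ := by linarith
  have hμ_pos : 0 < μ := by linarith
  have hμ_one : μ ≤ 1 := by linarith [norm_nonneg x]
  have hμa : ‖μ • a‖ ≤ μ := by
    rw [norm_smul, Real.norm_of_nonneg hμ_pos.le]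
    exact mul_le_of_le_one_right hμ_pos.le hnorm
  have h0 : (0 : X) ∈ closedBall (0 : X) 1 := by simp
  have hxB : x ∈ closedBall (0 : X) 1 := by
    rw [mem_closedBall_zero_iff]
    linarith
  have hp : x + μ • a ∈ closedBall (0 : X) 1 := by
    rw [mem_closedBall_zero_iff]
    linarith [norm_add_le x (μ • a)]
  have hq : x - μ • a ∈ closedBall (0 : X) 1 := by
    rw [mem_closedBall_zero_iff]
    linarith [norm_sub_le x (μ • a)]
  have hμaB : μ • a ∈ closedBall (0 : X) 1 := by
    rw [mem_closedBall_zero_iff]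
    linarith
  have hTμa : T (μ • a) = μ • T a := by
    simpa [hT0] using isometry_closedBall_affine_on_chord hconv hiso ha (x := 0) (μ := 1)
      (t := μ) one_pos (by simpa using hnorm) (by simpa using hnorm)
      (by rwa [abs_of_pos hμ_pos])
  have ht : |lam / μ| ≤ 1 := by
    rw [abs_div, abs_of_pos hμ_pos, div_le_one hμ_pos]
    linarith
  have hline := isometry_closedBall_affine_on_chord hconv hiso ha hμ_pos hp hq ht
  rw [div_mul_cancel₀ _ hμ_pos.ne'] at hline
  have hTx : ‖T x‖ = ‖x‖ := by
    simpa [hT0] using hiso x hxB 0 h0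
  have hTp : ‖T (x + μ • a) - T (μ • a)‖ = ‖x‖ := by
    rw [← dist_eq_norm, hiso _ hp _ hμaB, dist_eq_norm, add_sub_cancel_right]
  have hdefect : T (x + lam • a) - (T x + lam • T a) =
      (lam / μ) • (T (x + μ • a) - T (μ • a) - T x) := by
    rw [hline, hTμa]
    match_scalars <;> field_simp <;> ring
  have hcoef : |lam / μ| ≤ 2 * |lam| := by
    rw [abs_div, abs_of_pos hμ_pos, div_le_iff₀ hμ_pos]
    nlinarith [abs_nonneg lam]
  calc ‖T (x + lam • a) - (T x + lam • T a)‖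
      = |lam / μ| * ‖T (x + μ • a) - T (μ • a) - T x‖ := by
        rw [hdefect, norm_smul, Real.norm_eq_abs]
    _ ≤ 2 * |lam| * (‖x‖ + ‖x‖) := by
        gcongr
        exact (norm_sub_le _ _).trans (by rw [hTp, hTx])
    _ = 4 * ‖x‖ * |lam| := by ring
end

section
/- Let f and g be continuous strictly increasing functions from [0,1] onto [0,1], and let f⁻¹, g⁻¹ denote their inverse functions (which are again continuous strictly increasing bijections of [0,1]). Then ∫₀¹ |f⁻¹(t) − g⁻¹(t)| dt = ∫₀¹ |f(t) − g(t)| dt; that is, the inversion map is an isometry for the L¹[0,1] distance. -/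
open Set MeasureTheory

/-- The distance between two points of `[0,1]` is the measure of the open interval between them. -/
lemma lintegral_indicator_uIoo_unitInterval {a b : ℝ} (ha : a ∈ Icc (0:ℝ) 1)
    (hb : b ∈ Icc (0:ℝ) 1) :
    ∫⁻ y in Icc (0:ℝ) 1, (uIoo a b).indicator 1 y = ENNReal.ofReal |a - b| := by
  have hsub : uIoo a b ⊆ Icc 0 1 := fun y hy =>
    ⟨(le_inf ha.1 hb.1).trans hy.1.le, hy.2.le.trans (sup_le ha.2 hb.2)⟩
  have hmeas : MeasurableSet (uIoo a b) := measurableSet_Ioo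
  rw [lintegral_indicator_one hmeas, Measure.restrict_apply hmeas,
    inter_eq_self_of_subset_left hsub, Real.volume_uIoo, abs_sub_comm]

/-- A strictly increasing map `f` with inverse `fi` satisfies `f x < y ↔ x < fi y` and
`y < f x ↔ fi y < x`. -/
lemma StrictMonoOn.lt_iff_lt_of_invOn {α β : Type*} [LinearOrder α] [Preorder β] {f : α → β}
    {fi : β → α} {s : Set α} {t : Set β} (hf : StrictMonoOn f s) (hinv : InvOn fi f s t)
    (hmaps : MapsTo fi t s) {x : α} {y : β} (hx : x ∈ s) (hy : y ∈ t) :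
    (f x < y ↔ x < fi y) ∧ (y < f x ↔ fi y < x) := by
  constructor
  · rw [← hf.lt_iff_lt hx (hmaps hy), hinv.2 hy]
  · rw [← hf.lt_iff_lt (hmaps hy) hx, hinv.2 hy]

/-- The inverse of a map of `s` onto `t` maps `t` into `s`. -/
lemma Set.InvOn.mapsTo_of_image_eq {α β : Type*} {f : α → β} {fi : β → α} {s : Set α} {t : Set β}
    (hinv : InvOn fi f s t) (hs : f '' s = t) : MapsTo fi t s := by
  rw [← hs]
  rintro _ ⟨x, hx, rfl⟩
  rwa [hinv.1 hx]

lemma StrictMonoOn.monotoneOn_of_invOn {α β : Type*} [LinearOrder α] [Preorder β] {f : α → β}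
    {fi : β → α} {s : Set α} {t : Set β} (hf : StrictMonoOn f s) (hinv : InvOn fi f s t)
    (hmaps : MapsTo fi t s) : MonotoneOn fi t := by
  intro a ha b hb hab
  rwa [← hf.le_iff_le (hmaps ha) (hmaps hb), hinv.2 ha, hinv.2 hb]

/-- The interval integral of `|u - v|` over `[0,1]` as a lower Lebesgue integral. -/
lemma integral_abs_sub_eq_toReal_lintegral {u v : ℝ → ℝ} (hu : MonotoneOn u (Icc 0 1))
    (hv : MonotoneOn v (Icc 0 1)) :
    ∫ t in (0:ℝ)..1, |u t - v t| =
      (∫⁻ t in Icc (0:ℝ) 1, ENNReal.ofReal |u t - v t|).toReal := by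
  have hum := aemeasurable_restrict_of_monotoneOn (μ := volume) measurableSet_Icc hu
  have hvm := aemeasurable_restrict_of_monotoneOn (μ := volume) measurableSet_Icc hv
  rw [intervalIntegral.integral_of_le zero_le_one, ← integral_Icc_eq_integral_Ioc]
  exact integral_eq_lintegral_of_nonneg_ae (.of_forall fun _ => abs_nonneg _)
    (continuous_abs.measurable.comp_aemeasurable (hum.sub hvm)).aestronglyMeasurable

/-- If `f` and `g` are continuous strictly increasing bijections of `[0,1]` onto itself and
`fi`, `gi` are their inverse functions, then
`∫₀¹ |fi t - gi t| dt = ∫₀¹ |f t - g t| dt`; i.e. inversion is an isometry for the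
`L¹[0,1]`-distance. -/
theorem integral_abs_sub_inverse_eq
    (f g fi gi : ℝ → ℝ)
    (hfc : ContinuousOn f (Icc 0 1)) (hfm : StrictMonoOn f (Icc 0 1))
    (hfs : f '' Icc 0 1 = Icc 0 1)
    (hgc : ContinuousOn g (Icc 0 1)) (hgm : StrictMonoOn g (Icc 0 1))
    (hgs : g '' Icc 0 1 = Icc 0 1)
    (hfi : Set.InvOn fi f (Icc 0 1) (Icc 0 1))
    (hgi : Set.InvOn gi g (Icc 0 1) (Icc 0 1)) :
    ∫ t in (0:ℝ)..1, |fi t - gi t| = ∫ t in (0:ℝ)..1, |f t - g t| := by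
  have hf_maps : MapsTo f (Icc 0 1) (Icc 0 1) := mapsTo_iff_image_subset.2 hfs.subset
  have hg_maps : MapsTo g (Icc 0 1) (Icc 0 1) := mapsTo_iff_image_subset.2 hgs.subset
  have hfi_maps := hfi.mapsTo_of_image_eq hfs
  have hgi_maps := hgi.mapsTo_of_image_eq hgs
  rw [integral_abs_sub_eq_toReal_lintegral (hfm.monotoneOn_of_invOn hfi hfi_maps)
      (hgm.monotoneOn_of_invOn hgi hgi_maps),
    integral_abs_sub_eq_toReal_lintegral hfm.monotoneOn hgm.monotoneOn]
  congr 1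
  have hmem : ∀ x ∈ Icc (0:ℝ) 1, ∀ y ∈ Icc (0:ℝ) 1,
      (x ∈ uIoo (fi y) (gi y) ↔ y ∈ uIoo (f x) (g x)) := by
    intro x hx y hy
    have hf := hfm.lt_iff_lt_of_invOn hfi hfi_maps hx hy
    have hg := hgm.lt_iff_lt_of_invOn hgi hgi_maps hx hy
    simp only [uIoo, mem_Ioo, inf_lt_iff, lt_sup_iff, hf.1, hf.2, hg.1, hg.2, and_comm]
  have hfm' := aemeasurable_restrict_of_monotoneOn (μ := volume) measurableSet_Icc hfm.monotoneOn
  have hgm' := aemeasurable_restrict_of_monotoneOn (μ := volume) measurableSet_Icc hgm.monotoneOn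
  have hmeas : AEMeasurable (Function.uncurry fun x y : ℝ => (uIoo (f x) (g x)).indicator
      (1 : ℝ → ENNReal) y) ((volume.restrict (Icc 0 1)).prod (volume.restrict (Icc 0 1))) := by
    have hset : NullMeasurableSet {p : ℝ × ℝ | p.2 ∈ uIoo (f p.1) (g p.1)}
        ((volume.restrict (Icc 0 1)).prod (volume.restrict (Icc 0 1))) :=
      (nullMeasurableSet_lt (hfm'.comp_fst.inf hgm'.comp_fst) measurable_snd.aemeasurable).inter
        (nullMeasurableSet_lt measurable_snd.aemeasurable (hfm'.comp_fst.sup hgm'.comp_fst))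
    exact (aemeasurable_const (b := (1 : ENNReal))).indicator₀ hset
  calc ∫⁻ y in Icc (0:ℝ) 1, ENNReal.ofReal |fi y - gi y|
      = ∫⁻ y in Icc (0:ℝ) 1, ∫⁻ x in Icc (0:ℝ) 1, (uIoo (fi y) (gi y)).indicator 1 x :=
        setLIntegral_congr_fun measurableSet_Icc fun y hy =>
          (lintegral_indicator_uIoo_unitInterval (hfi_maps hy) (hgi_maps hy)).symm
    _ = ∫⁻ y in Icc (0:ℝ) 1, ∫⁻ x in Icc (0:ℝ) 1, (uIoo (f x) (g x)).indicator 1 y :=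
        setLIntegral_congr_fun measurableSet_Icc fun y hy =>
          setLIntegral_congr_fun measurableSet_Icc fun x hx => by
            classical simp only [indicator_apply, hmem x hx y hy, Pi.one_apply]
    _ = ∫⁻ x in Icc (0:ℝ) 1, ∫⁻ y in Icc (0:ℝ) 1, (uIoo (f x) (g x)).indicator 1 y :=
        (lintegral_lintegral_swap hmeas).symm
    _ = ∫⁻ x in Icc (0:ℝ) 1, ENNReal.ofReal |f x - g x| :=
        setLIntegral_congr_fun measurableSet_Icc fun x hx =>
          lintegral_indicator_uIoo_unitInterval (hf_maps hx) (hg_maps hx)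
end

section
/- Let K₀ be the set of all continuous strictly increasing functions from [0,1] onto [0,1], viewed inside L¹[0,1], and let K be the closure of K₀ in L¹[0,1]. Then K is a compact convex subset of L¹[0,1], the map T₀ : K₀ → K₀ sending f to its inverse function extends to a surjective isometry T : K → K, and this T is not affine. In particular, the compact convex subset K ⊂ L¹[0,1] does not have the strong Mankiewicz property. -/
open MeasureTheory Set

/-- Lebesgue measure restricted to `[0,1]`; `Lp ℝ 1 mu01` is the space `L¹[0,1]`. -/
noncomputable def mu01 : Measure ℝ := volume.restrict (Icc 0 1)

/-- `f` is a continuous strictly increasing function from `[0,1]` onto `[0,1]`. -/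
def IsIncBij (f : ℝ → ℝ) : Prop :=
  ContinuousOn f (Icc 0 1) ∧ StrictMonoOn f (Icc 0 1) ∧ f '' Icc 0 1 = Icc 0 1

/-- The set `K₀ ⊆ L¹[0,1]` of (classes of) continuous strictly increasing bijections of
`[0,1]`. -/
noncomputable def SchechtmanK0 : Set (Lp ℝ 1 mu01) :=
  {h | ∃ f : ℝ → ℝ, IsIncBij f ∧ ⇑h =ᵐ[mu01] f}

/-- `K`, the closure of `K₀` in `L¹[0,1]`. -/
noncomputable def SchechtmanK : Set (Lp ℝ 1 mu01) := closure SchechtmanK0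

namespace IsIncBij

variable {f g fi : ℝ → ℝ}

theorem of_endpoints (hc : ContinuousOn f (Icc 0 1)) (hm : StrictMonoOn f (Icc 0 1))
    (h0 : f 0 = 0) (h1 : f 1 = 1) : IsIncBij f := by
  refine ⟨hc, hm, Subset.antisymm ?_ ?_⟩
  · simpa [h0, h1] using hm.monotoneOn.image_Icc_subset
  · simpa [h0, h1] using intermediate_value_Icc zero_le_one hc

theorem mapsTo (hf : IsIncBij f) : MapsTo f (Icc 0 1) (Icc 0 1) :=
  mapsTo_iff_image_subset.2 hf.2.2.subset

theorem bijOn (hf : IsIncBij f) : BijOn f (Icc 0 1) (Icc 0 1) :=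
  ⟨hf.mapsTo, hf.2.1.injOn, hf.2.2.superset⟩

theorem map_zero (hf : IsIncBij f) : f 0 = 0 := by
  obtain ⟨x, hx, h⟩ := hf.2.2.superset (left_mem_Icc.2 zero_le_one)
  have h0 := hf.mapsTo (left_mem_Icc.2 zero_le_one)
  have := hf.2.1.monotoneOn (left_mem_Icc.2 zero_le_one) hx hx.1
  exact le_antisymm (this.trans h.le) h0.1

theorem map_one (hf : IsIncBij f) : f 1 = 1 := by
  obtain ⟨x, hx, h⟩ := hf.2.2.superset (right_mem_Icc.2 zero_le_one)
  have h1 := hf.mapsTo (right_mem_Icc.2 zero_le_one)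
  have := hf.2.1.monotoneOn hx (right_mem_Icc.2 zero_le_one) hx.2
  exact le_antisymm h1.2 (h.ge.trans this)

theorem mapsTo_inverse (hf : IsIncBij f) (h : InvOn fi f (Icc 0 1) (Icc 0 1)) :
    MapsTo fi (Icc 0 1) (Icc 0 1) := by
  intro y hy
  obtain ⟨x, hx, rfl⟩ := hf.2.2.superset hy
  rwa [h.1 hx]

theorem inverse (hf : IsIncBij f) (h : InvOn fi f (Icc 0 1) (Icc 0 1)) : IsIncBij fi := by
  have hmaps := hf.mapsTo_inverse h
  have hm : StrictMonoOn fi (Icc 0 1) := by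
    intro x hx y hy hxy
    rw [← hf.2.1.lt_iff_lt (hmaps hx) (hmaps hy), h.2 hx, h.2 hy]
    exact hxy
  have himage : fi '' Icc 0 1 = Icc 0 1 :=
    Subset.antisymm hmaps.image_subset fun x hx => ⟨f x, hf.mapsTo hx, h.1 hx⟩
  refine ⟨?_, hm, himage⟩
  exact continuousOn_iff_continuous_domRestrict.2 (continuous_subtype_val.comp
    ((hm.orderIso fi (Icc 0 1)).trans (OrderIso.setCongr _ _ himage)).continuous)

theorem lt_inverse_iff (hf : IsIncBij f) (h : InvOn fi f (Icc 0 1) (Icc 0 1)) {x y : ℝ}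
    (hx : x ∈ Icc (0 : ℝ) 1) (hy : y ∈ Icc (0 : ℝ) 1) : f x < y ↔ x < fi y := by
  rw [← hf.2.1.lt_iff_lt hx (hf.mapsTo_inverse h hy), h.2 hy]

theorem inverse_lt_iff (hf : IsIncBij f) (h : InvOn fi f (Icc 0 1) (Icc 0 1)) {x y : ℝ}
    (hx : x ∈ Icc (0 : ℝ) 1) (hy : y ∈ Icc (0 : ℝ) 1) : y < f x ↔ fi y < x := by
  rw [← hf.2.1.lt_iff_lt (hf.mapsTo_inverse h hy) hx, h.2 hy]

theorem convexComb (hf : IsIncBij f) (hg : IsIncBij g) {a b : ℝ} (ha : 0 ≤ a) (hb : 0 ≤ b)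
    (hab : a + b = 1) : IsIncBij (a • f + b • g) := by
  refine of_endpoints ((hf.1.const_smul a).add (hg.1.const_smul b)) ?_ ?_ ?_
  · intro x hx y hy hxy
    have h1 := hf.2.1 hx hy hxy
    have h2 := hg.2.1 hx hy hxy
    simp only [Pi.add_apply, Pi.smul_apply, smul_eq_mul]
    rcases ha.eq_or_lt with rfl | ha'
    · obtain rfl : b = 1 := by linarith
      simpa using h2
    · exact add_lt_add_of_lt_of_le (mul_lt_mul_of_pos_left h1 ha')
        (mul_le_mul_of_nonneg_left h2.le hb)
  · simp [hf.map_zero, hg.map_zero]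
  · simpa [hf.map_one, hg.map_one] using hab

theorem eqOn_of_ae_eq (hf : IsIncBij f) (hg : IsIncBij g) (h : f =ᵐ[mu01] g) :
    EqOn f g (Icc 0 1) :=
  Measure.eqOn_Icc_of_ae_eq volume zero_ne_one h hf.1 hg.1

theorem memLp (hf : IsIncBij f) : MemLp f 1 mu01 :=
  memLp_one_iff_integrable.2 (hf.1.integrableOn_compact isCompact_Icc)

theorem toLp_mem (hf : IsIncBij f) : hf.memLp.toLp f ∈ SchechtmanK0 :=
  ⟨f, hf, hf.memLp.coeFn_toLp⟩

end IsIncBij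

theorem mu01_Ioo {a b : ℝ} (ha : a ∈ Icc (0 : ℝ) 1) (hb : b ∈ Icc (0 : ℝ) 1) :
    mu01 (Ioo a b) = ENNReal.ofReal (b - a) := by
  rw [mu01, Measure.restrict_apply measurableSet_Ioo,
    inter_eq_left.2 (Ioo_subset_Icc_self.trans (Icc_subset_Icc ha.1 hb.2)), Real.volume_Ioo]

theorem ae_mem_Icc_mu01 : ∀ᵐ x ∂mu01, x ∈ Icc (0 : ℝ) 1 := ae_restrict_mem measurableSet_Icc

instance : IsFiniteMeasure mu01 := by unfold mu01; infer_instance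

/-- The region above the graph of `f` and below that of `g` has the same area as its reflection
in the diagonal. -/
theorem lintegral_sub_eq_lintegral_inverse_sub {f g fi gi : ℝ → ℝ} (hf : IsIncBij f)
    (hg : IsIncBij g) (hfi : InvOn fi f (Icc 0 1) (Icc 0 1))
    (hgi : InvOn gi g (Icc 0 1) (Icc 0 1)) :
    ∫⁻ x, ENNReal.ofReal (g x - f x) ∂mu01 = ∫⁻ y, ENNReal.ofReal (fi y - gi y) ∂mu01 := by
  set F : ℝ → ℝ := IccExtend zero_le_one ((Icc (0 : ℝ) 1).domRestrict f)
  set G : ℝ → ℝ := IccExtend zero_le_one ((Icc (0 : ℝ) 1).domRestrict g)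
  have hF : Continuous F := (continuousOn_iff_continuous_domRestrict.1 hf.1).Icc_extend'
  have hG : Continuous G := (continuousOn_iff_continuous_domRestrict.1 hg.1).Icc_extend'
  have hFf : ∀ x ∈ Icc (0 : ℝ) 1, F x = f x := fun x hx => IccExtend_of_mem _ _ hx
  have hGg : ∀ x ∈ Icc (0 : ℝ) 1, G x = g x := fun x hx => IccExtend_of_mem _ _ hx
  set S : Set (ℝ × ℝ) := {p | F p.1 < p.2 ∧ p.2 < G p.1}
  have hS : MeasurableSet S :=
    ((isOpen_lt (hF.comp continuous_fst) continuous_snd).inter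
      (isOpen_lt continuous_snd (hG.comp continuous_fst))).measurableSet
  trans (mu01.prod mu01) S
  · rw [Measure.prod_apply hS]
    refine lintegral_congr_ae (ae_mem_Icc_mu01.mono fun x hx => ?_)
    simp only
    rw [← mu01_Ioo (hf.mapsTo hx) (hg.mapsTo hx)]
    congr 1
    ext y
    simp [S, hFf x hx, hGg x hx]
  · rw [Measure.prod_apply_symm hS]
    refine lintegral_congr_ae (ae_mem_Icc_mu01.mono fun y hy => ?_)
    simp only
    rw [← mu01_Ioo (hg.mapsTo_inverse hgi hy) (hf.mapsTo_inverse hfi hy)]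
    refine measure_congr (ae_mem_Icc_mu01.mono fun x hx => propext ?_)
    change F x < y ∧ y < G x ↔ gi y < x ∧ x < fi y
    rw [hFf x hx, hGg x hx, hf.lt_inverse_iff hfi hx hy, hg.inverse_lt_iff hgi hx hy, and_comm]

theorem lintegral_enorm_sub_eq_add {f g : ℝ → ℝ} (hf : IsIncBij f) (hg : IsIncBij g) :
    ∫⁻ x, ‖f x - g x‖ₑ ∂mu01 =
      ∫⁻ x, ENNReal.ofReal (f x - g x) ∂mu01 + ∫⁻ x, ENNReal.ofReal (g x - f x) ∂mu01 := by
  rw [← lintegral_add_left']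
  · refine lintegral_congr fun x => ?_
    rw [Real.enorm_eq_ofReal_abs]
    rcases le_total (f x) (g x) with h | h
    · rw [abs_of_nonpos (sub_nonpos.2 h), ENNReal.ofReal_of_nonpos (sub_nonpos.2 h), zero_add,
        neg_sub]
    · rw [abs_of_nonneg (sub_nonneg.2 h), ENNReal.ofReal_of_nonpos (sub_nonpos.2 h), add_zero]
  · exact (hf.memLp.sub hg.memLp).aestronglyMeasurable.aemeasurable.ennreal_ofReal

theorem edist_eq_lintegral {h k : Lp ℝ 1 mu01} {f g : ℝ → ℝ} (hf : h =ᵐ[mu01] f)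
    (hg : k =ᵐ[mu01] g) : edist h k = ∫⁻ x, ‖f x - g x‖ₑ ∂mu01 := by
  rw [Lp.edist_def, eLpNorm_one_eq_lintegral_enorm]
  exact lintegral_congr_ae ((hf.sub hg).mono fun x hx => by simp [hx])

theorem dist_eq_integral {h k : Lp ℝ 1 mu01} {f g : ℝ → ℝ} (hf : h =ᵐ[mu01] f)
    (hg : k =ᵐ[mu01] g) (hf' : IsIncBij f) (hg' : IsIncBij g) :
    dist h k = ∫ x in (0 : ℝ)..1, |f x - g x| := by
  rw [intervalIntegral.integral_of_le zero_le_one, ← integral_Icc_eq_integral_Ioc, dist_edist,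
    edist_eq_lintegral hf hg]
  exact (integral_norm_eq_lintegral_enorm (hf'.memLp.sub hg'.memLp).aestronglyMeasurable).symm

theorem dist_inverse {h k h' k' : Lp ℝ 1 mu01} {f g fi gi : ℝ → ℝ} (hf : IsIncBij f)
    (hg : IsIncBij g) (hfi : InvOn fi f (Icc 0 1) (Icc 0 1))
    (hgi : InvOn gi g (Icc 0 1) (Icc 0 1)) (hhf : h =ᵐ[mu01] f) (hkg : k =ᵐ[mu01] g)
    (hhf' : h' =ᵐ[mu01] fi) (hkg' : k' =ᵐ[mu01] gi) : dist h' k' = dist h k := by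
  rw [dist_edist, dist_edist, edist_eq_lintegral hhf hkg, edist_eq_lintegral hhf' hkg',
    lintegral_enorm_sub_eq_add hf hg, lintegral_enorm_sub_eq_add (hf.inverse hfi) (hg.inverse hgi),
    lintegral_sub_eq_lintegral_inverse_sub hf hg hfi hgi,
    lintegral_sub_eq_lintegral_inverse_sub hg hf hgi hfi, add_comm]

theorem convex_schechtmanK0 : Convex ℝ SchechtmanK0 := by
  rintro h ⟨f, hf, hhf⟩ k ⟨g, hg, hkg⟩ a b ha hb hab
  refine ⟨_, hf.convexComb hg ha hb hab, ?_⟩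
  exact (Lp.coeFn_add _ _).trans (((Lp.coeFn_smul a h).trans (hhf.const_smul a)).add
    ((Lp.coeFn_smul b k).trans (hkg.const_smul b)))

theorem integral_abs_sub_le_of_close {f g : ℝ → ℝ} (hf : IsIncBij f) (hg : IsIncBij g) {n : ℕ}
    (hn : 0 < n) (hfg : ∀ i ≤ n, |f (i / n) - g (i / n)| ≤ 1 / n) :
    ∫ x in (0 : ℝ)..1, |f x - g x| ≤ 2 / n := by
  have hn' : (0 : ℝ) < n := Nat.cast_pos.2 hn
  have hmem : ∀ i ≤ n, ((i : ℝ) / n) ∈ Icc (0 : ℝ) 1 := fun i hi =>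
    ⟨by positivity, (div_le_one hn').2 (Nat.cast_le.2 hi)⟩
  have hle : ∀ i : ℕ, (i : ℝ) / n ≤ ((i + 1 : ℕ) : ℝ) / n := fun i => by
    gcongr; simp
  have hint : ∀ i < n, IntervalIntegrable (fun x => |f x - g x|) volume (i / n)
      ((i + 1 : ℕ) / n) := fun i hi => by
    refine ContinuousOn.intervalIntegrable ((hf.1.sub hg.1).abs.mono ?_)
    rw [uIcc_of_le (hle i)]
    exact Icc_subset_Icc (hmem i hi.le).1 (hmem (i + 1) hi).2
  have hcell : ∀ i < n, ∫ x in (i / n : ℝ)..((i + 1 : ℕ) / n), |f x - g x| ≤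
      (f ((i + 1 : ℕ) / n) - f (i / n) + 1 / n) * (1 / n) := fun i hi => by
    have hi0 := hmem i hi.le
    have hi1 := hmem (i + 1) hi
    refine (Real.le_norm_self _).trans ((intervalIntegral.norm_integral_le_of_norm_le_const
      (C := f ((i + 1 : ℕ) / n) - f (i / n) + 1 / n) fun x hx => ?_).trans_eq ?_)
    · rw [uIoc_of_le (hle i)] at hx
      have hx' : x ∈ Icc (0 : ℝ) 1 := ⟨hi0.1.trans hx.1.le, hx.2.trans hi1.2⟩
      have f1 := hf.2.1.monotoneOn hi0 hx' hx.1.le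
      have f2 := hf.2.1.monotoneOn hx' hi1 hx.2
      have g1 := hg.2.1.monotoneOn hi0 hx' hx.1.le
      have g2 := hg.2.1.monotoneOn hx' hi1 hx.2
      have d0 := abs_le.1 (hfg i hi.le)
      have d1 := abs_le.1 (hfg (i + 1) hi)
      rw [Real.norm_eq_abs, abs_abs, abs_le]
      constructor <;> linarith [d0.1, d0.2, d1.1, d1.2]
    · rw [abs_of_nonneg (sub_nonneg.2 (hle i))]
      push_cast
      ring
  have hsum := intervalIntegral.sum_integral_adjacent_intervals
    (a := fun i : ℕ => (i : ℝ) / n) hint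
  simp only [Nat.cast_zero, zero_div, div_self hn'.ne'] at hsum
  rw [← hsum]
  refine (Finset.sum_le_sum fun i hi => hcell i (Finset.mem_range.1 hi)).trans_eq ?_
  rw [← Finset.sum_mul, Finset.sum_add_distrib,
    Finset.sum_range_sub (fun i : ℕ => f ((i : ℝ) / n))]
  simp [hn'.ne', hf.map_zero, hf.map_one]
  ring

theorem totallyBounded_schechtmanK0 : TotallyBounded SchechtmanK0 := by
  choose! φ hφ hφ' using fun (h : Lp ℝ 1 mu01) (hh : h ∈ SchechtmanK0) => hh
  refine Metric.totallyBounded_of_finite_discretization fun ε hε => ?_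
  obtain ⟨n, hn⟩ := exists_nat_gt (2 / ε)
  have hn' : (0 : ℝ) < n := (by positivity : 0 < 2 / ε).trans hn
  refine ⟨Fin (n + 1) → Fin (n + 1), inferInstance,
    fun h i => Fin.ofNat (n + 1) ⌊(n : ℝ) * φ h (i / n)⌋₊, fun h k hhk => ?_⟩
  rw [dist_eq_integral (hφ' h h.2) (hφ' k k.2) (hφ h h.2) (hφ k k.2)]
  refine (integral_abs_sub_le_of_close (hφ h h.2) (hφ k k.2) (Nat.cast_pos.1 hn')
    fun i hi => ?_).trans_lt ((div_lt_comm₀ hε hn').1 hn)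
  have hmem : ((i : ℝ) / n) ∈ Icc (0 : ℝ) 1 :=
    ⟨by positivity, (div_le_one hn').2 (Nat.cast_le.2 hi)⟩
  have hfloor : ∀ y ∈ Icc (0 : ℝ) 1, ⌊(n : ℝ) * y⌋₊ < n + 1 := fun y hy =>
    Nat.lt_succ_of_le (Nat.floor_le_of_le (mul_le_of_le_one_right hn'.le hy.2))
  have hh := (hφ h h.2).mapsTo hmem
  have hk := (hφ k k.2).mapsTo hmem
  have heq := congrArg Fin.val (congrFun hhk ⟨i, Nat.lt_succ_of_le hi⟩)
  simp only [Fin.val_ofNat, Nat.mod_eq_of_lt (hfloor _ hh), Nat.mod_eq_of_lt (hfloor _ hk)] at heq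
  have h1 := Nat.floor_le (mul_nonneg hn'.le hh.1)
  have h2 := Nat.lt_floor_add_one ((n : ℝ) * φ h (i / n))
  have k1 := Nat.floor_le (mul_nonneg hn'.le hk.1)
  have k2 := Nat.lt_floor_add_one ((n : ℝ) * φ k (i / n))
  rw [heq] at h1 h2
  rw [le_div_iff₀ hn', ← abs_of_pos hn', ← abs_mul, abs_of_pos hn', abs_le]
  constructor <;> linarith

/-- The inversion map on the classes of increasing bijections. -/
theorem exists_inversion : ∃ T : Lp ℝ 1 mu01 → Lp ℝ 1 mu01,
    MapsTo T SchechtmanK0 SchechtmanK0 ∧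
    ∀ h ∈ SchechtmanK0, ∀ f fi : ℝ → ℝ, IsIncBij f → ⇑h =ᵐ[mu01] f →
      InvOn fi f (Icc 0 1) (Icc 0 1) → ⇑(T h) =ᵐ[mu01] fi := by
  have hex : ∀ h ∈ SchechtmanK0, ∃ k ∈ SchechtmanK0, ∀ f fi : ℝ → ℝ, IsIncBij f →
      ⇑h =ᵐ[mu01] f → InvOn fi f (Icc 0 1) (Icc 0 1) → ⇑k =ᵐ[mu01] fi := by
    rintro h ⟨g, hg, hhg⟩
    have hgi := hg.bijOn.invOn_invFunOn
    refine ⟨_, (hg.inverse hgi).toLp_mem, fun f fi hf hhf hfi => ?_⟩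
    refine (hg.inverse hgi).memLp.coeFn_toLp.trans (ae_mem_Icc_mu01.mono fun y hy => ?_)
    have heq := hf.eqOn_of_ae_eq hg (hhf.symm.trans hhg)
    have hmem := hf.mapsTo_inverse hfi hy
    have := hgi.1 hmem
    rwa [← heq hmem, hfi.2 hy] at this
  choose! T hT using hex
  exact ⟨T, fun h hh => (hT h hh).1, fun h hh => (hT h hh).2⟩

/-- An isometry defined on a set extends to the closure of that set. -/
theorem exists_isometry_extension_closure {X Y : Type*} [MetricSpace X] [MetricSpace Y]
    [CompleteSpace Y] {A : Set X} {T₀ : X → Y}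
    (hT₀ : ∀ x ∈ A, ∀ y ∈ A, dist (T₀ x) (T₀ y) = dist x y) :
    ∃ T : X → Y, EqOn T T₀ A ∧ ∀ x ∈ closure A, ∀ y ∈ closure A, dist (T x) (T y) = dist x y := by
  have hlip : LipschitzOnWith 1 T₀ A :=
    LipschitzOnWith.of_dist_le_mul fun x hx y hy => by simp [hT₀ x hx y hy]
  have huc := hlip.uniformContinuousOn
  have hcont : ContinuousOn (extendFrom A T₀) (closure A) := by
    refine continuousOn_extendFrom Subset.rfl fun x hx => ?_
    have : (nhdsWithin x A).NeBot := mem_closure_iff_nhdsWithin_neBot.1 hx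
    have hc : Cauchy (nhdsWithin x A) := cauchy_nhds.mono inf_le_left
    refine CompleteSpace.complete (f := Filter.map T₀ (nhdsWithin x A)) ?_
    refine hc.map_of_le huc ?_
    exact inf_le_right
  have hext : EqOn (extendFrom A T₀) T₀ A := extendFrom_extends huc.continuousOn
  refine ⟨extendFrom A T₀, hext, fun x hx y hy => ?_⟩
  have heq : EqOn (fun p : X × X => dist (extendFrom A T₀ p.1) (extendFrom A T₀ p.2))
      (fun p => dist p.1 p.2) (closure A ×ˢ closure A) := by
    refine EqOn.of_subset_closure (s := A ×ˢ A) ?_ ?_ (by fun_prop)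
      (prod_mono subset_closure subset_closure) closure_prod_eq.superset
    · rintro ⟨a, b⟩ ⟨ha, hb⟩
      simp only [hext ha, hext hb, hT₀ a ha b hb]
    · exact continuous_dist.comp_continuousOn (.prodMk
        (hcont.comp continuousOn_fst mapsTo_fst_prod)
        (hcont.comp continuousOn_snd mapsTo_snd_prod))
  exact heq (mk_mem_prod hx hy)

theorem isIncBij_id : IsIncBij id :=
  ⟨continuousOn_id, strictMonoOn_id, image_id _⟩

theorem isIncBij_sq : IsIncBij (fun x => x ^ 2) :=
  .of_endpoints (by fun_prop) (fun x hx y _ hxy => pow_lt_pow_left₀ hxy hx.1 two_ne_zero)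
    (by simp) (by simp)

theorem invOn_sqrt_sq : InvOn Real.sqrt (fun x => x ^ 2) (Icc 0 1) (Icc 0 1) :=
  ⟨fun _ hx => Real.sqrt_sq hx.1, fun _ hx => Real.sq_sqrt hx.1⟩

/-- Inversion of increasing bijections does not commute with taking the midpoint of `x` and
`x ^ 2`. -/
theorem not_affine_of_inversion {T : Lp ℝ 1 mu01 → Lp ℝ 1 mu01}
    (hT : ∀ h ∈ SchechtmanK0, ∀ f fi : ℝ → ℝ, IsIncBij f → ⇑h =ᵐ[mu01] f →
      InvOn fi f (Icc 0 1) (Icc 0 1) → ⇑(T h) =ᵐ[mu01] fi) :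
    ¬ (∀ x ∈ SchechtmanK, ∀ y ∈ SchechtmanK, ∀ α ∈ Icc (0 : ℝ) 1,
      T (α • x + (1 - α) • y) = α • T x + (1 - α) • T y) := by
  intro h
  set x := isIncBij_id.memLp.toLp id
  set y := isIncBij_sq.memLp.toLp (fun x => x ^ 2)
  have hx : x =ᵐ[mu01] id := isIncBij_id.memLp.coeFn_toLp
  have hy : y =ᵐ[mu01] fun x => x ^ 2 := isIncBij_sq.memLp.coeFn_toLp
  have hx0 : x ∈ SchechtmanK0 := isIncBij_id.toLp_mem
  have hy0 : y ∈ SchechtmanK0 := isIncBij_sq.toLp_mem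
  have hTx := hT x hx0 id id isIncBij_id hx ⟨fun _ _ => rfl, fun _ _ => rfl⟩
  have hTy := hT y hy0 _ _ isIncBij_sq hy invOn_sqrt_sq
  have hα : (1 / 2 : ℝ) ∈ Icc (0 : ℝ) 1 := by constructor <;> norm_num
  have hα' : (0 : ℝ) ≤ 1 - 1 / 2 := by norm_num
  have hsum : (1 / 2 : ℝ) + (1 - 1 / 2) = 1 := by norm_num
  have hm := isIncBij_id.convexComb isIncBij_sq hα.1 hα' hsum
  have hmi := hm.bijOn.invOn_invFunOn
  have hTm := hT _ (convex_schechtmanK0 hx0 hy0 hα.1 hα' hsum) _ _ hm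
    ((Lp.coeFn_add _ _).trans (((Lp.coeFn_smul _ x).trans (hx.const_smul _)).add
      ((Lp.coeFn_smul _ y).trans (hy.const_smul _)))) hmi
  rw [h x (subset_closure hx0) y (subset_closure hy0) _ hα] at hTm
  have hTm' := (Lp.coeFn_add _ _).trans (((Lp.coeFn_smul (1 / 2 : ℝ) (T x)).trans
    (hTx.const_smul _)).add ((Lp.coeFn_smul (1 - 1 / 2 : ℝ) (T y)).trans (hTy.const_smul _)))
  have heq := (hm.inverse hmi).eqOn_of_ae_eq (isIncBij_id.convexComb
    (isIncBij_sq.inverse invOn_sqrt_sq) hα.1 hα' hsum) (hTm.symm.trans hTm')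
  have h38 := heq (hm.mapsTo hα)
  rw [hmi.1 hα] at h38
  simp only [Pi.add_apply, Pi.smul_apply, id, smul_eq_mul] at h38
  rw [show (1 / 2 * (1 / 2) + (1 - 1 / 2) * (1 / 2) ^ 2 : ℝ) = 3 / 8 by norm_num] at h38
  have hs : √(3 / 8 : ℝ) = 5 / 8 := by linarith
  have := Real.sq_sqrt (by norm_num : (0 : ℝ) ≤ 3 / 8)
  rw [hs] at this
  norm_num at this

/-- Schechtman's example: `K`, the `L¹[0,1]`-closure of the set `K₀` of continuous strictly
increasing bijections of `[0,1]`, is a compact convex subset of `L¹[0,1]`; the map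
`f ↦ f⁻¹` on `K₀` extends to a surjective isometry `T : K → K`, which is not affine.
In particular `K` does not have the strong Mankiewicz property. -/
theorem schechtman_example :
    IsCompact SchechtmanK ∧ Convex ℝ SchechtmanK ∧
    (∃ T : Lp ℝ 1 mu01 → Lp ℝ 1 mu01,
      (∀ x ∈ SchechtmanK, ∀ y ∈ SchechtmanK, dist (T x) (T y) = dist x y) ∧
      T '' SchechtmanK = SchechtmanK ∧
      (∀ h ∈ SchechtmanK0, ∀ f fi : ℝ → ℝ, IsIncBij f → ⇑h =ᵐ[mu01] f →
        Set.InvOn fi f (Icc 0 1) (Icc 0 1) → ⇑(T h) =ᵐ[mu01] fi) ∧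
      ¬ (∀ x ∈ SchechtmanK, ∀ y ∈ SchechtmanK, ∀ α ∈ Icc (0 : ℝ) 1,
          T (α • x + (1 - α) • y) = α • T x + (1 - α) • T y)) ∧
    ¬ StrongMankiewiczProp SchechtmanK := by
  have hconv : Convex ℝ SchechtmanK := convex_schechtmanK0.closure
  obtain ⟨T₀, hmaps₀, hT₀⟩ := exists_inversion
  have hiso₀ : ∀ x ∈ SchechtmanK0, ∀ y ∈ SchechtmanK0, dist (T₀ x) (T₀ y) = dist x y := by
    intro x hx y hy
    obtain ⟨f, hf, hxf⟩ := id hx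
    obtain ⟨g, hg, hyg⟩ := id hy
    have hfi := hf.bijOn.invOn_invFunOn
    have hgi := hg.bijOn.invOn_invFunOn
    exact dist_inverse hf hg hfi hgi hxf hyg (hT₀ x hx f _ hf hxf hfi) (hT₀ y hy g _ hg hyg hgi)
  have hinv₀ : ∀ x ∈ SchechtmanK0, T₀ (T₀ x) = x := by
    intro x hx
    obtain ⟨f, hf, hxf⟩ := id hx
    have hfi := hf.bijOn.invOn_invFunOn
    exact Lp.ext ((hT₀ _ (hmaps₀ hx) _ f (hf.inverse hfi) (hT₀ x hx f _ hf hxf hfi)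
      hfi.symm).trans hxf.symm)
  obtain ⟨T, hTT₀, hiso⟩ := exists_isometry_extension_closure hiso₀
  have hcont : ContinuousOn T SchechtmanK :=
    (LipschitzOnWith.of_dist_le_mul (K := 1) fun x hx y hy => by
      simp [hiso x hx y hy]).continuousOn
  have hmaps : MapsTo T SchechtmanK SchechtmanK :=
    (hmaps₀.congr hTT₀.symm).closure_of_continuousOn hcont
  have hinv : EqOn (T ∘ T) id SchechtmanK := by
    refine EqOn.of_subset_closure (s := SchechtmanK0) (fun x hx => ?_) (hcont.comp hcont hmaps)
      continuousOn_id subset_closure Subset.rfl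
    simp [hTT₀ hx, hTT₀ (hmaps₀ hx), hinv₀ x hx]
  have hsurj : T '' SchechtmanK = SchechtmanK :=
    Subset.antisymm hmaps.image_subset fun x hx => ⟨T x, hmaps hx, hinv hx⟩
  have hT : ∀ h ∈ SchechtmanK0, ∀ f fi : ℝ → ℝ, IsIncBij f → ⇑h =ᵐ[mu01] f →
      InvOn fi f (Icc 0 1) (Icc 0 1) → ⇑(T h) =ᵐ[mu01] fi := fun h hh => by
    rw [hTT₀ hh]
    exact hT₀ h hh
  have hna := not_affine_of_inversion hT
  refine ⟨?_, hconv, ⟨T, hiso, hsurj, hT, hna⟩, fun hSM => hna fun x hx y hy α hα => ?_⟩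
  · exact isCompact_iff_totallyBounded_isComplete.2
      ⟨totallyBounded_schechtmanK0.closure, isClosed_closure.isComplete⟩
  · have hup := hSM (ULift (Lp ℝ 1 mu01)) (ULift.up '' SchechtmanK)
      (hconv.is_linear_image ⟨fun _ _ => rfl, fun _ _ => rfl⟩) (fun z => ULift.up (T z)) hiso
      (by rw [← image_image, hsurj]) x hx y hy α hα
    exact congrArg ULift.down hup
end

section
/- Let X and Y be real normed spaces and T : S_X → S_Y a surjective isometry. Assume there are families (φ_i)_{i∈I} in the closed unit ball of the dual X* and (ψ_i)_{i∈I} in the closed unit ball of the dual Y* such that φ_i = ψ_i ∘ T on S_X for every i, and such that the family (φ_i) is norming for X, i.e., ‖x‖ = sup_i |φ_i(x)| for all x ∈ X. Then T extends to a real linear isometry from X onto Y. -/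
/-- Every vector of a real normed space is its norm times a unit vector, unless it is zero. -/
theorem exists_mem_sphere_norm_smul_eq {E : Type*} [NormedAddCommGroup E] [NormedSpace ℝ E]
    {x : E} (hx : x ≠ 0) : ∃ u ∈ Metric.sphere (0 : E) 1, ‖x‖ • u = x :=
  ⟨‖x‖⁻¹ • x, by simp [norm_smul, hx], smul_inv_smul₀ (norm_ne_zero_iff.mpr hx) x⟩

/-- Let `T : S_X → S_Y` be a surjective isometry between the unit spheres of real normed
spaces. If there are families `(φ i)` in the closed unit ball of `X*` and `(ψ i)` in the
closed unit ball of `Y*` with `φ i = ψ i ∘ T` on the sphere, and `(φ i)` is norming for `X`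
(i.e. `‖x‖ = sup_i |φ i x|`), then `T` extends to a surjective real linear isometry. -/
theorem exists_linearIsometry_extension_of_norming
    (X : Type*) [NormedAddCommGroup X] [NormedSpace ℝ X]
    (Y : Type*) [NormedAddCommGroup Y] [NormedSpace ℝ Y]
    (T : X → Y)
    (hiso : ∀ x ∈ Metric.sphere (0 : X) 1, ∀ y ∈ Metric.sphere (0 : X) 1,
      dist (T x) (T y) = dist x y)
    (hsurj : T '' Metric.sphere (0 : X) 1 = Metric.sphere (0 : Y) 1)
    (I : Type*) (φ : I → (X →L[ℝ] ℝ)) (ψ : I → (Y →L[ℝ] ℝ))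
    (hφ : ∀ i, ‖φ i‖ ≤ 1) (hψ : ∀ i, ‖ψ i‖ ≤ 1)
    (hcomp : ∀ i, ∀ x ∈ Metric.sphere (0 : X) 1, φ i x = ψ i (T x))
    (hnorming : ∀ x : X, IsLUB (Set.range fun i => |φ i x|) ‖x‖) :
    ∃ g : X →ₗᵢ[ℝ] Y, Function.Surjective g ∧ ∀ x ∈ Metric.sphere (0 : X) 1, g x = T x := by
  have hT : ∀ x ∈ Metric.sphere (0 : X) 1, ‖T x‖ = 1 := fun x hx =>
    mem_sphere_zero_iff_norm.mp (hsurj ▸ Set.mem_image_of_mem T hx)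
  -- The families correspond under the homogeneous extension of `T`, in both directions.
  have forward : ∀ x : X, ∃ y : Y, ‖y‖ = ‖x‖ ∧ ∀ i, ψ i y = φ i x := by
    intro x
    obtain rfl | hx := eq_or_ne x 0
    · exact ⟨0, by simp⟩
    · obtain ⟨u, hu, hux⟩ := exists_mem_sphere_norm_smul_eq hx
      refine ⟨‖x‖ • T u, by simp [norm_smul, hT u hu], fun i => ?_⟩
      rw [map_smul, ← hcomp i u hu, ← map_smul, hux]
  have backward : ∀ y : Y, ∃ x : X, ‖x‖ = ‖y‖ ∧ ∀ i, φ i x = ψ i y := by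
    intro y
    obtain rfl | hy := eq_or_ne y 0
    · exact ⟨0, by simp⟩
    · obtain ⟨v, hv, hvy⟩ := exists_mem_sphere_norm_smul_eq hy
      obtain ⟨u, hu, rfl⟩ := hsurj.symm ▸ hv
      refine ⟨‖y‖ • u, by simp [norm_smul, mem_sphere_zero_iff_norm.mp hu], fun i => ?_⟩
      rw [map_smul, hcomp i u hu, ← map_smul, hvy]
  -- Hence `ψ` is norming for `Y`, and in particular separates points.
  have separating : ∀ y z : Y, (∀ i, ψ i y = ψ i z) → y = z := by
    intro y z h
    obtain ⟨x, hx, hφx⟩ := backward (y - z)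
    have hle : ‖x‖ ≤ 0 := (hnorming x).2 <| by
      rintro _ ⟨i, rfl⟩
      simp [hφx, h]
    exact sub_eq_zero.mp (norm_le_zero_iff.mp (hx ▸ hle))
  choose g hgnorm hgψ using forward
  refine ⟨{ toFun := g, map_add' := ?_, map_smul' := ?_, norm_map' := hgnorm }, ?_, ?_⟩
  · exact fun x y => separating _ _ fun i => by simp [hgψ]
  · exact fun c x => separating _ _ fun i => by simp [hgψ]
  · intro y
    obtain ⟨x, -, hx⟩ := backward y
    exact ⟨x, separating _ _ fun i => (hgψ x i).trans (hx i)⟩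
  · exact fun x hx => separating _ _ fun i => (hgψ x i).trans (hcomp i x hx)
end

section
/- Let A be a complex C*-algebra and φ a norm-one bounded linear functional on A (either complex linear, or real linear when A is regarded as a real Banach space). If a ∈ A with ‖a‖ ≤ 1 satisfies φ(a) = 1, then φ(x) = φ(a a* x a* a) for all x ∈ A. -/
section

attribute [local instance] CStarAlgebra.spectralOrder CStarAlgebra.spectralOrderedRing

variable {A : Type*} [CStarAlgebra A]

/-- Perturbing a contraction `a` by `t • (1 - a * star a) * x` changes the squared norm only to
second order in `t`. -/
lemma exists_norm_sq_add_smul_le [Nontrivial A] {a : A} (ha : ‖a‖ ≤ 1) (x : A) :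
    ∃ C : ℝ, 0 ≤ C ∧ ∀ t : ℝ, ‖a + t • ((1 - a * star a) * x)‖ ^ 2 ≤ 1 + C * t ^ 2 := by
  set q : A := 1 - a * star a with hq
  have hq0 : 0 ≤ q := by
    rw [hq, sub_nonneg, ← CStarAlgebra.norm_le_one_iff_of_nonneg _ (mul_star_self_nonneg a),
      CStarRing.norm_self_mul_star]
    exact mul_le_one₀ ha (norm_nonneg a) ha
  have hqs : star q = q := (IsSelfAdjoint.of_nonneg hq0).star_eq
  set y : A := x * star a with hy
  set z : A := star y * q * y + (q * x) * star (q * x) with hz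
  refine ⟨‖z‖, norm_nonneg z, fun t ↦ ?_⟩
  have hconj : 0 ≤ star (1 - t • y) * q * (1 - t • y) := star_left_conjugate_nonneg hq0 _
  have hid : (a + t • (q * x)) * star (a + t • (q * x)) =
      1 + (t ^ 2) • z - star (1 - t • y) * q * (1 - t • y) := by
    have h1 : a * star a = 1 - q := by rw [hq]; abel
    have h2 : q * x * star a = q * y := by rw [hy, mul_assoc]
    have h3 : a * (star x * q) = star y * q := by rw [hy]; simp [mul_assoc]
    have h4 : star (q * x) = star x * q := by rw [star_mul, hqs]
    simp only [hz, h4, star_add, star_sub, star_smul, star_trivial, star_one, mul_add, add_mul,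
      mul_sub, sub_mul, smul_mul_assoc, mul_smul_comm, one_mul, mul_one, h1, h2, h3, smul_add,
      smul_sub, smul_smul, pow_two]
    abel
  have hle : (a + t • (q * x)) * star (a + t • (q * x)) ≤ 1 + (t ^ 2) • z := by
    rw [hid]
    exact sub_le_self _ hconj
  calc ‖a + t • (q * x)‖ ^ 2 = ‖(a + t • (q * x)) * star (a + t • (q * x))‖ := by
        rw [CStarRing.norm_self_mul_star, pow_two]
    _ ≤ ‖1 + (t ^ 2) • z‖ :=
        CStarAlgebra.norm_le_norm_of_nonneg_of_le (mul_star_self_nonneg _) hle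
    _ ≤ ‖(1 : A)‖ + ‖(t ^ 2) • z‖ := norm_add_le _ _
    _ = 1 + ‖z‖ * t ^ 2 := by
        rw [CStarRing.norm_one, norm_smul, Real.norm_of_nonneg (sq_nonneg t), mul_comm]

end

section

variable {A : Type*} [CStarAlgebra A] {a : A} {φ : A →ₗ[ℝ] ℝ}

lemma map_one_sub_mul_star_mul_nonpos (ha : ‖a‖ ≤ 1) (hφ : ∀ y, φ y ≤ ‖y‖) (hφa : φ a = 1)
    (x : A) : φ ((1 - a * star a) * x) ≤ 0 := by
  have : Nontrivial A := ⟨a, 0, by rintro rfl; simp at hφa⟩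
  obtain ⟨C, hC, h⟩ := exists_norm_sq_add_smul_le ha x
  by_contra! hs
  set s := φ ((1 - a * star a) * x) with hs_def
  set t := s / (C + 1) with ht_def
  have ht : 0 < t := by positivity
  have hts : t * (C + 1) = s := by rw [ht_def]; field_simp
  have hlow : 1 + t * s ≤ ‖a + t • ((1 - a * star a) * x)‖ := by
    simpa [hφa, ← hs_def] using hφ (a + t • ((1 - a * star a) * x))
  have hsq : (1 + t * s) ^ 2 ≤ 1 + C * t ^ 2 :=
    (pow_le_pow_left₀ (by positivity) hlow 2).trans (h t)
  rw [← hts] at hsq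
  have : 0 < t ^ 2 := by positivity
  nlinarith [sq_nonneg (t * (t * (C + 1))), mul_nonneg hC this.le]

lemma map_mul_star_mul_eq (ha : ‖a‖ ≤ 1) (hφ : ∀ y, φ y ≤ ‖y‖) (hφa : φ a = 1) (x : A) :
    φ (a * star a * x) = φ x := by
  have h1 := map_one_sub_mul_star_mul_nonpos ha hφ hφa x
  have h2 := map_one_sub_mul_star_mul_nonpos ha hφ hφa (-x)
  simp only [sub_mul, one_mul, mul_neg, map_sub, map_neg] at h1 h2
  linarith

lemma map_mul_star_mul_self_eq (ha : ‖a‖ ≤ 1) (hφ : ∀ y, φ y ≤ ‖y‖) (hφa : φ a = 1) (x : A) :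
    φ (x * (star a * a)) = φ x := by
  have h := map_mul_star_mul_eq (a := star a)
    (φ := φ ∘ₗ (starLinearEquiv ℝ : A ≃ₗ⋆[ℝ] A).toLinearMap) (by rwa [norm_star])
    (fun y ↦ by simpa using hφ (star y)) (by simpa using hφa) (star x)
  simpa [mul_assoc] using h

lemma map_mul_star_mul_mul_star_mul_eq (ha : ‖a‖ ≤ 1) (hφ : ∀ y, φ y ≤ ‖y‖) (hφa : φ a = 1)
    (x : A) : φ (a * star a * x * (star a * a)) = φ x := by
  rw [map_mul_star_mul_self_eq ha hφ hφa, map_mul_star_mul_eq ha hφ hφa]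

end

/-- Let `A` be a complex C*-algebra and `φ` a norm-one bounded linear functional on `A`
(complex linear, or real linear when `A` is regarded as a real Banach space).
If `a ∈ A` with `‖a‖ ≤ 1` satisfies `φ a = 1`, then `φ x = φ (a a* x a* a)` for all `x`. -/
theorem functional_eq_of_norm_one_attained
    (A : Type*) [CStarAlgebra A] (a : A) (ha : ‖a‖ ≤ 1) :
    (∀ φ : A →L[ℂ] ℂ, ‖φ‖ = 1 → φ a = 1 →
      ∀ x : A, φ x = φ (a * star a * x * (star a * a))) ∧
    (∀ φ : A →L[ℝ] ℝ, ‖φ‖ = 1 → φ a = 1 →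
      ∀ x : A, φ x = φ (a * star a * x * (star a * a))) := by
  refine ⟨fun φ hφ hφa x ↦ ?_, fun φ hφ hφa x ↦ ?_⟩
  · have hre : ∀ y, (φ (a * star a * y * (star a * a))).re = (φ y).re := fun y ↦
      map_mul_star_mul_mul_star_mul_eq (φ := Complex.reLm ∘ₗ (φ : A →ₗ[ℂ] ℂ).restrictScalars ℝ)
        ha (fun z ↦ (Complex.re_le_norm (φ z)).trans (by simpa [hφ] using φ.le_opNorm z))
        (by simp [hφa]) y
    refine Complex.ext (hre x).symm ?_
    have him := hre (Complex.I • x)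
    simp only [mul_smul_comm, smul_mul_assoc, map_smul, smul_eq_mul, Complex.I_mul_re] at him
    linarith
  · exact (map_mul_star_mul_mul_star_mul_eq (φ := (φ : A →ₗ[ℝ] ℝ)) ha
      (fun z ↦ (le_abs_self (φ z)).trans (by simpa [hφ] using φ.le_opNorm z)) hφa x).symm
end

section
/- Let X and Y be real normed spaces, T : S_X → S_Y a surjective isometry, and F ⊂ S_X an intersection face. Then T(F) is an intersection face of S_Y satisfying T(−F) = −T(F). In particular, there exists ψ in the closed unit ball of the dual Y* such that ψ(y) = 1 for all y ∈ T(F). -/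
open Pointwise

variable {X : Type*} [NormedAddCommGroup X] [NormedSpace ℝ X]

/-- A *face* of the closed unit ball `B_X`: a nonempty convex subset `F ⊆ B_X` such that
whenever a point of an open segment contained in `B_X` lies in `F`, the whole segment
lies in `F`. -/
def IsFace (F : Set X) : Prop :=
  F.Nonempty ∧ Convex ℝ F ∧ IsExtreme ℝ (Metric.closedBall (0 : X) 1) F

/-- A *maximal face* of the unit sphere `S_X`: a face of `B_X` contained in `S_X` that is
maximal among proper faces of `B_X`. -/
def IsMaximalFace (F : Set X) : Prop :=
  IsFace F ∧ F ⊆ Metric.sphere (0 : X) 1 ∧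
    ∀ G : Set X, IsFace G → G ≠ Metric.closedBall (0 : X) 1 → F ⊆ G → F = G

/-- An *intersection face*: a closed face `F ⊆ S_X` which is the intersection of all
maximal faces of `S_X` containing it. -/
def IsIntersectionFace (F : Set X) : Prop :=
  IsClosed F ∧ IsFace F ∧ F ⊆ Metric.sphere (0 : X) 1 ∧
    F = ⋂₀ {E : Set X | IsMaximalFace E ∧ F ⊆ E}

section SphereIsometry

variable {V W : Type*} [NormedAddCommGroup V] [NormedAddCommGroup W]

/-- `T` restricts to a surjective isometry between the unit spheres. -/
structure IsSphereIsometry (T : V → W) : Prop where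
  dist_eq : ∀ x ∈ Metric.sphere (0 : V) 1, ∀ y ∈ Metric.sphere (0 : V) 1,
    dist (T x) (T y) = dist x y
  image_sphere : T '' Metric.sphere (0 : V) 1 = Metric.sphere (0 : W) 1

namespace IsSphereIsometry

variable {T : V → W}

lemma norm_eq_one (hT : IsSphereIsometry T) {x : V} (hx : ‖x‖ = 1) : ‖T x‖ = 1 := by
  rw [← mem_sphere_zero_iff_norm, ← hT.image_sphere]
  exact Set.mem_image_of_mem T (by simpa using hx)

lemma exists_eq (hT : IsSphereIsometry T) {y : W} (hy : ‖y‖ = 1) : ∃ x, ‖x‖ = 1 ∧ T x = y := by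
  rw [← mem_sphere_zero_iff_norm, ← hT.image_sphere] at hy
  simpa using hy

lemma injOn (hT : IsSphereIsometry T) : Set.InjOn T (Metric.sphere 0 1) := fun x hx y hy h ↦ by
  rw [← dist_eq_zero, ← hT.dist_eq x hx y hy, h, dist_self]

lemma norm_sub (hT : IsSphereIsometry T) {x y : V} (hx : ‖x‖ = 1) (hy : ‖y‖ = 1) :
    ‖T x - T (-y)‖ = ‖x + y‖ := by
  rw [← dist_eq_norm, hT.dist_eq x (by simpa using hx) (-y) (by simpa using hy), dist_eq_norm,
    sub_neg_eq_add]

/-- The antipodal conjugate of a sphere isometry is a sphere isometry. -/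
lemma antipodal (hT : IsSphereIsometry T) : IsSphereIsometry fun x ↦ -T (-x) where
  dist_eq x hx y hy := by
    rw [dist_neg_neg, hT.dist_eq _ (by simpa using hx) _ (by simpa using hy), dist_neg_neg]
  image_sphere := by
    ext y
    rw [mem_sphere_zero_iff_norm]
    constructor
    · rintro ⟨x, hx, rfl⟩
      simpa using hT.norm_eq_one (x := -x) (by simpa using hx)
    · intro hy
      obtain ⟨x, hx, hxy⟩ := hT.exists_eq (y := -y) (by simpa using hy)
      exact ⟨-x, by simpa using hx, by simp [hxy]⟩

lemma norm_antipodal_add (hT : IsSphereIsometry T) {x y : V} (hx : ‖x‖ = 1) (hy : ‖y‖ = 1) :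
    ‖-T (-x) + T y‖ = ‖x + y‖ := by
  rw [neg_add_eq_sub, hT.norm_sub hy hx, add_comm]

lemma image_subset_sphere (hT : IsSphereIsometry T) {C : Set V} (hC : C ⊆ Metric.sphere 0 1) :
    T '' C ⊆ Metric.sphere 0 1 := hT.image_sphere ▸ Set.image_mono hC

end IsSphereIsometry

variable [NormedSpace ℝ V]

lemma apply_le_norm_of_opNorm_le_one {g : V →L[ℝ] ℝ} (hg : ‖g‖ ≤ 1) (v : V) : g v ≤ ‖v‖ :=
  (le_abs_self _).trans (by simpa using g.le_of_opNorm_le hg v)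

lemma norm_add_eq_two_of_apply_eq_one {g : V →L[ℝ] ℝ} (hg : ‖g‖ ≤ 1) {a b : V}
    (ha : ‖a‖ ≤ 1) (hb : ‖b‖ ≤ 1) (hga : g a = 1) (hgb : g b = 1) : ‖a + b‖ = 2 := by
  have h₁ := apply_le_norm_of_opNorm_le_one hg (a + b)
  have h₂ := norm_add_le a b
  rw [map_add] at h₁
  linarith

lemma exists_apply_eq_one_of_norm_add_eq_two {a b : V} (ha : ‖a‖ = 1) (hb : ‖b‖ = 1)
    (hab : ‖a + b‖ = 2) : ∃ g : V →L[ℝ] ℝ, ‖g‖ ≤ 1 ∧ g a = 1 ∧ g b = 1 := by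
  obtain ⟨g, hg, hgab⟩ := exists_dual_vector'' ℝ (a + b)
  have h₁ := apply_le_norm_of_opNorm_le_one hg a
  have h₂ := apply_le_norm_of_opNorm_le_one hg b
  simp only [map_add, hab, RCLike.ofReal_real_eq_id, id_eq] at hgab
  exact ⟨g, hg, by linarith, by linarith⟩

/-- If every unit vector forming a flat segment with `p` also does so with `a` and with `b`,
then `a`, `b` and any `c` forming a flat segment with `p` lie on a common supporting
hyperplane of the unit ball. -/
lemma exists_common_support {p a b c : V} (hp : ‖p‖ = 1) (ha : ‖a‖ = 1) (hb : ‖b‖ = 1)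
    (hc : ‖c‖ = 1) (hpa : ∀ w : V, ‖w‖ = 1 → ‖w + p‖ = 2 → ‖w + a‖ = 2)
    (hpb : ∀ w : V, ‖w‖ = 1 → ‖w + p‖ = 2 → ‖w + b‖ = 2) (hpc : ‖c + p‖ = 2) :
    ∃ g : V →L[ℝ] ℝ, ‖g‖ ≤ 1 ∧ g a = 1 ∧ g b = 1 ∧ g c = 1 := by
  have norm_one {g : V →L[ℝ] ℝ} (hg : ‖g‖ ≤ 1) {v : V} (hv : ‖v‖ ≤ 1) (hgv : g v = 1) :
      ‖v‖ = 1 := le_antisymm hv (hgv ▸ apply_le_norm_of_opNorm_le_one hg v)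
  obtain ⟨g, hg, hgc, hgp⟩ := exists_apply_eq_one_of_norm_add_eq_two hc hp hpc
  set n : V := (1 / 2 : ℝ) • (c + p) with hn
  have hgn : g n = 1 := by simp [hn, hgc, hgp]; norm_num
  have hn1 : ‖n‖ = 1 := by
    rw [hn, norm_smul, hpc]; norm_num
  obtain ⟨k, hk, hkn, hka⟩ := exists_apply_eq_one_of_norm_add_eq_two hn1 ha
    (hpa n hn1 (norm_add_eq_two_of_apply_eq_one hg hn1.le hp.le hgn hgp))
  have hkc := apply_le_norm_of_opNorm_le_one hk c
  have hkp := apply_le_norm_of_opNorm_le_one hk p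
  simp only [hn, map_smul, map_add, smul_eq_mul] at hkn
  set m : V := (1 / 2 : ℝ) • (a + n) with hm
  have hkm : k m = 1 := by
    simp only [hm, hn, map_smul, map_add, smul_eq_mul]; linarith
  have hm1 : ‖m‖ = 1 := by
    refine norm_one hk ?_ hkm
    have := norm_add_le a n
    rw [hm, norm_smul, Real.norm_of_nonneg (by norm_num)]
    linarith
  obtain ⟨l, hl, hlm, hlb⟩ := exists_apply_eq_one_of_norm_add_eq_two hm1 hb
    (hpb m hm1 (norm_add_eq_two_of_apply_eq_one hk hm1.le hp.le hkm (by linarith)))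
  have hla := apply_le_norm_of_opNorm_le_one hl a
  have hlc := apply_le_norm_of_opNorm_le_one hl c
  have hlp := apply_le_norm_of_opNorm_le_one hl p
  simp only [hm, hn, map_smul, map_add, smul_eq_mul] at hlm
  exact ⟨l, hl, by linarith, hlb, by linarith⟩

lemma Convex.norm_add_eq_two {C : Set V} (hC : Convex ℝ C) (hS : C ⊆ Metric.sphere 0 1)
    {x y : V} (hx : x ∈ C) (hy : y ∈ C) : ‖x + y‖ = 2 := by
  have h := hS (hC hx hy (by norm_num : (0 : ℝ) ≤ 1 / 2) (by norm_num : (0 : ℝ) ≤ 1 / 2)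
    (by norm_num))
  rw [mem_sphere_zero_iff_norm, ← smul_add, norm_smul, Real.norm_of_nonneg (by norm_num)] at h
  linarith

/-- A convex subset of the unit sphere lies on a supporting hyperplane of the unit ball. -/
lemma Convex.exists_support {K : Set V} (hK : Convex ℝ K) (hS : K ⊆ Metric.sphere 0 1) :
    ∃ g : V →L[ℝ] ℝ, ‖g‖ ≤ 1 ∧ ∀ k ∈ K, g k = 1 := by
  obtain ⟨f, u, hf, hu⟩ := geometric_hahn_banach_open (convex_ball (0 : V) 1)
    Metric.isOpen_ball hK (Set.disjoint_left.2 fun v hv hvK ↦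
      (Metric.sphere_disjoint_ball.le_bot ⟨hS hvK, hv⟩).elim)
  have hu0 : 0 < u := by simpa using hf 0 (by simp)
  have hfu : ‖f‖ ≤ u := by
    refine f.opNorm_le_of_unit_norm hu0.le fun v hv ↦ ?_
    have key (w : V) (hw : ‖w‖ = 1) : f w ≤ u := by
      have hcl : closure (Metric.ball (0 : V) 1) ⊆ {w | f w ≤ u} :=
        closure_minimal (fun w hw ↦ (hf w hw).le) (isClosed_le f.continuous continuous_const)
      rw [closure_ball 0 one_ne_zero] at hcl
      exact hcl (by simpa using hw.le)
    rw [Real.norm_eq_abs, abs_le]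
    have h₁ := key v hv
    have h₂ := key (-v) (by simpa using hv)
    rw [map_neg] at h₂
    exact ⟨by linarith, h₁⟩
  have hg : ‖u⁻¹ • f‖ ≤ 1 := by
    rw [norm_smul, Real.norm_of_nonneg (by positivity), inv_mul_le_iff₀ hu0]
    simpa using hfu
  refine ⟨u⁻¹ • f, hg, fun k hk ↦ le_antisymm ?_ ?_⟩
  · simpa [mem_sphere_zero_iff_norm.1 (hS hk)] using apply_le_norm_of_opNorm_le_one hg k
  · simpa [← div_eq_inv_mul, one_le_div hu0] using hu k hk

/-- A nonempty convex subset of the unit sphere containing every unit vector that forms a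
flat segment with each of its points. -/
structure IsSaturatedConvex (C : Set V) : Prop where
  nonempty : C.Nonempty
  convex : Convex ℝ C
  subset_sphere : C ⊆ Metric.sphere 0 1
  mem_of_forall : ∀ x : V, ‖x‖ = 1 → (∀ y ∈ C, ‖x + y‖ = 2) → x ∈ C

lemma IsSaturatedConvex.norm_eq_one {C : Set V} (hC : IsSaturatedConvex C) {x : V}
    (hx : x ∈ C) : ‖x‖ = 1 := mem_sphere_zero_iff_norm.1 (hC.subset_sphere hx)

lemma IsSaturatedConvex.norm_add {C : Set V} (hC : IsSaturatedConvex C) {x y : V}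
    (hx : x ∈ C) (hy : y ∈ C) : ‖x + y‖ = 2 :=
  hC.convex.norm_add_eq_two hC.subset_sphere hx hy

lemma IsSaturatedConvex.isClosed {C : Set V} (hC : IsSaturatedConvex C) : IsClosed C := by
  have h : C = {x | ‖x‖ = 1} ∩ ⋂ y ∈ C, {x | ‖x + y‖ = 2} := by
    ext x
    simp only [Set.mem_inter_iff, Set.mem_ofPred_eq, Set.mem_iInter]
    exact ⟨fun hx ↦ ⟨hC.norm_eq_one hx, fun y hy ↦ hC.norm_add hx hy⟩,
      fun hx ↦ hC.mem_of_forall x hx.1 hx.2⟩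
  rw [h]
  exact (isClosed_eq continuous_norm continuous_const).inter
    (isClosed_biInter fun y _ ↦ isClosed_eq (by fun_prop) continuous_const)

lemma isFace_of_support {g : V →L[ℝ] ℝ} (hg : ‖g‖ ≤ 1)
    (hne : {v : V | ‖v‖ ≤ 1 ∧ g v = 1}.Nonempty) : IsFace {v : V | ‖v‖ ≤ 1 ∧ g v = 1} := by
  refine ⟨hne, ?_, fun v hv ↦ by simpa using hv.1, ?_⟩
  · have h := (convex_closedBall (0 : V) 1).inter (convex_hyperplane g.isLinear 1)
    convert h using 1
    ext v
    simp
  · rintro x hx y hy z ⟨-, hz⟩ ⟨s, t, hs, ht, hst, rfl⟩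
    rw [mem_closedBall_zero_iff] at hx hy
    have h₁ := apply_le_norm_of_opNorm_le_one hg x
    have h₂ := apply_le_norm_of_opNorm_le_one hg y
    simp only [map_add, map_smul, smul_eq_mul] at hz
    exact ⟨hx, by nlinarith⟩

lemma IsMaximalFace.isSaturatedConvex {C : Set V} (hC : IsMaximalFace C) :
    IsSaturatedConvex C where
  nonempty := hC.1.1
  convex := hC.1.2.1
  subset_sphere := hC.2.1
  mem_of_forall x hx h := by
    have hK : convexHull ℝ (insert x C) ⊆ Metric.sphere 0 1 := by
      rw [convexHull_insert hC.1.1, hC.1.2.1.convexHull_eq]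
      intro v hv
      obtain ⟨y, hy, hv⟩ := by simpa [mem_convexJoin] using hv
      have hy1 : ‖y‖ = 1 := mem_sphere_zero_iff_norm.1 (hC.2.1 hy)
      obtain ⟨g, hg, hgx, hgy⟩ := exists_apply_eq_one_of_norm_add_eq_two hx hy1 (h y hy)
      obtain ⟨s, t, hs, ht, hst, rfl⟩ := hv
      rw [mem_sphere_zero_iff_norm]
      refine le_antisymm ?_ ?_
      · refine (norm_add_le _ _).trans ?_
        rw [norm_smul, norm_smul, hx, hy1, Real.norm_of_nonneg hs, Real.norm_of_nonneg ht]
        linarith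
      · have := apply_le_norm_of_opNorm_le_one hg (s • x + t • y)
        simpa [hgx, hgy, hst] using this
    obtain ⟨g, hg, hgK⟩ := (convex_convexHull ℝ _).exists_support hK
    have hsub : insert x C ⊆ {v : V | ‖v‖ ≤ 1 ∧ g v = 1} := fun v hv ↦
      ⟨(mem_sphere_zero_iff_norm.1 (hK (subset_convexHull ℝ _ hv))).le,
        hgK v (subset_convexHull ℝ _ hv)⟩
    have hface := isFace_of_support hg ⟨x, hsub (Set.mem_insert x C)⟩
    rw [hC.2.2 _ hface (fun heq ↦ ?_) ((Set.subset_insert x C).trans hsub)]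
    · exact hsub (Set.mem_insert x C)
    · have h0 : (0 : V) ∈ {v : V | ‖v‖ ≤ 1 ∧ g v = 1} := heq ▸ by simp
      simpa using h0.2

lemma IsFace.subset_sphere {G : Set V} (hG : IsFace G) (hne : G ≠ Metric.closedBall 0 1) :
    G ⊆ Metric.sphere 0 1 := by
  intro v hv
  by_contra hvs
  have hv1 : ‖v‖ ≤ 1 := by simpa using hG.2.2.1 hv
  have hv1 : ‖v‖ < 1 := lt_of_le_of_ne hv1 (by simpa using hvs)
  refine hne (hG.2.2.1.antisymm fun w hw ↦ ?_)
  have hw1 : ‖w‖ ≤ 1 := by simpa using hw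
  set d : ℝ := (1 - ‖v‖) / 2 with hd
  have hd0 : 0 < d := by rw [hd]; linarith
  have hw' : v + d • (v - w) ∈ Metric.closedBall (0 : V) 1 := by
    rw [mem_closedBall_zero_iff]
    refine (norm_add_le _ _).trans ?_
    rw [norm_smul, Real.norm_of_nonneg hd0.le]
    have := norm_sub_le v w
    nlinarith
  refine hG.2.2.2 hw hw' hv ⟨d / (1 + d), 1 / (1 + d), by positivity, by positivity,
    by field_simp; ring, ?_⟩
  have h1 : d / (1 + d) = 1 - 1 / (1 + d) := by field_simp; ring
  have h2 : (1 / (1 + d)) * d = 1 - 1 / (1 + d) := by field_simp; ring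
  rw [smul_add, smul_smul, h2, h1]
  module

lemma IsSaturatedConvex.isMaximalFace {C : Set V} (hC : IsSaturatedConvex C) :
    IsMaximalFace C := by
  refine ⟨⟨hC.nonempty, hC.convex, hC.subset_sphere.trans Metric.sphere_subset_closedBall,
    ?_⟩, hC.subset_sphere, fun G hG hne hCG ↦ hCG.antisymm fun x hx ↦ ?_⟩
  · intro x hx y hy z hz hzxy
    obtain ⟨s, t, hs, ht, hst, rfl⟩ := hzxy
    rw [mem_closedBall_zero_iff] at hx hy
    have key (w : V) (hw : w ∈ C) : ∃ g : V →L[ℝ] ℝ, ‖g‖ ≤ 1 ∧ g x = 1 ∧ g w = 1 := by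
      obtain ⟨g, hg, hgz, hgw⟩ := exists_apply_eq_one_of_norm_add_eq_two
        (hC.norm_eq_one hz) (hC.norm_eq_one hw) (hC.norm_add hz hw)
      have h₁ := apply_le_norm_of_opNorm_le_one hg x
      have h₂ := apply_le_norm_of_opNorm_le_one hg y
      simp only [map_add, map_smul, smul_eq_mul] at hgz
      exact ⟨g, hg, by nlinarith, hgw⟩
    refine hC.mem_of_forall x ?_ fun w hw ↦ ?_
    · obtain ⟨g, hg, hgx, -⟩ := key _ hz
      exact le_antisymm hx (hgx ▸ apply_le_norm_of_opNorm_le_one hg x)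
    · obtain ⟨g, hg, hgx, hgw⟩ := key w hw
      exact norm_add_eq_two_of_apply_eq_one hg hx (hC.norm_eq_one hw).le hgx hgw
  · have hGS := hG.subset_sphere hne
    exact hC.mem_of_forall x (mem_sphere_zero_iff_norm.1 (hGS hx)) fun y hy ↦
      hG.2.1.norm_add_eq_two hGS hx (hCG hy)

lemma IsIntersectionFace.exists_isMaximalFace {F : Set V} (hF : IsIntersectionFace F) :
    ∃ E, IsMaximalFace E ∧ F ⊆ E := by
  by_contra! h
  have h0 : (0 : V) ∈ F := by
    rw [hF.2.2.2]
    exact fun E hE ↦ (h E hE.1 hE.2).elim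
  simpa using hF.2.2.1 h0

lemma IsIntersectionFace.mem_of_forall {F : Set V} (hF : IsIntersectionFace F) {x : V}
    (h : ∀ E, IsMaximalFace E → F ⊆ E → x ∈ E) : x ∈ F := by
  rw [hF.2.2.2]
  exact fun E hE ↦ h E hE.1 hE.2

/-- A sphere isometry sends an intersection face to the intersection of the images of the
maximal faces containing it. -/
lemma IsSphereIsometry.mem_image_intersectionFace {T : V → W} (hT : IsSphereIsometry T)
    {F : Set V} (hF : IsIntersectionFace F) {y : W}
    (h : ∀ E, IsMaximalFace E → F ⊆ E → y ∈ T '' E) : y ∈ T '' F := by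
  obtain ⟨E, hE, hFE⟩ := hF.exists_isMaximalFace
  obtain ⟨x, hx, rfl⟩ := h E hE hFE
  refine ⟨x, hF.mem_of_forall fun G hG hFG ↦ ?_, rfl⟩
  obtain ⟨z, hz, hzx⟩ := h G hG hFG
  rwa [← hT.injOn (hG.2.1 hz) (hE.2.1 hx) hzx]

namespace IsSphereIsometry

variable {T : V → W}

/-- The image of a saturated convex set consists of the unit vectors forming a flat segment
with the antipodal image of each of its points. -/
lemma mem_image_of_forall (hT : IsSphereIsometry T) {C : Set V} (hC : IsSaturatedConvex C)
    {v : W} (hv : ‖v‖ = 1) (h : ∀ z ∈ C, ‖-T (-z) + v‖ = 2) : v ∈ T '' C := by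
  obtain ⟨x, hx, rfl⟩ := hT.exists_eq hv
  refine ⟨x, hC.mem_of_forall x hx fun y hy ↦ ?_, rfl⟩
  rw [add_comm, ← hT.norm_antipodal_add (hC.norm_eq_one hy) hx, h y hy]

variable [NormedSpace ℝ W]

lemma convex_image (hT : IsSphereIsometry T) {C : Set V} (hC : IsSaturatedConvex C) :
    Convex ℝ (T '' C) := by
  rintro _ ⟨x, hx, rfl⟩ _ ⟨y, hy, rfl⟩ s t hs ht hst
  have hx1 := hC.norm_eq_one hx
  have hy1 := hC.norm_eq_one hy
  have hu : (1 / 2 : ℝ) • x + (1 / 2 : ℝ) • y ∈ C :=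
    hC.convex hx hy (by norm_num) (by norm_num) (by norm_num)
  set u : V := (1 / 2 : ℝ) • x + (1 / 2 : ℝ) • y with hudef
  have hu1 := hC.norm_eq_one hu
  have star (w : W) (hw : ‖w‖ = 1) (hwu : ‖w + T u‖ = 2) :
      ‖w + T x‖ = 2 ∧ ‖w + T y‖ = 2 := by
    obtain ⟨q, hq, rfl⟩ := hT.antipodal.exists_eq hw
    simp only [hT.norm_antipodal_add hq hu1, hT.norm_antipodal_add hq hx1,
      hT.norm_antipodal_add hq hy1] at hwu ⊢
    obtain ⟨g, hg, hgq, hgu⟩ := exists_apply_eq_one_of_norm_add_eq_two hq hu1 hwu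
    have h₁ := apply_le_norm_of_opNorm_le_one hg x
    have h₂ := apply_le_norm_of_opNorm_le_one hg y
    simp only [hudef, map_add, map_smul, smul_eq_mul] at hgu
    exact ⟨norm_add_eq_two_of_apply_eq_one hg hq.le hx1.le hgq (by linarith),
      norm_add_eq_two_of_apply_eq_one hg hq.le hy1.le hgq (by linarith)⟩
  have key (z : V) (hz : z ∈ C) : ∃ g : W →L[ℝ] ℝ, ‖g‖ ≤ 1 ∧ g (-T (-z)) = 1 ∧
      g (s • T x + t • T y) = 1 := by
    have hz1 := hC.norm_eq_one hz
    obtain ⟨g, hg, hgx, hgy, hgz⟩ := exists_common_support (hT.norm_eq_one hu1)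
      (hT.norm_eq_one hx1) (hT.norm_eq_one hy1) (hT.antipodal.norm_eq_one hz1)
      (fun w hw h ↦ (star w hw h).1) (fun w hw h ↦ (star w hw h).2)
      ((hT.norm_antipodal_add hz1 hu1).trans (hC.norm_add hz hu))
    exact ⟨g, hg, hgz, by simp [hgx, hgy, hst]⟩
  have hle : ‖s • T x + t • T y‖ ≤ 1 := by
    refine (norm_add_le _ _).trans ?_
    rw [norm_smul, norm_smul, hT.norm_eq_one hx1, hT.norm_eq_one hy1, Real.norm_of_nonneg hs,
      Real.norm_of_nonneg ht]
    linarith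
  refine hT.mem_image_of_forall hC ?_ fun z hz ↦ ?_
  · obtain ⟨g, hg, -, hgv⟩ := key x hx
    exact le_antisymm hle (hgv ▸ apply_le_norm_of_opNorm_le_one hg _)
  · obtain ⟨g, hg, hgz, hgv⟩ := key z hz
    exact norm_add_eq_two_of_apply_eq_one hg
      (hT.antipodal.norm_eq_one (hC.norm_eq_one hz)).le hle hgz hgv

lemma antipodal_image_subset (hT : IsSphereIsometry T) {C : Set V} (hC : IsSaturatedConvex C) :
    (fun x ↦ -T (-x)) '' C ⊆ T '' C := by
  rintro _ ⟨x, hx, rfl⟩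
  exact hT.mem_image_of_forall hC (hT.antipodal.norm_eq_one (hC.norm_eq_one hx)) fun z hz ↦
    (hT.antipodal.convex_image hC).norm_add_eq_two
      (hT.antipodal.image_subset_sphere hC.subset_sphere) ⟨z, hz, rfl⟩ ⟨x, hx, rfl⟩

lemma isSaturatedConvex_image (hT : IsSphereIsometry T) {C : Set V}
    (hC : IsSaturatedConvex C) : IsSaturatedConvex (T '' C) where
  nonempty := hC.nonempty.image T
  convex := hT.convex_image hC
  subset_sphere := hT.image_subset_sphere hC.subset_sphere
  mem_of_forall v hv h := hT.mem_image_of_forall hC hv fun z hz ↦ by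
    rw [add_comm]
    exact h _ (hT.antipodal_image_subset hC ⟨z, hz, rfl⟩)

end IsSphereIsometry

variable [NormedSpace ℝ W]

lemma IsSphereIsometry.antipodal_image_intersectionFace_subset {T : V → W}
    (hT : IsSphereIsometry T) {F : Set V} (hF : IsIntersectionFace F) :
    (fun x ↦ -T (-x)) '' F ⊆ T '' F := by
  rintro _ ⟨x, hx, rfl⟩
  exact hT.mem_image_intersectionFace hF fun E hE hFE ↦
    hT.antipodal_image_subset hE.isSaturatedConvex ⟨x, hFE hx, rfl⟩

lemma IsSphereIsometry.image_neg_intersectionFace {T : V → W} (hT : IsSphereIsometry T)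
    {F : Set V} (hF : IsIntersectionFace F) : T '' (-F) = -(T '' F) := by
  have h : (fun x ↦ -T (-x)) '' F = T '' F :=
    (hT.antipodal_image_intersectionFace_subset hF).antisymm
      (by simpa using hT.antipodal.antipodal_image_intersectionFace_subset hF)
  rw [← h, ← Set.image_neg_eq_neg, ← Set.image_neg_eq_neg, Set.image_image, Set.image_image]
  simp

lemma IsSphereIsometry.isIntersectionFace_image {T : V → W} (hT : IsSphereIsometry T)
    {F : Set V} (hF : IsIntersectionFace F) : IsIntersectionFace (T '' F) := by
  have himage (E : Set V) (hE : IsMaximalFace E) : IsMaximalFace (T '' E) :=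
    (hT.isSaturatedConvex_image hE.isSaturatedConvex).isMaximalFace
  have hinter : T '' F = ⋂₀ {E | IsMaximalFace E ∧ T '' F ⊆ E} :=
    (Set.subset_sInter fun E hE ↦ hE.2).antisymm fun y hy ↦
      hT.mem_image_intersectionFace hF fun E hE hFE ↦
        hy _ ⟨himage E hE, Set.image_mono hFE⟩
  obtain ⟨E, hE, hFE⟩ := hF.exists_isMaximalFace
  refine ⟨?_, ⟨hF.2.1.1.image T, ?_, ?_⟩, hT.image_subset_sphere hF.2.2.1, hinter⟩
  · rw [hinter]
    exact isClosed_sInter fun G hG ↦ hG.1.isSaturatedConvex.isClosed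
  · rw [hinter]
    exact convex_sInter fun G hG ↦ hG.1.1.2.1
  · rw [hinter]
    exact isExtreme_sInter ⟨T '' E, himage E hE, Set.image_mono hFE⟩ fun G hG ↦ hG.1.1.2.2

end SphereIsometry

/-- If `T : S_X → S_Y` is a surjective isometry and `F ⊆ S_X` is an intersection face, then
`T(F)` is an intersection face with `T(-F) = -T(F)`; in particular there is `ψ` in the closed
unit ball of `Y*` with `ψ = 1` on `T(F)`. -/
theorem image_intersectionFace
    (Y : Type*) [NormedAddCommGroup Y] [NormedSpace ℝ Y]
    (T : X → Y)
    (hiso : ∀ x ∈ Metric.sphere (0 : X) 1, ∀ y ∈ Metric.sphere (0 : X) 1,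
      dist (T x) (T y) = dist x y)
    (hsurj : T '' Metric.sphere (0 : X) 1 = Metric.sphere (0 : Y) 1)
    (F : Set X) (hF : IsIntersectionFace F) :
    IsIntersectionFace (T '' F) ∧ T '' (-F) = -(T '' F) ∧
      ∃ ψ : Y →L[ℝ] ℝ, ‖ψ‖ ≤ 1 ∧ ∀ y ∈ T '' F, ψ y = 1 := by
  have hT : IsSphereIsometry T := ⟨hiso, hsurj⟩
  have h := hT.isIntersectionFace_image hF
  exact ⟨h, hT.image_neg_intersectionFace hF, h.2.1.2.1.exists_support h.2.2.1⟩
end
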